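/- Let m ≥ 2 and let G be a rooted graph with roots x_0, x_1 such that |V(G)| ≥ 4, λ_n(G) ≥ 3, λ_n^i(G) ≥ 4, and λ_s(G) ≥ m. Then G has no rooted immersion of D_m if and only if G has type A_m or type B_m. -/

import Mathlib

open scoped Classical

noncomputable section

namespace PaperW4

/-- A finite loopless undirected multigraph on ambient vertex type `V`:
a finite vertex set together with a multiset of (non-loop) edges supported on it. -/
structure MG (V : Type) where
  verts : Finset V
  edges : Multiset (Sym2 V)
  edge_support : ∀ e ∈ edges, ∀ v ∈ e, v ∈ verts
  loopless : ∀ e ∈ edges, ¬ e.IsDiag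

variable {V : Type} {W : Type}

/-- `δ_G(X)`: the edges of `G` with exactly one endpoint in `X`. -/
def cutEdges (G : MG V) (X : Finset V) : Multiset (Sym2 V) :=
  G.edges.filter fun e => ∃ u v, e = s(u, v) ∧ u ∈ X ∧ v ∉ X

/-- `d_G(X) = |δ_G(X)|`. -/
def dcut (G : MG V) (X : Finset V) : ℕ := (cutEdges G X).card

/-- The degree of a vertex: the number of edges incident with it. -/
def deg (G : MG V) (v : V) : ℕ := (G.edges.filter fun e => v ∈ e).card

/-- `e_G(u,v)`: the number of edges joining `u` and `v`. -/
def emult (G : MG V) (u v : V) : ℕ := G.edges.count s(u, v)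

/-- `G` is `k`-edge-connected: every edge-cut `δ(X)` with `∅ ≠ X ⊊ V(G)` has size `≥ k`. -/
def EdgeConn (G : MG V) (k : ℕ) : Prop :=
  ∀ X : Finset V, X ⊆ G.verts → X.Nonempty → X ≠ G.verts → k ≤ dcut G X

/-- `G` is internally `k`-edge-connected: every edge-cut with at least two vertices
on each side has size `≥ k`. -/
def InternallyEdgeConn (G : MG V) (k : ℕ) : Prop :=
  ∀ X : Finset V, X ⊆ G.verts → 2 ≤ X.card → 2 ≤ (G.verts \ X).card → k ≤ dcut G X

/-- Every vertex has degree three. -/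
def Cubic (G : MG V) : Prop := ∀ v ∈ G.verts, deg G v = 3

/-- The multiset of edges traversed by a walk, given as its list of vertices. -/
def walkEdges (l : List V) : Multiset (Sym2 V) :=
  (↑((l.zip l.tail).map fun p => s(p.1, p.2)) : Multiset (Sym2 V))

/-- `l` is (the vertex sequence of) a walk from `u` to `v`. -/
def IsWalk (l : List V) (u v : V) : Prop :=
  l.head? = some u ∧ l.getLast? = some v

/-- `G` is connected: any two of its vertices are joined by a trail in `G`. -/
def Connected (G : MG V) : Prop :=
  ∀ u ∈ G.verts, ∀ v ∈ G.verts,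
    ∃ l : List V, IsWalk l u v ∧ walkEdges l ≤ G.edges ∧ ∀ w ∈ l, w ∈ G.verts

/-- An immersion of the loopless multigraph with vertex type `W` and edge multiset `H`
into `G`, with terminal map `φ`: `φ` is injective, and to each edge `uv` of `H` is
assigned a walk in `G` from `φ u` to `φ v`, these walks being globally edge-disjoint. -/
def ImmersionVia (G : MG V) (H : Multiset (Sym2 W)) (φ : W → V) : Prop :=
  Function.Injective φ ∧ (∀ w : W, φ w ∈ G.verts) ∧
  ∃ P : Multiset (Sym2 W × List V),
    P.map Prod.fst = H ∧
    (∀ p ∈ P, ∃ u v : W, p.1 = s(u, v) ∧ IsWalk p.2 (φ u) (φ v)) ∧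
    (P.map fun p => walkEdges p.2).sum ≤ G.edges

/-- The edges of the wheel `W₄`: vertex `0` is the center, `1,2,3,4` the rim cycle. -/
def w4Edges : Multiset (Sym2 (Fin 5)) :=
  {s(0, 1), s(0, 2), s(0, 3), s(0, 4), s(1, 2), s(2, 3), s(3, 4), s(4, 1)}

/-- `G` has an immersion of `W₄`. -/
def HasW4Immersion (G : MG V) : Prop :=
  ∃ φ : Fin 5 → V, ImmersionVia G w4Edges φ

/-- `G` (rooted at `x`) has a rooted immersion of `W₄`: one in which the
center of `W₄` corresponds to `x`. -/
def HasRootedW4Immersion (G : MG V) (x : V) : Prop :=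
  ∃ φ : Fin 5 → V, φ 0 = x ∧ ImmersionVia G w4Edges φ

/-- The edges of `D_m`: roots are `0, 1`; vertices `2, 3` play the role of `y₀, y₁`;
there are `m - 2` parallel edges between the two roots. -/
def dmEdges (m : ℕ) : Multiset (Sym2 (Fin 4)) :=
  Multiset.replicate (m - 2) s(0, 1) + {s(0, 2), s(0, 3), s(1, 2), s(1, 3), s(2, 3)}

/-- `G` with roots `x0, x1` has a rooted immersion of `D_m`. -/
def HasRootedDmImmersion (G : MG V) (m : ℕ) (x0 x1 : V) : Prop :=
  ∃ φ : Fin 4 → V, φ 0 = x0 ∧ φ 1 = x1 ∧ ImmersionVia G (dmEdges m) φ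

/-- The edges of `K₄`. -/
def k4Edges : Multiset (Sym2 (Fin 4)) :=
  {s(0, 1), s(0, 2), s(0, 3), s(1, 2), s(1, 3), s(2, 3)}

/-- A nested chain of vertex sets `C 0 ⊂ C 1 ⊂ ⋯`, each obtained from the previous
by adding one vertex, all cuts having size exactly `k`. -/
def SegChain (G : MG V) (n : ℕ) (C : Fin (n + 1) → Finset V) (k : ℕ) : Prop :=
  (∀ i, C i ⊆ G.verts) ∧
  (∀ i : Fin n, C i.castSucc ⊆ C i.succ ∧ (C i.succ \ C i.castSucc).card = 1) ∧
  (∀ i, dcut G (C i) = k)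

/-- `G` has a segmentation of width `k` relative to `(X, Y)`. -/
def HasSegmentation (G : MG V) (X Y : Finset V) (k : ℕ) : Prop :=
  ∃ (n : ℕ) (C : Fin (n + 1) → Finset V),
    SegChain G n C k ∧ C 0 = X ∧ G.verts \ C (Fin.last n) = Y

/-- `λ_s(G) ≥ m`: every edge-cut separating `x0` from `x1` has size `≥ m`. -/
def LamSGe (G : MG V) (x0 x1 : V) (m : ℕ) : Prop :=
  ∀ X : Finset V, X ⊆ G.verts → x0 ∈ X → x1 ∉ X → m ≤ dcut G X

/-- `λ_n(G) ≥ m`: every edge-cut not separating `x0` from `x1` has size `≥ m`. -/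
def LamNGe (G : MG V) (x0 x1 : V) (m : ℕ) : Prop :=
  ∀ X : Finset V, X ⊆ G.verts → X.Nonempty → X ≠ G.verts →
    (x0 ∈ X ↔ x1 ∈ X) → m ≤ dcut G X

/-- `λ_n^i(G) ≥ m`: every internal edge-cut not separating `x0` from `x1` has size `≥ m`. -/
def LamNiGe (G : MG V) (x0 x1 : V) (m : ℕ) : Prop :=
  ∀ X : Finset V, X ⊆ G.verts → 2 ≤ X.card → 2 ≤ (G.verts \ X).card →
    (x0 ∈ X ↔ x1 ∈ X) → m ≤ dcut G X

/-- The subgraph of `G` induced on `S`. -/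
def induce (G : MG V) (S : Finset V) : MG V where
  verts := G.verts ∩ S
  edges := G.edges.filter fun e => ∀ v ∈ e, v ∈ S
  edge_support := by
    intro e he v hv
    rw [Multiset.mem_filter] at he
    exact Finset.mem_inter.mpr ⟨G.edge_support e he.1 v hv, he.2 v hv⟩
  loopless := fun e he => G.loopless e (Multiset.mem_of_mem_filter he)

/-- `G` with the vertices of `S` (and all incident edges) deleted. -/
def deleteVerts (G : MG V) (S : Finset V) : MG V := induce G (G.verts \ S)

/-- `C` is (the vertex set of) a connected component of `G`. -/
def IsComponent (G : MG V) (C : Finset V) : Prop :=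
  C ⊆ G.verts ∧ C.Nonempty ∧ Connected (induce G C) ∧
  ∀ e ∈ G.edges, (∃ v ∈ e, v ∈ C) → ∀ v ∈ e, v ∈ C

/-- `G` has type `A_m` with respect to roots `x0, x1`. -/
def TypeA (G : MG V) (m : ℕ) (x0 x1 : V) : Prop :=
  ∃ X0 X1 : Finset V, x0 ∈ X0 ∧ x1 ∈ X1 ∧ X0.card ≤ 2 ∧ X1.card ≤ 2 ∧
    HasSegmentation G X0 X1 m

/-- The edges of the lobe of `G` (with roots `x0, x1`) corresponding to the
component `C` of `G ∖ {x0, x1}`: edges inside `C ∪ {x0, x1}` other than `x0x1`-edges. -/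
def lobeEdges (G : MG V) (C : Finset V) (x0 x1 : V) : Multiset (Sym2 V) :=
  G.edges.filter fun e => (∀ v ∈ e, v ∈ insert x0 (insert x1 C)) ∧ e ≠ s(x0, x1)

/-- `G` has type `B_m` with respect to roots `x0, x1`. -/
def TypeB (G : MG V) (m : ℕ) (x0 x1 : V) : Prop :=
  ∃ (k : ℕ) (C : Fin k → Finset V) (nL : Fin k → ℕ),
    Function.Injective C ∧
    (∀ D : Finset V, IsComponent (deleteVerts G {x0, x1}) D ↔ ∃ i, C i = D) ∧
    (∀ i : Fin k, 2 ≤ nL i ∧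
      ∃ l : List V, l.Nodup ∧ IsWalk l x0 x1 ∧
        l.toFinset = insert x0 (insert x1 (C i)) ∧
        (2 ≤ (C i).card → nL i = 2) ∧
        lobeEdges G (C i) x0 x1 = nL i • walkEdges l) ∧
    emult G x0 x1 + ∑ i, nL i = m + 1

/-- The edge multiset of a cycle of length `n` on the vertices `f 0, f 1, …`. -/
def cycleEdges (n : ℕ) (f : Fin n → V) : Multiset (Sym2 V) :=
  (Finset.univ.val : Multiset (Fin n)).map fun i =>
    s(f i, f ⟨(i.val + 1) % n, Nat.mod_lt _ i.pos⟩)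

/-- `G` is a doubled cycle of length `n`. -/
def IsDoubledCycleLen (G : MG V) (n : ℕ) : Prop :=
  ∃ f : Fin n → V, Function.Injective f ∧ Finset.univ.image f = G.verts ∧
    G.edges = 2 • cycleEdges n f

/-- `G` is a doubled cycle. -/
def IsDoubledCycle (G : MG V) : Prop := ∃ n, 3 ≤ n ∧ IsDoubledCycleLen G n

/-- The map collapsing all of `Y` to the vertex `y0` and fixing everything else. -/
def collapseFun (Y : Finset V) (y0 : V) : V → V := fun v => if v ∈ Y then y0 else v

/-- The image multigraph of `G` under a vertex map `f` (identification of vertices),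
with any created loops deleted. -/
def mapGraph (f : V → V) (G : MG V) : MG V where
  verts := G.verts.image f
  edges := (G.edges.map (Sym2.map f)).filter fun e => ¬e.IsDiag
  edge_support := by
    intro e he v hv
    rw [Multiset.mem_filter] at he
    obtain ⟨he, -⟩ := he
    rw [Multiset.mem_map] at he
    obtain ⟨e', he', rfl⟩ := he
    rw [Sym2.mem_map] at hv
    obtain ⟨u, hu, rfl⟩ := hv
    exact Finset.mem_image_of_mem f (G.edge_support e' he' u hu)
  loopless := by
    intro e he
    rw [Multiset.mem_filter] at he
    exact he.2

/-- `G[X]` is a chain of sausages of order `k` in `G`: identifying `V(G) ∖ X` to a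
single vertex yields a doubled cycle of length `k + 1`. -/
def ChainOfSausages (G : MG V) (X : Finset V) (k : ℕ) : Prop :=
  X ⊆ G.verts ∧ X.card = k ∧ 2 ≤ k ∧
  ∃ y0 ∈ G.verts \ X,
    IsDoubledCycleLen (mapGraph (collapseFun (G.verts \ X) y0) G) (k + 1)

/-- `G` is sausage reduced: it has no chain of sausages of order at least `3`. -/
def SausageReduced (G : MG V) : Prop :=
  ¬ ∃ (X : Finset V) (k : ℕ), 3 ≤ k ∧ ChainOfSausages G X k

/-- One sausage shortening step of a rooted graph: two adjacent vertices of a chain of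
sausages of order at least three are identified, carrying the root along. -/
def RootedShortStep (p q : MG V × V) : Prop :=
  ∃ (X : Finset V) (k : ℕ) (a b : V),
    3 ≤ k ∧ ChainOfSausages p.1 X k ∧ a ∈ X ∧ b ∈ X ∧ a ≠ b ∧ s(a, b) ∈ p.1.edges ∧
    q.1 = mapGraph (fun v => if v = b then a else v) p.1 ∧
    q.2 = (if p.2 = b then a else p.2)

/-- Deleting a single copy of the edge `e` from `G`. -/
def deleteEdge (G : MG V) (e : Sym2 V) : MG V where
  verts := G.verts
  edges := G.edges.erase e
  edge_support := fun e' he' => G.edge_support e' (Multiset.mem_of_mem_erase he')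
  loopless := fun e' he' => G.loopless e' (Multiset.mem_of_mem_erase he')

/-- `G` has a tree-decomposition of width at most `k`. -/
def HasTreeDecomp (G : MG V) (k : ℕ) : Prop :=
  ∃ (ι : Type) (T : SimpleGraph ι) (B : ι → Finset V),
    T.IsTree ∧
    (∀ t, B t ⊆ G.verts) ∧
    (∀ v ∈ G.verts, ∃ t, v ∈ B t) ∧
    (∀ e ∈ G.edges, ∃ t, ∀ v ∈ e, v ∈ B t) ∧
    (∀ v ∈ G.verts, (SimpleGraph.induce {t | v ∈ B t} T).Connected) ∧
    ∀ t, (B t).card ≤ k + 1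

/-- The tree-width of `G`. -/
def treewidth (G : MG V) : ℕ := sInf { k | HasTreeDecomp G k }

/-- One subdivision step: an edge `uv` is replaced by a path `u - w - v`
through a new vertex `w`. -/
def SubdivStep (G H : MG V) : Prop :=
  ∃ u v w : V, s(u, v) ∈ G.edges ∧ w ∉ G.verts ∧
    H.verts = insert w G.verts ∧
    H.edges = (G.edges.erase s(u, v)) + {s(u, w), s(w, v)}

/-- `H` is a subdivision of `G`. -/
def IsSubdivision (G H : MG V) : Prop := Relation.ReflTransGen SubdivStep G H

/-- `G`, rooted at `u`, has type 2 (for the rooted `W₄` theorem). -/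
def TypeTwo (G : MG V) (u : V) : Prop :=
  ∃ W0 : Finset V, W0 ⊆ G.verts ∧ u ∉ W0 ∧ 1 ≤ W0.card ∧ W0.card ≤ 2 ∧
    ∃ w0 ∈ W0,
      ∃ n : ℕ, 3 ≤ n ∧
        ∃ f : Fin n → V,
          Function.Injective f ∧
          Finset.univ.image f = (mapGraph (collapseFun W0 w0) G).verts ∧
          (∃ i, f i = u) ∧ (∃ j, f j = w0) ∧
          ((s(u, w0) ∉ cycleEdges n f ∧
              (mapGraph (collapseFun W0 w0) G).edges =
                2 • cycleEdges n f + {s(u, w0)}) ∨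
           (∃ v : V, s(u, v) ∈ cycleEdges n f ∧ s(v, w0) ∈ cycleEdges n f ∧
              (mapGraph (collapseFun W0 w0) G).edges =
                2 • cycleEdges n f + {s(u, v), s(v, w0)}) ∨
           (s(u, w0) ∈ cycleEdges n f ∧
              (mapGraph (collapseFun W0 w0) G).edges =
                2 • cycleEdges n f + {s(u, w0)}))

/-! ### Walks and connectivity -/

@[simp] lemma walkEdges_nil : walkEdges ([] : List V) = 0 := rfl

@[simp] lemma walkEdges_singleton (a : V) : walkEdges [a] = 0 := rfl

@[simp] lemma walkEdges_cons_cons (a b : V) (l : List V) :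
    walkEdges (a :: b :: l) = s(a, b) ::ₘ walkEdges (b :: l) := rfl

lemma walkEdges_append (p s : List V) (y : V) :
    walkEdges (p ++ y :: s) = walkEdges (p ++ [y]) + walkEdges (y :: s) := by
  induction p with
  | nil => simp
  | cons a p ih =>
    cases p with
    | nil => simp
    | cons b p => simpa using ih

lemma walkEdges_concat (l : List V) (a b : V) :
    walkEdges (l ++ [a, b]) = walkEdges (l ++ [a]) + {s(a, b)} := by
  rw [walkEdges_append]
  simp

lemma walkEdges_reverse (l : List V) : walkEdges l.reverse = walkEdges l := by
  induction l with
  | nil => rfl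
  | cons a l ih =>
    cases l with
    | nil => rfl
    | cons b l =>
      rw [walkEdges_cons_cons, ← ih]
      simp only [List.reverse_cons, List.append_assoc, List.cons_append, List.nil_append]
      rw [walkEdges_concat, add_comm, Multiset.singleton_add, Sym2.eq_swap]

lemma mem_of_mem_walkEdges {l : List V} {e : Sym2 V} {v : V} (he : e ∈ walkEdges l)
    (hv : v ∈ e) : v ∈ l := by
  induction l with
  | nil => simp at he
  | cons a l ih =>
    cases l with
    | nil => simp at he
    | cons b l =>
      rw [walkEdges_cons_cons, Multiset.mem_cons] at he
      rcases he with rfl | he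
      · rcases Sym2.mem_iff.1 hv with rfl | rfl <;> simp
      · exact List.mem_cons_of_mem _ (ih he)

lemma walkEdges_nodup {l : List V} (hl : l.Nodup) : (walkEdges l).Nodup := by
  induction l with
  | nil => simp
  | cons a l ih =>
    cases l with
    | nil => simp
    | cons b l =>
      rw [walkEdges_cons_cons, Multiset.nodup_cons]
      rw [List.nodup_cons] at hl
      exact ⟨fun h => hl.1 (mem_of_mem_walkEdges h (by simp)), ih hl.2⟩

/-- `u` and `v` are joined by a walk using only edges of `A`. -/
def Cn (A : Multiset (Sym2 V)) (u v : V) : Prop :=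
  Relation.ReflTransGen (fun a b => s(a, b) ∈ A) u v

namespace Cn

variable {A B : Multiset (Sym2 V)} {u v w : V}

lemma refl (A : Multiset (Sym2 V)) (u : V) : Cn A u u := Relation.ReflTransGen.refl

lemma symm (h : Cn A u v) : Cn A v u := by
  have : Std.Symm fun a b => s(a, b) ∈ A := ⟨fun a b hab => by rwa [Sym2.eq_swap]⟩
  exact Relation.ReflTransGen.stdSymm.symm _ _ h

lemma trans (h : Cn A u v) (h' : Cn A v w) : Cn A u w := Relation.ReflTransGen.trans h h'

lemma of_mem (h : s(u, v) ∈ A) : Cn A u v := Relation.ReflTransGen.single h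

lemma mono_subset (h : Cn A u v) (hAB : A ⊆ B) : Cn B u v :=
  Relation.ReflTransGen.mono (fun _ _ h => hAB h) _ _ h

lemma mono (h : Cn A u v) (hAB : A ≤ B) : Cn B u v :=
  h.mono_subset (Multiset.subset_of_le hAB)

lemma left (h : Cn A u v) (B : Multiset (Sym2 V)) : Cn (A + B) u v :=
  h.mono (Multiset.le_add_right _ _)

lemma right (h : Cn B u v) (A : Multiset (Sym2 V)) : Cn (A + B) u v :=
  h.mono (Multiset.le_add_left _ _)

lemma trans_add (h : Cn A u v) (h' : Cn B v w) : Cn (A + B) u w :=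
  (h.left B).trans (h'.right A)

lemma of_walk {l : List V} (hu : u ∈ l) (hv : v ∈ l) : Cn (walkEdges l) u v := by
  have key : ∀ (l : List V) (a v : V), v ∈ a :: l → Cn (walkEdges (a :: l)) a v := by
    intro l
    induction l with
    | nil => intro a v hv; simp at hv; subst hv; exact refl _ _
    | cons b l ih =>
      intro a v hv
      rcases List.mem_cons.1 hv with rfl | hv
      · exact refl _ _
      · refine (of_mem (by simp)).trans ((ih b v hv).mono ?_)
        simp [Multiset.le_cons_self]
  cases l with
  | nil => simp at hu
  | cons a l => exact (key l a u hu).symm.trans (key l a v hv)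

lemma exists_path (h : Cn A u v) :
    ∃ l : List V, l.Nodup ∧ IsWalk l u v ∧ walkEdges l ≤ A := by
  induction h using Relation.ReflTransGen.head_induction_on with
  | refl => exact ⟨[v], by simp, ⟨rfl, rfl⟩, by simp⟩
  | @head a c hac _ ih =>
    obtain ⟨l, hl, hw, hle⟩ := ih
    by_cases ha : a ∈ l
    · obtain ⟨p, q, rfl⟩ := List.append_of_mem ha
      refine ⟨a :: q, (List.nodup_append.1 hl).2.1, ⟨rfl, ?_⟩, le_trans ?_ hle⟩
      · simpa [List.getLast?_append] using hw.2
      · rw [walkEdges_append]; exact Multiset.le_add_left _ _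
    · cases l with
      | nil => simp [IsWalk] at hw
      | cons b l =>
        obtain rfl : b = c := by simpa using hw.1
        have hnd : (a :: b :: l).Nodup := List.nodup_cons.2 ⟨ha, hl⟩
        refine ⟨a :: b :: l, hnd, ⟨rfl, ?_⟩, ?_⟩
        · simpa [List.getLast?_cons_cons] using hw.2
        · refine (Multiset.le_iff_subset (walkEdges_nodup hnd)).2 ?_
          rw [walkEdges_cons_cons, Multiset.cons_subset]
          exact ⟨hac, Multiset.subset_of_le hle⟩

lemma of_isWalk {l : List V} (h : IsWalk l u v) (hl : walkEdges l ≤ A) : Cn A u v :=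
  (of_walk (List.mem_of_mem_head? h.1) (List.mem_of_mem_getLast? h.2)).mono hl

lemma exists_path_of_ne (h : Cn A u v) (huv : u ≠ v) :
    ∃ w : List V, (u :: (w ++ [v])).Nodup ∧ walkEdges (u :: (w ++ [v])) ≤ A := by
  obtain ⟨l, hl, hw, hle⟩ := h.exists_path
  cases l with
  | nil => simp [IsWalk] at hw
  | cons a l =>
    obtain rfl : a = u := by simpa using hw.1
    rcases List.eq_nil_or_concat l with rfl | ⟨w, b, rfl⟩
    · exact absurd (by simpa using hw.2) huv
    · have hb := hw.2
      rw [List.concat_eq_append] at *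
      rw [show a :: (w ++ [b]) = (a :: w) ++ [b] from rfl, List.getLast?_append] at hb
      obtain rfl : b = v := by simpa using hb
      exact ⟨w, hl, hle⟩

end Cn

/-! ### Cuts -/

/-- The edge `e` has exactly one end in `X`. -/
def crosses (X : Set V) (e : Sym2 V) : Prop := ∃ u v, e = s(u, v) ∧ u ∈ X ∧ v ∉ X

lemma crosses_mk {X : Set V} {u v : V} :
    crosses X s(u, v) ↔ (u ∈ X ∧ v ∉ X) ∨ (v ∈ X ∧ u ∉ X) := by
  constructor
  · rintro ⟨a, b, h, ha, hb⟩
    rcases Sym2.eq_iff.1 h with ⟨rfl, rfl⟩ | ⟨rfl, rfl⟩ <;> simp_all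
  · rintro (⟨hu, hv⟩ | ⟨hv, hu⟩)
    · exact ⟨u, v, rfl, hu, hv⟩
    · exact ⟨v, u, Sym2.eq_swap, hv, hu⟩

/-- The number of edges of `E` with exactly one end in `X`. -/
def cut (E : Multiset (Sym2 V)) (X : Set V) : ℕ := E.countP (crosses X)

@[simp] lemma cut_zero (X : Set V) : cut 0 X = 0 := Multiset.countP_zero _

lemma cut_add (A B : Multiset (Sym2 V)) (X : Set V) : cut (A + B) X = cut A X + cut B X :=
  Multiset.countP_add _ _ _

lemma cut_cons (e : Sym2 V) (A : Multiset (Sym2 V)) (X : Set V) :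
    cut (e ::ₘ A) X = cut A X + if crosses X e then 1 else 0 := Multiset.countP_cons _ _ _

lemma cut_mono {A B : Multiset (Sym2 V)} (h : A ≤ B) (X : Set V) : cut A X ≤ cut B X :=
  Multiset.countP_le_of_le _ h

lemma cut_pos_iff {E : Multiset (Sym2 V)} {X : Set V} :
    0 < cut E X ↔ ∃ e ∈ E, crosses X e := Multiset.countP_pos

lemma cut_eq_zero_iff {E : Multiset (Sym2 V)} {X : Set V} :
    cut E X = 0 ↔ ∀ e ∈ E, ¬ crosses X e := Multiset.countP_eq_zero

lemma cut_compl (E : Multiset (Sym2 V)) (X : Set V) : cut E Xᶜ = cut E X := by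
  refine Multiset.countP_congr rfl fun e _ => ?_
  induction e with | _ u v => simp only [crosses_mk, Set.mem_compl_iff, eq_iff_iff]; tauto

lemma cut_submod (E : Multiset (Sym2 V)) (X Y : Set V) :
    cut E (X ∩ Y) + cut E (X ∪ Y) ≤ cut E X + cut E Y := by
  induction E using Multiset.induction with
  | empty => simp
  | cons e E ih =>
    induction e with | _ u v =>
    simp only [cut_cons, crosses_mk, Set.mem_inter_iff, Set.mem_union]
    by_cases h1 : u ∈ X <;> by_cases h2 : u ∈ Y <;> by_cases h3 : v ∈ X <;>
      by_cases h4 : v ∈ Y <;> simp [h1, h2, h3, h4] <;> omega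

lemma Cn.cut_pos {A : Multiset (Sym2 V)} {u v : V} (h : Cn A u v) {X : Set V} (hu : u ∈ X)
    (hv : v ∉ X) : 0 < cut A X := by
  by_contra h0
  have h0 : cut A X = 0 := by omega
  rw [cut_eq_zero_iff] at h0
  have key : ∀ w, Cn A u w → w ∈ X := by
    intro w hw
    induction hw with
    | refl => exact hu
    | tail _ hbc ih =>
      by_contra hc
      exact h0 _ hbc (crosses_mk.2 (Or.inl ⟨ih, hc⟩))
  exact hv (key v h)

lemma Cn.cut_pos' {A : Multiset (Sym2 V)} {u v : V} (h : Cn A u v) {X : Set V} (hu : u ∉ X)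
    (hv : v ∈ X) : 0 < cut A X := h.symm.cut_pos hv hu

lemma dcut_eq_cut (G : MG V) (X : Finset V) : dcut G X = cut G.edges (X : Set V) := by
  rw [dcut, cutEdges, cut, Multiset.countP_eq_card_filter]
  congr

/-! ### Menger's theorem for walks ending in a set of sinks -/

/-- There are edge-disjoint walks in `E`, one from each member of `Y` to a member of `R`. -/
def Route (R : Set V) (Y : Multiset V) (E : Multiset (Sym2 V)) : Prop :=
  ∃ P : Multiset (V × Multiset (Sym2 V)), P.map Prod.fst = Y ∧ (P.map Prod.snd).sum ≤ E ∧
    ∀ p ∈ P, ∃ r ∈ R, Cn p.2 p.1 r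

lemma Route.mono {R : Set V} {Y : Multiset V} {E E' : Multiset (Sym2 V)} (h : Route R Y E)
    (hE : E ≤ E') : Route R Y E' := by
  obtain ⟨P, h1, h2, h3⟩ := h
  exact ⟨P, h1, h2.trans hE, h3⟩

lemma Route.cons {R : Set V} {Y : Multiset V} {E : Multiset (Sym2 V)} {v : V}
    (h : Route R (v ::ₘ Y) E) :
    ∃ A B r, A + B = E ∧ r ∈ R ∧ Cn A v r ∧ Route R Y B := by
  obtain ⟨P, h1, h2, h3⟩ := h
  obtain ⟨p, hp, hpv, hP⟩ := (Multiset.map_eq_cons _ _ _ _).2 h1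
  obtain ⟨Q, rfl⟩ := Multiset.exists_cons_of_mem hp
  rw [Multiset.erase_cons_head] at hP
  rw [Multiset.map_cons, Multiset.sum_cons] at h2
  obtain ⟨r, hr, hc⟩ := h3 p (by simp)
  obtain ⟨D, rfl⟩ := Multiset.le_iff_exists_add.1 h2
  refine ⟨p.2, (Q.map Prod.snd).sum + D, r, by rw [add_assoc], hr, hpv ▸ hc, Q, hP, ?_, ?_⟩
  · exact Multiset.le_add_right _ _
  · exact fun q hq => h3 q (Multiset.mem_cons_of_mem hq)

lemma Route.move {R : Set V} {Y : Multiset V} {E : Multiset (Sym2 V)} {x z : V}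
    (h : Route R (z ::ₘ Y) E) : Route R (x ::ₘ Y) (s(x, z) ::ₘ E) := by
  obtain ⟨A, B, r, rfl, hr, hA, P, h1, h2, h3⟩ := h.cons
  refine ⟨(x, s(x, z) ::ₘ A) ::ₘ P, by simp [h1], ?_, ?_⟩
  · simp only [Multiset.map_cons, Multiset.sum_cons, Multiset.cons_add]
    exact (Multiset.cons_le_cons_iff _).2 (add_le_add_right h2 _)
  · intro p hp
    rcases Multiset.mem_cons.1 hp with rfl | hp
    · exact ⟨r, hr, (Cn.of_mem (by simp)).trans (hA.mono (Multiset.le_cons_self _ _))⟩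
    · exact h3 p hp

lemma cut_insert_add_two_le {E : Multiset (Sym2 V)} {x z : V} {X : Set V} (he : s(x, z) ∈ E)
    (hz : z ∈ X) (hx : x ∉ X) : cut E (insert x X) + 2 ≤ cut E X + cut E {x} := by
  obtain ⟨E, rfl⟩ := Multiset.exists_cons_of_mem he
  have h := cut_submod E {x} X
  have hxz : z ≠ x := by rintro rfl; exact hx hz
  rw [show ({x} : Set V) ∪ X = insert x X from rfl] at h
  simp only [cut_cons, crosses_mk]
  simp [hz, hx, hxz]
  omega

lemma cut_eq_add_of_no_inner {E : Multiset (Sym2 V)} {X : Set V} {x : V} (hx : x ∈ X)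
    (h : ∀ u v, s(u, v) ∈ E → u ∈ X → v ∉ X) :
    cut E X = cut E (X \ {x}) + cut E {x} := by
  induction E using Multiset.induction with
  | empty => simp
  | cons e E ih =>
    have ih := ih fun u v huv => h u v (Multiset.mem_cons_of_mem huv)
    induction e with | _ u v =>
    have h1 := h u v (by simp)
    have h2 := h v u (by rw [Sym2.eq_swap]; simp)
    simp only [cut_cons, crosses_mk, ih, Set.mem_sdiff, Set.mem_singleton_iff]
    by_cases h3 : u = x
    · subst h3
      have : v ∉ X := h1 hx
      have hvu : v ≠ u := by rintro rfl; exact this hx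
      simp [hx, this, hvu]; omega
    · by_cases h4 : v = x
      · subst h4
        have : u ∉ X := h2 hx
        simp [hx, this, h3]; omega
      · by_cases h5 : u ∈ X
        · have := h1 h5; simp [h3, h4, h5, this]; omega
        · simp [h3, h4, h5]; omega

/-- The number of members of `Y` lying in `X`. -/
def tok (Y : Multiset V) (X : Set V) : ℕ := Y.countP (· ∈ X)

lemma tok_cons (a : V) (Y : Multiset V) (X : Set V) :
    tok (a ::ₘ Y) X = tok Y X + if a ∈ X then 1 else 0 := Multiset.countP_cons _ _ _

@[simp] lemma tok_zero (X : Set V) : tok 0 X = 0 := Multiset.countP_zero _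

@[simp] lemma tok_empty (Y : Multiset V) : tok Y ∅ = 0 := by simp [tok]

lemma tok_inter_add_tok_union (Y : Multiset V) (A B : Set V) :
    tok Y (A ∩ B) + tok Y (A ∪ B) = tok Y A + tok Y B := by
  induction Y using Multiset.induction with
  | empty => simp
  | cons a Y ih =>
    simp only [tok_cons, Set.mem_inter_iff, Set.mem_union] at ih ⊢
    by_cases hA : a ∈ A <;> by_cases hB : a ∈ B <;> simp [hA, hB] <;> omega

theorem route_of_cut (R : Set V) (Y : Multiset V) (E : Multiset (Sym2 V))
    (h : ∀ X : Set V, Disjoint X R → tok Y X ≤ cut E X) : Route R Y E := by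
  induction hn : E.card using Nat.strong_induction_on generalizing E Y with
  | _ n ih =>
  by_cases h1 : ∃ e ∈ E, ∀ X : Set V, Disjoint X R → tok Y X ≤ cut (E.erase e) X
  · obtain ⟨e, he, h1⟩ := h1
    refine (ih _ ?_ Y (E.erase e) h1 rfl).mono (Multiset.erase_le _ _)
    rw [← hn]; exact Multiset.card_erase_lt_of_mem he
  push Not at h1
  have tight : ∀ e ∈ E, ∃ X : Set V, Disjoint X R ∧ cut E X = tok Y X ∧
      crosses X e := by
    intro e he
    obtain ⟨X, hX, hlt⟩ := h1 e he
    refine ⟨X, hX, ?_⟩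
    have h2 := h X hX
    obtain ⟨E', rfl⟩ := Multiset.exists_cons_of_mem he
    rw [Multiset.erase_cons_head] at hlt
    rw [cut_cons] at h2 ⊢
    by_cases hc : crosses X e
    · simp only [hc, if_true, and_true] at h2 ⊢; omega
    · simp only [hc, if_false] at h2; omega
  by_cases hE : E = 0
  · subst hE
    refine ⟨Y.map fun v => (v, 0), by simp, by simp, ?_⟩
    intro p hp
    obtain ⟨v, hv, rfl⟩ := Multiset.mem_map.1 hp
    refine ⟨v, ?_, Cn.refl _ _⟩
    by_contra hvR
    have := h {v} (by simpa using hvR)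
    rw [cut_zero, Nat.le_zero, tok, Multiset.countP_eq_zero] at this
    exact this v hv rfl
  let inn : Set V → ℕ := fun X => E.countP fun e => ∀ v ∈ e, v ∈ X
  have hex : ∃ n, ∃ X : Set V, Disjoint X R ∧ cut E X = tok Y X ∧
      (∃ e ∈ E, crosses X e) ∧ inn X = n := by
    obtain ⟨e, he⟩ := Multiset.exists_mem_of_ne_zero hE
    obtain ⟨X, hX, ht, hc⟩ := tight e he
    exact ⟨_, X, hX, ht, ⟨e, he, hc⟩, rfl⟩
  obtain ⟨X, hXR, hXt, ⟨e, he, hec⟩, hXn⟩ := Nat.find_spec hex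
  have hmod := tok_inter_add_tok_union Y
  have hinner : ∀ u v, s(u, v) ∈ E → u ∈ X → v ∉ X := by
    intro u v huv hu hv
    obtain ⟨Z, hZR, hZt, hZc⟩ := tight _ huv
    have hi : Disjoint (X ∩ Z) R := hXR.mono_left Set.inter_subset_left
    have hun : Disjoint (X ∪ Z) R := Set.disjoint_union_left.2 ⟨hXR, hZR⟩
    have a1 := h _ hi
    have a2 := h _ hun
    have a3 := cut_submod E X Z
    have a4 := hmod X Z
    have hlt : inn (X ∩ Z) < inn X := by
      obtain ⟨E', hE'⟩ := Multiset.exists_cons_of_mem huv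
      simp only [inn, hE', Multiset.countP_cons]
      have b1 : E'.countP (fun e => ∀ v ∈ e, v ∈ X ∩ Z) ≤ E'.countP fun e => ∀ v ∈ e, v ∈ X :=
        by
          rw [Multiset.countP_eq_card_filter, Multiset.countP_eq_card_filter]
          exact Multiset.card_le_card (Multiset.monotone_filter_right _
            fun e hb w hw => (hb w hw).1)
      have b2 : ¬ ∀ w ∈ s(u, v), w ∈ X ∩ Z := by
        intro hall
        rcases crosses_mk.1 hZc with ⟨_, hb⟩ | ⟨_, hb⟩
        · exact hb (hall v (by simp)).2
        · exact hb (hall u (by simp)).2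
      have b3 : ∀ w ∈ s(u, v), w ∈ X := by simp [hu, hv]
      rw [if_neg b2, if_pos b3]
      omega
    refine Nat.find_min hex (m := inn (X ∩ Z)) (hXn ▸ hlt) ⟨X ∩ Z, hi, by omega, ?_, rfl⟩
    refine ⟨_, huv, crosses_mk.2 ?_⟩
    rcases crosses_mk.1 hZc with ⟨ha, hb⟩ | ⟨ha, hb⟩
    · exact Or.inl ⟨⟨hu, ha⟩, fun hc => hb hc.2⟩
    · exact Or.inr ⟨⟨hv, ha⟩, fun hc => hb hc.2⟩
  obtain ⟨x, z, rfl, hx, hz⟩ := hec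
  have c1 := cut_eq_add_of_no_inner hx hinner
  have c2 := hmod (X \ {x}) {x}
  have c3 := h (X \ {x}) (hXR.mono_left Set.sdiff_subset)
  have c4 := h {x} (hXR.mono_left (by simpa using hx))
  rw [Set.sdiff_inter_self, Set.sdiff_union_self,
    Set.union_eq_self_of_subset_right (Set.singleton_subset_iff.2 hx)] at c2
  rw [tok_empty, zero_add] at c2
  have hxt : cut E {x} = tok Y {x} := by omega
  have hzx : z ≠ x := by rintro rfl; exact hz hx
  have hpos : 0 < cut E {x} :=
    cut_pos_iff.2 ⟨_, he, crosses_mk.2 (Or.inl ⟨rfl, hzx⟩)⟩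
  have hxY : x ∈ Y := by
    rw [hxt, tok, Multiset.countP_pos] at hpos
    obtain ⟨y, hy, rfl⟩ := hpos
    exact hy
  obtain ⟨Y, rfl⟩ := Multiset.exists_cons_of_mem hxY
  have hmove : Route R (z ::ₘ Y) (E.erase s(x, z)) := by
    refine ih _ ?_ _ _ ?_ rfl
    · rw [← hn]; exact Multiset.card_erase_lt_of_mem he
    intro S hS
    have d1 := h S hS
    have d2 : z ∈ S → x ∉ S → tok (x ::ₘ Y) S + 2 ≤ cut E S := by
      intro hzS hxS
      have e1 := cut_insert_add_two_le he hzS hxS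
      have e2 := h (insert x S)
        (Set.disjoint_insert_left.2 ⟨fun hxR => Set.disjoint_left.1 hXR hx hxR, hS⟩)
      have e3 := hmod {x} S
      rw [show ({x} : Set V) ∪ S = insert x S from rfl, Set.singleton_inter_eq_empty.2 hxS] at e3
      rw [tok_empty, zero_add] at e3
      omega
    obtain ⟨E', hE'⟩ := Multiset.exists_cons_of_mem he
    rw [hE'] at d1 d2 ⊢
    rw [Multiset.erase_cons_head]
    rw [cut_cons, crosses_mk] at d1 d2
    rw [tok_cons] at d1 d2 ⊢
    by_cases h5 : x ∈ S <;> by_cases h6 : z ∈ S <;> simp [h5, h6] at d1 d2 ⊢ <;> omega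
  have := hmove.move (x := x)
  rwa [Multiset.cons_erase he] at this

/-! ### Edge-disjoint packings of walks -/

/-- `E` contains edge-disjoint walks joining the pairs listed in `D`. -/
def Pack : List (V × V) → Multiset (Sym2 V) → Prop
  | [], _ => True
  | d :: D, E => ∃ A B, A + B = E ∧ Cn A d.1 d.2 ∧ Pack D B

namespace Pack

lemma mono {D : List (V × V)} {E E' : Multiset (Sym2 V)} (h : Pack D E) (hE : E ≤ E') :
    Pack D E' := by
  induction D generalizing E E' with
  | nil => trivial
  | cons d D ih =>
    obtain ⟨A, B, rfl, hA, hB⟩ := h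
    obtain ⟨C, rfl⟩ := Multiset.le_iff_exists_add.1 hE
    exact ⟨A, B + C, by rw [add_assoc], hA, ih hB (Multiset.le_add_right _ _)⟩

lemma cons {D : List (V × V)} {A B : Multiset (Sym2 V)} {u v : V} (hA : Cn A u v)
    (hB : Pack D B) : Pack ((u, v) :: D) (A + B) := ⟨A, B, rfl, hA, hB⟩

lemma append {D D' : List (V × V)} {A B : Multiset (Sym2 V)} (hA : Pack D A) (hB : Pack D' B) :
    Pack (D ++ D') (A + B) := by
  induction D generalizing A with
  | nil => exact hB.mono (Multiset.le_add_left _ _)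
  | cons d D ih =>
    obtain ⟨A1, A2, rfl, h1, h2⟩ := hA
    exact ⟨A1, A2 + B, by rw [add_assoc], h1, ih h2⟩

lemma split {D D' : List (V × V)} {E : Multiset (Sym2 V)} (h : Pack (D ++ D') E) :
    ∃ A B, A + B = E ∧ Pack D A ∧ Pack D' B := by
  induction D generalizing E with
  | nil => exact ⟨0, E, by simp, trivial, h⟩
  | cons d D ih =>
    obtain ⟨A1, A2, rfl, h1, h2⟩ := h
    obtain ⟨B1, B2, rfl, h3, h4⟩ := ih h2
    exact ⟨A1 + B1, B2, by rw [add_assoc], ⟨A1, B1, rfl, h1, h3⟩, h4⟩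

lemma perm {D D' : List (V × V)} {E : Multiset (Sym2 V)} (hD : D.Perm D') (h : Pack D E) :
    Pack D' E := by
  induction hD generalizing E with
  | nil => exact h
  | cons d _ ih =>
    obtain ⟨A, B, rfl, hA, hB⟩ := h
    exact ⟨A, B, rfl, hA, ih hB⟩
  | swap d d' _ =>
    obtain ⟨A, _, rfl, hA, B, C, rfl, hB, hC⟩ := h
    exact ⟨B, A + C, by abel, hB, A, C, rfl, hA, hC⟩
  | trans _ _ ih1 ih2 => exact ih2 (ih1 h)

lemma subst {D : List (V × V)} {E C : Multiset (Sym2 V)} {u v : V}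
    (h : Pack D (s(u, v) ::ₘ E)) (hC : Cn C u v) : Pack D (E + C) := by
  induction D generalizing E with
  | nil => trivial
  | cons d D ih =>
    obtain ⟨A, B, hAB, hA, hB⟩ := h
    have hmem : s(u, v) ∈ A + B := by rw [hAB]; simp
    rcases Multiset.mem_add.1 hmem with hm | hm
    · obtain ⟨A, rfl⟩ := Multiset.exists_cons_of_mem hm
      rw [Multiset.cons_add, Multiset.cons_inj_right] at hAB
      subst hAB
      refine ⟨A + C, B, by abel, ?_, hB⟩
      have key : ∀ w, Cn (s(u, v) ::ₘ A) d.1 w → Cn (A + C) d.1 w := by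
        intro w hw
        induction hw with
        | refl => exact Cn.refl _ _
        | tail _ hbc ih =>
          refine ih.trans ?_
          rcases Multiset.mem_cons.1 hbc with hbc | hbc
          · rcases Sym2.eq_iff.1 hbc with ⟨rfl, rfl⟩ | ⟨rfl, rfl⟩
            · exact hC.right _
            · exact hC.symm.right _
          · exact (Cn.of_mem hbc).left _
      exact key _ hA
    · obtain ⟨B, rfl⟩ := Multiset.exists_cons_of_mem hm
      rw [Multiset.add_cons, Multiset.cons_inj_right] at hAB
      subst hAB
      exact ⟨A, B + C, by abel, hA, ih hB⟩

end Pack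

/-- The pairs of vertices joined by the edges of `D_m`. -/
def dmPairs (m : ℕ) (x0 x1 y0 y1 : V) : List (V × V) :=
  [(x0, y0), (x0, y1), (x1, y0), (x1, y1), (y0, y1)] ++ List.replicate (m - 2) (x0, x1)

/-- `E` contains edge-disjoint walks forming an immersion of `D_m` rooted at `x0, x1` whose
other two terminals lie in `U`. -/
def Dm (E : Multiset (Sym2 V)) (m : ℕ) (x0 x1 : V) (U : Set V) : Prop :=
  ∃ y0 ∈ U, ∃ y1 ∈ U, y0 ≠ y1 ∧ Pack (dmPairs m x0 x1 y0 y1) E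

lemma pack_replicate {C : Multiset (Multiset (Sym2 V))} {x0 x1 : V} {n : ℕ}
    (hC : ∀ c ∈ C, Cn c x0 x1) (hn : n ≤ C.card) : Pack (List.replicate n (x0, x1)) C.sum := by
  induction n generalizing C with
  | zero => trivial
  | succ n ih =>
    obtain ⟨c, hc⟩ := Multiset.card_pos_iff_exists_mem.1 (by omega : 0 < C.card)
    obtain ⟨C, rfl⟩ := Multiset.exists_cons_of_mem hc
    rw [Multiset.sum_cons, List.replicate_succ]
    exact Pack.cons (hC c hc) (ih (fun c hc => hC c (Multiset.mem_cons_of_mem hc))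
      (by simpa using hn))

/-- `A` splits into walks from `y` to `x0` and to `x1`. -/
def Legs (x0 x1 : V) (A : Multiset (Sym2 V)) (y : V) : Prop :=
  ∃ A1 A2, A1 + A2 = A ∧ Cn A1 y x0 ∧ Cn A2 y x1

lemma dm_of_legs {A B Q E : Multiset (Sym2 V)} {C : Multiset (Multiset (Sym2 V))}
    {m : ℕ} {x0 x1 y0 y1 : V} {U : Set V} (h0 : Legs x0 x1 A y0) (h1 : Legs x0 x1 B y1)
    (hQ : Cn Q y0 y1) (hC : ∀ c ∈ C, Cn c x0 x1) (hm : m - 2 ≤ C.card)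
    (hE : A + B + Q + C.sum ≤ E) (hy0 : y0 ∈ U) (hy1 : y1 ∈ U) (hy : y0 ≠ y1) :
    Dm E m x0 x1 U := by
  obtain ⟨A1, A2, rfl, a1, a2⟩ := h0
  obtain ⟨B1, B2, rfl, b1, b2⟩ := h1
  refine ⟨y0, hy0, y1, hy1, hy, Pack.mono ?_ hE⟩
  rw [show A1 + A2 + (B1 + B2) + Q + C.sum = A1 + (B1 + (A2 + (B2 + (Q + C.sum)))) by abel]
  exact .cons a1.symm (.cons b1.symm (.cons a2.symm (.cons b2.symm (.cons hQ
    (pack_replicate hC hm)))))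

/-- `A` splits into two walks from `y` to roots, which are distinct if `k` is positive. -/
def Thru (x0 x1 : V) (A : Multiset (Sym2 V)) (y : V) (k : ℕ) : Prop :=
  ∃ A1 A2 r s, A1 + A2 = A ∧ Cn A1 y r ∧ Cn A2 y s ∧ (r = x0 ∨ r = x1) ∧ (s = x0 ∨ s = x1) ∧
    k ≤ if r = s then 0 else 1

lemma Thru.legs {x0 x1 : V} {A : Multiset (Sym2 V)} {y : V} {k : ℕ} (h : Thru x0 x1 A y k)
    (hk : 0 < k) : Legs x0 x1 A y := by
  obtain ⟨A1, A2, r, s, rfl, h1, h2, rfl | rfl, rfl | rfl, hk'⟩ := h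
  · simp at hk'; omega
  · exact ⟨A1, A2, rfl, h1, h2⟩
  · exact ⟨A2, A1, add_comm _ _, h2, h1⟩
  · simp at hk'; omega

lemma Thru.legs_add {x0 x1 : V} {A c : Multiset (Sym2 V)} {y : V} {k : ℕ}
    (h : Thru x0 x1 A y k) (hc : Cn c x0 x1) : Legs x0 x1 (A + c) y := by
  obtain ⟨A1, A2, r, s, rfl, h1, h2, rfl | rfl, rfl | rfl, hk'⟩ := h
  · exact ⟨A1, A2 + c, by abel, h1, h2.trans_add hc⟩
  · exact ⟨A1, A2 + c, by abel, h1, h2.left _⟩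
  · exact ⟨A2, A1 + c, by abel, h2, h1.left _⟩
  · exact ⟨A1 + c, A2, by abel, h1.trans_add hc.symm, h2⟩

lemma Thru.legs_of_le {x0 x1 : V} {A : Multiset (Sym2 V)} {y : V} {k n : ℕ}
    {C : Multiset (Multiset (Sym2 V))} (h : Thru x0 x1 A y k) (hC : ∀ c ∈ C, Cn c x0 x1)
    (hn : n + 1 ≤ C.card + k) :
    ∃ (A' : Multiset (Sym2 V)) (C' : Multiset (Multiset (Sym2 V))), Legs x0 x1 A' y ∧ (∀ c ∈ C', Cn c x0 x1) ∧ n ≤ C'.card ∧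
      A' + C'.sum = A + C.sum := by
  by_cases hk : 0 < k
  · refine ⟨A, C, h.legs hk, hC, ?_, rfl⟩
    obtain ⟨_, _, r, s, -, -, -, -, -, hk'⟩ := h
    split_ifs at hk' <;> omega
  · obtain ⟨c, hc⟩ := Multiset.card_pos_iff_exists_mem.1 (by omega : 0 < C.card)
    obtain ⟨C, rfl⟩ := Multiset.exists_cons_of_mem hc
    refine ⟨A + c, C, h.legs_add (hC c hc), fun c hc => hC c (Multiset.mem_cons_of_mem hc), ?_, ?_⟩
    · rw [Multiset.card_cons] at hn; omega
    · rw [Multiset.sum_cons]; abel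

lemma dm_of_thru {A B Q E : Multiset (Sym2 V)} {C : Multiset (Multiset (Sym2 V))}
    {m k0 k1 : ℕ} {x0 x1 y0 y1 : V} {U : Set V} (h0 : Thru x0 x1 A y0 k0)
    (h1 : Thru x0 x1 B y1 k1) (hQ : Cn Q y0 y1) (hC : ∀ c ∈ C, Cn c x0 x1)
    (h2 : 2 ≤ m) (hm : m ≤ C.card + k0 + k1) (hE : A + B + Q + C.sum ≤ E)
    (hy0 : y0 ∈ U) (hy1 : y1 ∈ U) (hy : y0 ≠ y1) : Dm E m x0 x1 U := by
  have hk1 : k1 ≤ 1 := by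
    obtain ⟨_, _, r, s, -, -, -, -, -, hk'⟩ := h1
    split_ifs at hk' <;> omega
  obtain ⟨A', C', a1, a2, a3, a4⟩ := Thru.legs_of_le h0 hC (n := m - k1 - 1) (by omega)
  obtain ⟨B', C'', b1, b2, b3, b4⟩ := Thru.legs_of_le h1 a2 (n := m - 2) (by omega)
  refine dm_of_legs a1 b1 hQ b2 b3 (le_trans (le_of_eq ?_) hE) hy0 hy1 hy
  calc A' + B' + Q + C''.sum = A' + Q + (B' + C''.sum) := by abel
    _ = (A' + C'.sum) + B + Q := by rw [b4]; abel
    _ = _ := by rw [a4]; abel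

/-! ### Families of root trails -/

/-- The edges of the walk from `a` through the vertices of `p` to `b`. -/
def seg (a : V) (p : List V) (b : V) : Multiset (Sym2 V) := walkEdges (a :: (p ++ [b]))

lemma seg_nil (a b : V) : seg a [] b = {s(a, b)} := rfl

lemma seg_cons (a c : V) (p : List V) (b : V) : seg a (c :: p) b = s(a, c) ::ₘ seg c p b := rfl

lemma seg_append (a : V) (p : List V) (c : V) (q : List V) (b : V) :
    seg a (p ++ c :: q) b = seg a p c + seg c q b := by
  have := walkEdges_append (a :: p) (q ++ [b]) c
  simpa [seg] using this

lemma seg_reverse (a : V) (p : List V) (b : V) : seg b p.reverse a = seg a p b := by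
  rw [seg, seg, ← walkEdges_reverse]
  simp

lemma seg_cn {a b u v : V} {p : List V} (hu : u = a ∨ u ∈ p ∨ u = b)
    (hv : v = a ∨ v ∈ p ∨ v = b) : Cn (seg a p b) u v := by
  apply Cn.of_walk <;> simp [hu, hv]

lemma seg_cn_ends (a : V) (p : List V) (b : V) : Cn (seg a p b) a b :=
  seg_cn (Or.inl rfl) (Or.inr (Or.inr rfl))

/-- A walk recorded as its first vertex, its list of inner vertices and its last vertex. -/
abbrev Trl (V : Type) := V × List V × V

/-- The edges of a trail. -/
def te (T : Trl V) : Multiset (Sym2 V) := seg T.1 T.2.1 T.2.2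

/-- `1` if the trail has distinct ends and `0` otherwise. -/
def tk (T : Trl V) : ℕ := if T.1 = T.2.2 then 0 else 1

/-- The ends of the trail are roots and its inner vertices lie in `U`. -/
def OkT (x0 x1 : V) (U : Set V) (T : Trl V) : Prop :=
  (T.1 = x0 ∨ T.1 = x1) ∧ (T.2.2 = x0 ∨ T.2.2 = x1) ∧ ∀ z ∈ T.2.1, z ∈ U

/-- `E` is partitioned into the root trails in `F` and the remaining edges `H`. -/
structure Fam (E : Multiset (Sym2 V)) (x0 x1 : V) (U : Set V) (F : Multiset (Trl V))
    (H : Multiset (Sym2 V)) : Prop where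
  ok : ∀ T ∈ F, OkT x0 x1 U T
  sum : (F.map te).sum + H = E

/-- The number of trails joining distinct roots. -/
def nk (F : Multiset (Trl V)) : ℕ := (F.map tk).sum

@[simp] lemma nk_zero : nk (0 : Multiset (Trl V)) = 0 := rfl

@[simp] lemma nk_cons (T : Trl V) (F : Multiset (Trl V)) : nk (T ::ₘ F) = tk T + nk F := by
  simp [nk]

lemma tk_le_one (T : Trl V) : tk T ≤ 1 := by
  unfold tk; split_ifs <;> simp

lemma nk_le_card (F : Multiset (Trl V)) : nk F ≤ F.card := by
  induction F using Multiset.induction with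
  | empty => simp
  | cons T F ih => have := tk_le_one T; simp; omega

/-- The trails of `F` joining distinct roots, as edge sets. -/
def links (F : Multiset (Trl V)) : Multiset (Multiset (Sym2 V)) :=
  (F.filter fun T => T.1 ≠ T.2.2).map te

lemma card_links (F : Multiset (Trl V)) : (links F).card = nk F := by
  induction F using Multiset.induction with
  | empty => simp [links]
  | cons T F ih =>
    rw [nk_cons, ← ih, links, links, Multiset.filter_cons]
    unfold tk
    by_cases h : T.1 = T.2.2 <;> simp [h]; omega

lemma sum_links_le (F : Multiset (Trl V)) : (links F).sum ≤ (F.map te).sum := by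
  obtain ⟨G, hG⟩ := Multiset.le_iff_exists_add.1
    (Multiset.filter_le (fun T : Trl V => T.1 ≠ T.2.2) F)
  conv_rhs => rw [hG]
  rw [Multiset.map_add, Multiset.sum_add, links]
  exact Multiset.le_add_right _ _

lemma OkT.cn_link {x0 x1 : V} {U : Set V} {T : Trl V} (h : OkT x0 x1 U T) (hT : T.1 ≠ T.2.2) :
    Cn (te T) x0 x1 := by
  obtain ⟨a, w, b⟩ := T
  obtain ⟨h1, h2, -⟩ := h
  simp only at h1 h2 hT
  rcases h1 with rfl | rfl <;> rcases h2 with rfl | rfl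
  · exact absurd rfl hT
  · exact seg_cn_ends _ _ _
  · exact (seg_cn_ends _ _ _).symm
  · exact absurd rfl hT

lemma links_cn {x0 x1 : V} {U : Set V} {F : Multiset (Trl V)} (h : ∀ T ∈ F, OkT x0 x1 U T) :
    ∀ c ∈ links F, Cn c x0 x1 := by
  intro c hc
  obtain ⟨T, hT, rfl⟩ := Multiset.mem_map.1 hc
  rw [Multiset.mem_filter] at hT
  exact (h T hT.1).cn_link hT.2

lemma OkT.thru {x0 x1 : V} {U : Set V} {T : Trl V} (h : OkT x0 x1 U T) {y : V}
    (hy : y ∈ T.2.1) : Thru x0 x1 (te T) y (tk T) := by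
  obtain ⟨a, w, b⟩ := T
  obtain ⟨p, q, rfl⟩ := List.append_of_mem hy
  exact ⟨seg a p y, seg y q b, a, b, (seg_append _ _ _ _ _).symm, (seg_cn_ends _ _ _).symm,
    seg_cn_ends _ _ _, h.1, h.2.1, le_rfl⟩

namespace Fam

variable {E : Multiset (Sym2 V)} {m : ℕ} {x0 x1 : V} {U : Set V} {F K F' : Multiset (Trl V)}
  {H : Multiset (Sym2 V)} {T T' : Trl V}

/-- The basic criterion: build `D_m` from the trails in `K`, the edges in `H`, and use the
trails in `F'` as links between the roots. -/
lemma dm (h : Fam E x0 x1 U (K + F') H) {A B Q R : Multiset (Sym2 V)} {y0 y1 : V} {k0 k1 : ℕ}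
    (h0 : Thru x0 x1 A y0 k0) (h1 : Thru x0 x1 B y1 k1) (hQ : Cn Q y0 y1)
    (hR : A + B + Q + R = (K.map te).sum + H) (h2 : 2 ≤ m) (hm : m ≤ nk F' + k0 + k1)
    (hy0 : y0 ∈ U) (hy1 : y1 ∈ U) (hy : y0 ≠ y1) : Dm E m x0 x1 U := by
  refine dm_of_thru h0 h1 hQ (links_cn fun T hT => h.ok T (Multiset.mem_add.2 (Or.inr hT))) h2
    (by rw [card_links]; exact hm) ?_ hy0 hy1 hy
  rw [← h.sum, Multiset.map_add, Multiset.sum_add]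
  calc A + B + Q + (links F').sum ≤ A + B + Q + R + (F'.map te).sum := by
        refine add_le_add (Multiset.le_add_right _ _) (sum_links_le _)
    _ = _ := by rw [hR]; abel

lemma mem_U (h : Fam E x0 x1 U F H) (hT : T ∈ F) {y : V} (hy : y ∈ T.2.1) : y ∈ U :=
  (h.ok T hT).2.2 y hy

/-- Remove a trail from the family, leaving its edges unused. -/
lemma drop (h : Fam E x0 x1 U (T ::ₘ F) H) : Fam E x0 x1 U F (H + te T) := by
  refine ⟨fun S hS => h.ok S (Multiset.mem_cons_of_mem hS), ?_⟩
  rw [← h.sum, Multiset.map_cons, Multiset.sum_cons]; abel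

lemma of_perm (h : Fam E x0 x1 U F H) (hF : F = F') : Fam E x0 x1 U F' H := hF ▸ h

lemma replace (h : Fam E x0 x1 U (T ::ₘ F) H) {H' : Multiset (Sym2 V)} (hT : OkT x0 x1 U T')
    (he : te T' + H' = te T + H) : Fam E x0 x1 U (T' ::ₘ F) H' := by
  refine ⟨fun S hS => ?_, ?_⟩
  · rcases Multiset.mem_cons.1 hS with rfl | hS
    · exact hT
    · exact h.ok S (Multiset.mem_cons_of_mem hS)
  · have := h.sum
    rw [Multiset.map_cons, Multiset.sum_cons] at this ⊢
    rw [← this]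
    calc _ = (te T' + H') + (F.map te).sum := by abel
      _ = _ := by rw [he]; abel

/-- Add a trail made of unused edges. -/
lemma add (h : Fam E x0 x1 U F (H + te T)) (hT : OkT x0 x1 U T) : Fam E x0 x1 U (T ::ₘ F) H := by
  refine ⟨fun S hS => ?_, ?_⟩
  · rcases Multiset.mem_cons.1 hS with rfl | hS
    · exact hT
    · exact h.ok S hS
  · rw [Multiset.map_cons, Multiset.sum_cons, ← h.sum]; abel

/-- Reverse a trail. -/
lemma rev {a b : V} {w : List V} (h : Fam E x0 x1 U ((a, w, b) ::ₘ F) H) :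
    Fam E x0 x1 U ((b, w.reverse, a) ::ₘ F) H := by
  have hT := h.ok (a, w, b) (by simp)
  refine h.replace ⟨hT.2.1, hT.1, ?_⟩ ?_
  · intro z hz; exact hT.2.2 z (List.mem_reverse.1 hz)
  · rw [te, te, seg_reverse]

lemma tk_rev (a b : V) (w w' : List V) : tk (b, w', a) = tk (a, w, b) := by
  simp [tk, eq_comm]

/-- Two distinct vertices on different members joined by unused edges give `D_m`. -/
lemma dm_of_two (h : Fam E x0 x1 U (T ::ₘ T' ::ₘ F) H) (h2 : 2 ≤ m)
    (hm : m ≤ nk (T ::ₘ T' ::ₘ F)) {y0 y1 : V} (hy0 : y0 ∈ T.2.1) (hy1 : y1 ∈ T'.2.1)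
    (hy : y0 ≠ y1) (hQ : Cn H y0 y1) : Dm E m x0 x1 U := by
  have h' : Fam E x0 x1 U ({T, T'} + F) H := h.of_perm (by simp)
  refine h'.dm ((h.ok T (by simp)).thru hy0) ((h.ok T' (by simp)).thru hy1) hQ (R := 0)
    ?_ h2 ?_ (h.mem_U (by simp) hy0) (h.mem_U (T := T') (by simp) hy1) hy
  · simp
  · simp only [nk_cons] at hm; omega

lemma ends_add_le {a b c d : V} (ha : a = x0 ∨ a = x1) (hb : b = x0 ∨ b = x1)
    (hc : c = x0 ∨ c = x1) (hd : d = x0 ∨ d = x1) :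
    ((if a = b then 0 else 1) + if c = d then 0 else 1) ≤
      if a = c then (if a = d then 0 else 1) + (if b = c then 0 else 1)
      else (if a = c then 0 else 1) + if b = d then 0 else 1 := by
  by_cases h : x0 = x1
  · subst h
    simp_all
  · rcases ha with rfl | rfl <;> rcases hb with rfl | rfl <;> rcases hc with rfl | rfl <;>
      rcases hd with rfl | rfl <;> simp_all [eq_comm]

/-- Crossing a chord of a trail by another trail gives `D_m`. -/
lemma dm_of_chord {a b u v z : V} {p q s : List V}
    (h : Fam E x0 x1 U ((a, p ++ u :: (q ++ v :: s), b) ::ₘ T' ::ₘ F) H) (h2 : 2 ≤ m)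
    (hm : m ≤ nk ((a, p ++ u :: (q ++ v :: s), b) ::ₘ T' ::ₘ F))
    (huv : u ≠ v) (hH : Cn H u v) (hz : z ∈ q) (hz' : z ∈ T'.2.1) : Dm E m x0 x1 U := by
  obtain ⟨c, w', d⟩ := T'
  obtain ⟨q1, q2, rfl⟩ := List.append_of_mem hz
  obtain ⟨w1, w2, hw⟩ := List.append_of_mem hz'
  simp only at hw
  subst hw
  have h' : Fam E x0 x1 U (({(a, p ++ u :: (q1 ++ z :: q2 ++ v :: s), b),
    (c, w1 ++ z :: w2, d)} : Multiset (Trl V)) + F) H := h.of_perm (by simp)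
  have hT := h.ok (a, p ++ u :: (q1 ++ z :: q2 ++ v :: s), b) (by simp)
  have hT' := h.ok (c, w1 ++ z :: w2, d) (by simp)
  have hu : u ∈ U := hT.2.2 u (by simp)
  have hv : v ∈ U := hT.2.2 v (by simp)
  simp only [nk_cons, tk] at hm
  have ha := hT.1
  have hb := hT.2.1
  have hc := hT'.1
  have hd := hT'.2.1
  simp only at ha hb hc hd
  by_cases hac : a = c
  · refine h'.dm (A := seg a p u + (seg u q1 z + seg z w2 d))
      (B := seg v s b + (seg z q2 v + seg c w1 z)) (k0 := if a = d then 0 else 1)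
      (k1 := if b = c then 0 else 1) (R := 0)
      ⟨_, _, a, d, rfl, (seg_cn_ends _ _ _).symm, (seg_cn_ends _ _ _).trans_add (seg_cn_ends _ _ _),
        ha, hd, le_rfl⟩
      ⟨_, _, b, c, rfl, seg_cn_ends _ _ _, (seg_cn_ends _ _ _).symm.trans_add
        (seg_cn_ends _ _ _).symm, hb, hc, le_rfl⟩ hH ?_ h2 ?_ hu hv huv
    · simp [te, seg_append]; abel
    · have := ends_add_le ha hb hc hd
      rw [if_pos hac] at this
      omega
  · refine h'.dm (A := seg a p u + (seg u q1 z + seg c w1 z))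
      (B := seg v s b + (seg z q2 v + seg z w2 d)) (k0 := if a = c then 0 else 1)
      (k1 := if b = d then 0 else 1) (R := 0)
      ⟨_, _, a, c, rfl, (seg_cn_ends _ _ _).symm, (seg_cn_ends _ _ _).trans_add
        (seg_cn_ends _ _ _).symm, ha, hc, le_rfl⟩
      ⟨_, _, b, d, rfl, seg_cn_ends _ _ _, (seg_cn_ends _ _ _).symm.trans_add
        (seg_cn_ends _ _ _), hb, hd, le_rfl⟩ hH ?_ h2 ?_ hu hv huv
    · simp [te, seg_append]; abel
    · have := ends_add_le ha hb hc hd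
      rw [if_neg hac] at this
      omega

/-- A trail repeating a vertex is met by no other trail inside the loop. -/
lemma dm_of_loop {a b u z : V} {p q s : List V}
    (h : Fam E x0 x1 U ((a, p ++ u :: (q ++ u :: s), b) ::ₘ T' ::ₘ F) H) (h2 : 2 ≤ m)
    (hm : m ≤ nk ((a, p ++ u :: (q ++ u :: s), b) ::ₘ T' ::ₘ F))
    (hzu : z ≠ u) (hz : z ∈ q) (hz' : z ∈ T'.2.1) : Dm E m x0 x1 U := by
  have hT := h.ok (a, p ++ u :: (q ++ u :: s), b) (by simp)
  have h' := h.replace (T' := (a, p ++ u :: s, b)) (H' := seg u q u + H)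
    ⟨hT.1, hT.2.1, fun y hy => hT.2.2 y (by simp at hy ⊢; tauto)⟩ (by
      simp only [te, seg_append]; abel)
  refine h'.dm_of_two h2 (by simpa [tk] using hm) (y0 := u) (y1 := z) (by simp) hz' hzu.symm
    ((seg_cn (Or.inl rfl) (Or.inr (Or.inl hz))).left _)

/-- Two members sharing two distinct vertices. -/
lemma dm_of_share {a b c d y0 y1 : V} {p q s p' q' s' : List V}
    (h : Fam E x0 x1 U ((a, p ++ y0 :: (q ++ y1 :: s), b) ::ₘ
      (c, p' ++ y0 :: (q' ++ y1 :: s'), d) ::ₘ F) H) (h2 : 2 ≤ m) (hy : y0 ≠ y1)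
    (hm : m ≤ nk F + (if a = c then 0 else 1) + (if b = d then 0 else 1)) : Dm E m x0 x1 U := by
  have h' : Fam E x0 x1 U (({(a, p ++ y0 :: (q ++ y1 :: s), b),
    (c, p' ++ y0 :: (q' ++ y1 :: s'), d)} : Multiset (Trl V)) + F) H := h.of_perm (by simp)
  have hT := h.ok (a, p ++ y0 :: (q ++ y1 :: s), b) (by simp)
  have hT' := h.ok (c, p' ++ y0 :: (q' ++ y1 :: s'), d) (by simp)
  refine h'.dm (A := seg a p y0 + seg c p' y0) (B := seg y1 s b + seg y1 s' d)
    (Q := seg y0 q y1) (R := seg y0 q' y1 + H) (k0 := if a = c then 0 else 1)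
    (k1 := if b = d then 0 else 1)
    ⟨_, _, a, c, rfl, (seg_cn_ends _ _ _).symm, (seg_cn_ends _ _ _).symm, hT.1, hT'.1, le_rfl⟩
    ⟨_, _, b, d, rfl, seg_cn_ends _ _ _, seg_cn_ends _ _ _, hT.2.1, hT'.2.1, le_rfl⟩
    (seg_cn_ends _ _ _) ?_ h2 hm (hT.2.2 y0 (by simp)) (hT.2.2 y1 (by simp)) hy
  simp [te, seg_append]; abel

end Fam

lemma List.exists_split_pair {l : List V} {a c : V} (ha : a ∈ l) (hc : c ∈ l) (hac : a ≠ c) :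
    (∃ p q s, l = p ++ a :: (q ++ c :: s)) ∨ ∃ p q s, l = p ++ c :: (q ++ a :: s) := by
  obtain ⟨p, q, rfl⟩ := List.append_of_mem ha
  rcases List.mem_append.1 hc with hc | hc
  · obtain ⟨p1, p2, rfl⟩ := List.append_of_mem hc
    exact Or.inr ⟨p1, p2, q, by simp⟩
  · rcases List.mem_cons.1 hc with rfl | hc
    · exact absurd rfl hac
    · obtain ⟨q1, q2, rfl⟩ := List.append_of_mem hc
      exact Or.inl ⟨p, q1, q2, rfl⟩

/-- No member of `F` passes through `v`. -/
def Off (F : Multiset (Trl V)) (v : V) : Prop := ∀ T ∈ F, v ∉ T.2.1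

/-- Exactly one member of `F` passes through `v`. -/
def Priv (F : Multiset (Trl V)) (v : V) : Prop := ∃ T K, F = T ::ₘ K ∧ v ∈ T.2.1 ∧ Off K v

/-- At least two members of `F` pass through `v`. -/
def Multi (F : Multiset (Trl V)) (v : V) : Prop :=
  ∃ T T' F', F = T ::ₘ T' ::ₘ F' ∧ v ∈ T.2.1 ∧ v ∈ T'.2.1

lemma not_off {F : Multiset (Trl V)} {v : V} : ¬ Off F v ↔ ∃ T F', F = T ::ₘ F' ∧ v ∈ T.2.1 := by
  simp only [Off, not_forall, not_not]
  constructor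
  · rintro ⟨T, hT, hv⟩
    obtain ⟨F', rfl⟩ := Multiset.exists_cons_of_mem hT
    exact ⟨T, F', rfl, hv⟩
  · rintro ⟨T, F', rfl, hv⟩
    exact ⟨T, by simp, hv⟩

lemma off_cons {F : Multiset (Trl V)} {T : Trl V} {v : V} :
    Off (T ::ₘ F) v ↔ v ∉ T.2.1 ∧ Off F v := by
  simp [Off]

lemma multi_of_not_off {F : Multiset (Trl V)} {T : Trl V} {v : V} (hT : v ∈ T.2.1)
    (h : ¬ Off F v) : Multi (T ::ₘ F) v := by
  obtain ⟨T', F', rfl, hv⟩ := not_off.1 h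
  exact ⟨T, T', F', rfl, hT, hv⟩

lemma off_or_priv_or_multi (F : Multiset (Trl V)) (v : V) : Off F v ∨ Priv F v ∨ Multi F v := by
  by_cases h : Off F v
  · exact Or.inl h
  · obtain ⟨T, F', rfl, hv⟩ := not_off.1 h
    by_cases h' : Off F' v
    · exact Or.inr (Or.inl ⟨T, F', rfl, hv, h'⟩)
    · exact Or.inr (Or.inr (multi_of_not_off hv h'))

lemma Multi.not_off_of_cons {F : Multiset (Trl V)} {T : Trl V} {v : V}
    (h : Multi (T ::ₘ F) v) : ¬ Off F v := by
  obtain ⟨S, S', F', hF, hS, hS'⟩ := h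
  intro hoff
  by_cases hTS : T = S
  · subst hTS
    rw [Multiset.cons_inj_right] at hF
    exact hoff S' (by simp [hF]) hS'
  · have : S ∈ T ::ₘ F := by simp [hF]
    rcases Multiset.mem_cons.1 this with rfl | h1
    · exact hTS rfl
    · exact hoff S h1 hS

lemma Multi.of_cons {F : Multiset (Trl V)} {T : Trl V} {v : V}
    (h : Multi (T ::ₘ F) v) (hT : v ∉ T.2.1) : Multi F v := by
  obtain ⟨S, F1, rfl, hS⟩ := not_off.1 h.not_off_of_cons
  refine multi_of_not_off hS ?_
  rw [Multiset.cons_swap] at h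
  have := h.not_off_of_cons
  rw [off_cons] at this
  tauto

lemma Multi.not_off {F : Multiset (Trl V)} {v : V} (h : Multi F v) : ¬ Off F v := by
  obtain ⟨S, S', F', rfl, hS, hS'⟩ := h
  exact PaperW4.not_off.2 ⟨S, _, rfl, hS⟩

lemma Multi.not_priv {F : Multiset (Trl V)} {v : V} (h : Multi F v) : ¬ Priv F v := by
  rintro ⟨T, F', rfl, _, hoff⟩
  exact h.not_off_of_cons hoff

/-- `v` is joined to a root by edges of `H`. -/
def Rooted (H : Multiset (Sym2 V)) (x0 x1 v : V) : Prop := ∃ r, (r = x0 ∨ r = x1) ∧ Cn H v r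

namespace Fam

variable {E : Multiset (Sym2 V)} {m : ℕ} {x0 x1 : V} {U : Set V} {F K F' : Multiset (Trl V)}
  {H : Multiset (Sym2 V)} {T T' : Trl V}

lemma reindex (h : Fam E x0 x1 U F H) (hF : F = F') : Fam E x0 x1 U F' H := hF ▸ h

/-- A vertex `a` joined to a root by unused edges, followed on its trail by a vertex `c` lying
on another trail. -/
lemma dm_of_rooted_before {r b a c ρ : V} {p q s : List V}
    (h : Fam E x0 x1 U ((r, p ++ a :: (q ++ c :: s), b) ::ₘ T' ::ₘ F) H) (h2 : 2 ≤ m)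
    (hc : c ∈ T'.2.1) (hac : a ≠ c) (hρ : ρ = x0 ∨ ρ = x1) (hH : Cn H a ρ)
    (hm : m ≤ nk F + tk T' + if ρ = r then 0 else 1) : Dm E m x0 x1 U := by
  have h' : Fam E x0 x1 U (({(r, p ++ a :: (q ++ c :: s), b), T'} : Multiset (Trl V)) + F) H :=
    h.of_perm (by simp)
  have hT := h.ok (r, p ++ a :: (q ++ c :: s), b) (by simp)
  refine h'.dm (A := H + seg r p a) (B := te T') (Q := seg a q c) (R := seg c s b)
    (k0 := if ρ = r then 0 else 1) (k1 := tk T')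
    ⟨_, _, ρ, r, rfl, hH, (seg_cn_ends _ _ _).symm, hρ, hT.1, le_rfl⟩
    ((h.ok T' (by simp)).thru hc) (seg_cn_ends _ _ _) ?_ h2 (by omega)
    (hT.2.2 a (by simp)) (hT.2.2 c (by simp)) hac
  simp [te, seg_append]; abel

lemma dm_of_rooted (h : Fam E x0 x1 U (T ::ₘ T' ::ₘ F) H) (h2 : 2 ≤ m) {a c : V}
    (ha : a ∈ T.2.1) (hc : c ∈ T.2.1) (hc' : c ∈ T'.2.1) (hac : a ≠ c) (hH : Rooted H x0 x1 a)
    (hm : m ≤ nk F + tk T') : Dm E m x0 x1 U := by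
  obtain ⟨r, w, b⟩ := T
  obtain ⟨ρ, hρ, hH⟩ := hH
  rcases List.exists_split_pair ha hc hac with ⟨p, q, s, hw⟩ | ⟨p, q, s, hw⟩
  · simp only at hw
    subst hw
    exact h.dm_of_rooted_before h2 hc' hac hρ hH (by omega)
  · simp only at hw
    subst hw
    have h' := h.rev
    rw [show (p ++ c :: (q ++ a :: s)).reverse = s.reverse ++ a :: (q.reverse ++ c :: p.reverse)
      by simp] at h'
    exact h'.dm_of_rooted_before h2 hc' hac hρ hH (by omega)

/-- Two members sharing two distinct vertices, in either order. -/
lemma dm_of_share' (h : Fam E x0 x1 U (T ::ₘ T' ::ₘ F) H) (h2 : 2 ≤ m) {y0 y1 : V}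
    (h0 : y0 ∈ T.2.1) (h1 : y1 ∈ T.2.1) (k0 : y0 ∈ T'.2.1) (k1 : y1 ∈ T'.2.1) (hy : y0 ≠ y1)
    (hm : m ≤ nk F ∨ tk T' + 1 = tk T + 2 ∧ m ≤ nk F + 1) : Dm E m x0 x1 U := by
  obtain ⟨a, w, b⟩ := T
  obtain ⟨c, w', d⟩ := T'
  simp only at h0 h1 k0 k1
  have hends : ∀ {a b c d : V}, (a = x0 ∨ a = x1) → (b = x0 ∨ b = x1) → (c = x0 ∨ c = x1) →
      (d = x0 ∨ d = x1) → (m ≤ nk F ∨ tk (c, w', d) + 1 = tk (a, w, b) + 2 ∧ m ≤ nk F + 1) →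
      m ≤ nk F + (if a = c then 0 else 1) + (if b = d then 0 else 1) := by
    intro a b c d _ _ _ _ hm
    rcases hm with hm | ⟨hm1, hm⟩
    · omega
    · simp only [tk] at hm1
      by_cases hab : a = b
      · by_cases hcd : c = d
        · simp [hab, hcd] at hm1
        · subst hab
          by_cases hac : a = c
          · have : a ≠ d := by rintro rfl; exact hcd hac.symm
            simp [this]; omega
          · simp [hac]; omega
      · by_cases hcd : c = d <;> simp [hab, hcd] at hm1
  have hT := h.ok (a, w, b) (by simp)
  have hT' := h.ok (c, w', d) (by simp)
  have main : ∀ y0 y1 : V, y0 ≠ y1 → y0 ∈ w' → y1 ∈ w' →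
      (∃ p q s, w = p ++ y0 :: (q ++ y1 :: s)) → Dm E m x0 x1 U := by
    rintro y0 y1 hy k0 k1 ⟨p, q, s, rfl⟩
    rcases List.exists_split_pair k0 k1 hy with ⟨p', q', s', rfl⟩ | ⟨p', q', s', rfl⟩
    · exact h.dm_of_share h2 hy (hends hT.1 hT.2.1 hT'.1 hT'.2.1 hm)
    · rw [Multiset.cons_swap] at h
      have h' := h.rev
      rw [Multiset.cons_swap, show (p' ++ y1 :: (q' ++ y0 :: s')).reverse =
        s'.reverse ++ y0 :: (q'.reverse ++ y1 :: p'.reverse) by simp] at h'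
      refine h'.dm_of_share h2 hy (hends hT.1 hT.2.1 hT'.2.1 hT'.1 ?_)
      have := tk_rev c d (p' ++ y1 :: (q' ++ y0 :: s')) (p' ++ y1 :: (q' ++ y0 :: s'))
      rwa [this]
  rcases List.exists_split_pair h0 h1 hy with hw | hw
  · exact main y0 y1 hy k0 k1 hw
  · exact main y1 y0 hy.symm k1 k0 hw

/-- Two distinct vertices on different members, both joined to roots by unused edges. -/
lemma dm_of_two_rooted (h : Fam E x0 x1 U (T ::ₘ T' ::ₘ F) H) (h2 : 2 ≤ m)
    (hm : m + 1 ≤ nk (T ::ₘ T' ::ₘ F)) {a b : V} (ha : a ∈ T.2.1) (hb : b ∈ T'.2.1)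
    (hab : a ≠ b) (hra : Rooted H x0 x1 a) (hrb : Rooted H x0 x1 b) : Dm E m x0 x1 U := by
  obtain ⟨r, hr, hra⟩ := hra
  obtain ⟨s, hs, hrb⟩ := hrb
  simp only [nk_cons] at hm
  have t1 := tk_le_one T
  have t2 := tk_le_one T'
  have hpos : 0 < (links F).card := by rw [card_links]; omega
  obtain ⟨c, hc⟩ := Multiset.card_pos_iff_exists_mem.1 hpos
  obtain ⟨P, hP, rfl⟩ := Multiset.mem_map.1 hc
  rw [Multiset.mem_filter] at hP
  have hlink := (h.ok P (by simp [hP.1])).cn_link hP.2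
  obtain ⟨F, rfl⟩ := Multiset.exists_cons_of_mem hP.1
  have h' := (h.reindex (F' := P ::ₘ T ::ₘ T' ::ₘ F)
    (by rw [Multiset.cons_swap T' P, Multiset.cons_swap T P])).drop
  have t3 := tk_le_one P
  refine h'.dm_of_two h2 (by simp only [nk_cons] at hm ⊢; omega) ha hb hab
    (((hra.left _).trans ?_).trans (hrb.left _).symm)
  rcases hr with rfl | rfl <;> rcases hs with rfl | rfl
  · exact Cn.refl _ _
  · exact hlink.right _
  · exact hlink.symm.right _
  · exact Cn.refl _ _

/-- A vertex joined to a root by unused edges and another vertex on two members. -/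
lemma dm_of_rooted_multi (h : Fam E x0 x1 U F H) (h2 : 2 ≤ m) (hm : m + 1 ≤ nk F) {a c : V}
    (ha : ¬ Off F a) (hra : Rooted H x0 x1 a) (hc : Multi F c) (hac : a ≠ c) :
    Dm E m x0 x1 U := by
  obtain ⟨T, F, rfl, haT⟩ := not_off.1 ha
  have tT := tk_le_one T
  by_cases hcT : c ∈ T.2.1
  · obtain ⟨T', F, rfl, hcT'⟩ := not_off.1 hc.not_off_of_cons
    exact h.dm_of_rooted h2 haT hcT hcT' hac hra (by simp only [nk_cons] at hm; omega)
  · obtain ⟨S, S', F, rfl, hS, hS'⟩ := hc.of_cons hcT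
    have h' := (h.reindex (F' := S' ::ₘ T ::ₘ S ::ₘ F)
      (by rw [Multiset.cons_swap S S', Multiset.cons_swap T S'])).drop
    have hok := h.ok S' (by simp)
    obtain ⟨r, hr, hra⟩ := hra
    have cr : Cn (te S') c S'.1 := seg_cn (Or.inr (Or.inl hS')) (Or.inl rfl)
    have cr' : Cn (te S') c S'.2.2 := seg_cn (Or.inr (Or.inl hS')) (Or.inr (Or.inr rfl))
    simp only [nk_cons] at hm
    by_cases hk : S'.1 = S'.2.2
    · have : tk S' = 0 := by simp [tk, hk]
      exact h'.dm_of_two_rooted h2 (by simp only [nk_cons]; omega) haT hS hac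
        ⟨r, hr, hra.left _⟩ ⟨_, hok.1, cr.right _⟩
    · have t3 := tk_le_one S'
      refine h'.dm_of_two h2 (by simp only [nk_cons]; omega) haT hS hac
        ((hra.left _).trans (Cn.symm ?_))
      have : r = S'.1 ∨ r = S'.2.2 := by
        have o1 := hok.1
        have o2 := hok.2.1
        rcases hr with rfl | rfl <;> rcases o1 with o1 | o1 <;> rcases o2 with o2 | o2 <;>
          simp_all
      rcases this with rfl | rfl
      · exact cr.right _
      · exact cr'.right _

/-- Distinct vertices of the family joined by unused edges lie on exactly one and the same
member. -/
lemma exists_common (h : Fam E x0 x1 U F H) (h2 : 2 ≤ m) (hm : m ≤ nk F)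
    (hD : ¬ Dm E m x0 x1 U) {u v : V} (hu : ¬ Off F u) (hv : ¬ Off F v) (huv : u ≠ v)
    (hH : Cn H u v) :
    ∃ T F', F = T ::ₘ F' ∧ u ∈ T.2.1 ∧ v ∈ T.2.1 ∧ Off F' u ∧ Off F' v := by
  obtain ⟨T, F', rfl, huT⟩ := not_off.1 hu
  have hv' : Off F' v := by
    by_contra hcon
    obtain ⟨T', F'', rfl, hvT'⟩ := not_off.1 hcon
    exact hD (h.dm_of_two h2 hm huT hvT' huv hH)
  have hvT : v ∈ T.2.1 := by
    by_contra hcon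
    exact hv (off_cons.2 ⟨hcon, hv'⟩)
  refine ⟨T, F', rfl, huT, hvT, ?_, hv'⟩
  by_contra hcon
  obtain ⟨T', F'', rfl, huT'⟩ := not_off.1 hcon
  exact hD (h.dm_of_two h2 hm hvT huT' huv.symm hH.symm)

lemma priv_of_cn (h : Fam E x0 x1 U F H) (h2 : 2 ≤ m) (hm : m ≤ nk F)
    (hD : ¬ Dm E m x0 x1 U) {u v : V} (hu : ¬ Off F u) (hv : ¬ Off F v) (huv : u ≠ v)
    (hH : Cn H u v) : Priv F u := by
  obtain ⟨T, F', rfl, h1, _, h3, _⟩ := h.exists_common h2 hm hD hu hv huv hH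
  exact ⟨T, F', rfl, h1, h3⟩

end Fam

/-! ### The class of rooted graphs under consideration -/

/-- The connectivity conditions on a graph with edges `E`, roots `x0, x1` and remaining vertices
`U`: `λ_n ≥ 3`, `λ_n^i ≥ 4` and `λ_s ≥ m`. -/
structure Conn (E : Multiset (Sym2 V)) (x0 x1 : V) (U : Set V) (m : ℕ) : Prop where
  ne : x0 ≠ x1
  x0U : x0 ∉ U
  x1U : x1 ∉ U
  supp : ∀ e ∈ E, ∀ v ∈ e, v ∈ U ∨ v = x0 ∨ v = x1
  loopless : ∀ e ∈ E, ¬ e.IsDiag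
  n3 : ∀ X : Set V, X.Nonempty → X ⊆ U → 3 ≤ cut E X
  n4 : ∀ X : Set V, X.Nontrivial → X ⊆ U → 4 ≤ cut E X
  s : ∀ X : Set V, X ⊆ U → m ≤ cut E (insert x0 X)

/-- The conditions of `Conn` together with `λ_s^i ≥ m + 1`. -/
structure Cls (E : Multiset (Sym2 V)) (x0 x1 : V) (U : Set V) (m : ℕ) : Prop
    extends Conn E x0 x1 U m where
  nontrivial : U.Nontrivial
  si : ∀ X : Set V, X.Nonempty → X ⊆ U → X ≠ U → m + 1 ≤ cut E (insert x0 X)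

lemma cut_congr {E : Multiset (Sym2 V)} {X Y : Set V}
    (h : ∀ e ∈ E, crosses X e ↔ crosses Y e) : cut E X = cut E Y :=
  Multiset.countP_congr rfl fun e he => by simpa using h e he

lemma crosses_congr {X Y : Set V} {e : Sym2 V} (h : ∀ v ∈ e, v ∈ X ↔ v ∈ Y) :
    crosses X e ↔ crosses Y e := by
  induction e with | _ u v =>
  rw [crosses_mk, crosses_mk, h u (by simp), h v (by simp)]

namespace Conn

variable {E : Multiset (Sym2 V)} {m : ℕ} {x0 x1 : V} {U : Set V}

lemma cut_inter (h : Conn E x0 x1 U m) {X : Set V} (h0 : x0 ∉ X) (h1 : x1 ∉ X) :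
    cut E X = cut E (X ∩ U) := by
  refine cut_congr fun e he => crosses_congr fun v hv => ⟨fun hX => ⟨hX, ?_⟩, fun hX => hX.1⟩
  rcases h.supp e he v hv with hU | rfl | rfl
  · exact hU
  · exact absurd hX h0
  · exact absurd hX h1

lemma cut_insert_inter (h : Conn E x0 x1 U m) {X : Set V} (h0 : x0 ∈ X) (h1 : x1 ∉ X) :
    cut E X = cut E (insert x0 (X ∩ U)) := by
  refine cut_congr fun e he => crosses_congr fun v hv => ⟨fun hX => ?_, ?_⟩
  · rcases h.supp e he v hv with hU | rfl | rfl
    · exact Or.inr ⟨hX, hU⟩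
    · exact Or.inl rfl
    · exact absurd hX h1
  · rintro (rfl | hX)
    · exact h0
    · exact hX.1

lemma cut_insert_diff (h : Conn E x0 x1 U m) {X : Set V} (h0 : x0 ∉ X) (h1 : x1 ∈ X) :
    cut E X = cut E (insert x0 (U \ X)) := by
  rw [← cut_compl, h.cut_insert_inter (X := Xᶜ) h0 (by simpa using h1)]
  congr 2
  ext v; simp [and_comm]

lemma le_cut (h : Conn E x0 x1 U m) {X : Set V} (h0 : x0 ∈ X) (h1 : x1 ∉ X) : m ≤ cut E X := by
  rw [h.cut_insert_inter h0 h1]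
  exact h.s _ Set.inter_subset_right

lemma cut_insert_swap (h : Conn E x0 x1 U m) {X : Set V} (hX : X ⊆ U) :
    cut E (insert x1 X) = cut E (insert x0 (U \ X)) := by
  rw [h.cut_insert_diff (by simp [h.ne]; exact fun hc => h.x0U (hX hc)) (by simp)]
  congr 2
  ext v; simp only [Set.mem_sdiff, Set.mem_insert_iff]
  constructor
  · rintro ⟨h1, h2⟩; exact ⟨h1, fun hc => h2 (Or.inr hc)⟩
  · rintro ⟨h1, h2⟩
    exact ⟨h1, by rintro (rfl | hc); exacts [h.x1U h1, h2 hc]⟩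

lemma swap (h : Conn E x0 x1 U m) : Conn E x1 x0 U m := by
  refine ⟨h.ne.symm, h.x1U, h.x0U, fun e he v hv => ?_, h.loopless, h.n3, h.n4, fun X hX => ?_⟩
  · have := h.supp e he v hv; tauto
  · rw [h.cut_insert_swap hX]; exact h.s _ Set.sdiff_subset

end Conn

lemma Cls.swap {E : Multiset (Sym2 V)} {m : ℕ} {x0 x1 : V} {U : Set V} (h : Cls E x0 x1 U m) :
    Cls E x1 x0 U m := by
  refine ⟨h.toConn.swap, h.nontrivial, fun X hX0 hX hXU => ?_⟩
  rw [h.cut_insert_swap hX]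
  refine h.si _ ?_ Set.sdiff_subset ?_
  · rw [Set.nonempty_iff_ne_empty]
    intro hc
    exact hXU (subset_antisymm hX (Set.sdiff_eq_empty.1 hc))
  · intro hc
    obtain ⟨v, hv⟩ := hX0
    have := hc ▸ hX hv
    exact this.2 hv

lemma Dm.swap {E : Multiset (Sym2 V)} {m : ℕ} {x0 x1 : V} {U : Set V} (h : Dm E m x0 x1 U) :
    Dm E m x1 x0 U := by
  obtain ⟨y0, h0, y1, h1, hy, hP⟩ := h
  refine ⟨y0, h0, y1, h1, hy, ?_⟩
  obtain ⟨A, B, rfl, hA, hB⟩ := hP.split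
  have hrev : ∀ n (B : Multiset (Sym2 V)), Pack (List.replicate n (x0, x1)) B →
      Pack (List.replicate n (x1, x0)) B := by
    intro n
    induction n with
    | zero => intro B _; trivial
    | succ n ih =>
      rintro B ⟨A, C, rfl, hA, hC⟩
      exact ⟨A, C, rfl, hA.symm, ih C hC⟩
  refine Pack.append (hA.perm ?_) (hrev _ _ hB)
  exact (List.perm_append_comm (l₁ := [(x0, y0), (x0, y1)]) (l₂ := [(x1, y0), (x1, y1)])).append_right
    [(y0, y1)]

/-! ### Maximal families of root trails -/

lemma exists_mem_seg {a b v : V} {w : List V} (hv : v ∈ w) : ∃ e ∈ seg a w b, v ∈ e := by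
  obtain ⟨p, q, rfl⟩ := List.append_of_mem hv
  rw [seg_append]
  cases q with
  | nil => exact ⟨s(v, b), by simp [seg_nil], by simp⟩
  | cons c q => exact ⟨s(v, c), by simp [seg_cons], by simp⟩

lemma card_seg_pos (a b : V) (w : List V) : 0 < (seg a w b).card := by
  cases w <;> simp [seg_nil, seg_cons]

lemma seg_of_isWalk {l : List V} {u u' : V} (h : IsWalk l u u') (v v' : V) :
    seg v l v' = {s(u, v), s(u', v')} + walkEdges l := by
  cases l with
  | nil => simp [IsWalk] at h
  | cons c l =>
    have : c = u := by simpa [IsWalk] using h.1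
    subst this
    rw [seg]
    rcases List.eq_nil_or_concat l with rfl | ⟨l, d, rfl⟩
    · have : c = u' := by simpa [IsWalk] using h.2
      subst this
      simp [Sym2.eq_swap (a := v)]
    · rw [List.concat_eq_append] at h ⊢
      have : d = u' := by
        have := h.2
        rw [← List.cons_append, List.getLast?_concat] at this
        simpa using this
      subst this
      rw [show v :: ((c :: (l ++ [d])) ++ [v']) = (v :: c :: l) ++ [d, v'] by simp,
        walkEdges_concat, Multiset.insert_eq_cons, Multiset.cons_add]
      simp only [List.cons_append, walkEdges_cons_cons, Multiset.cons_add, Sym2.eq_swap (a := v)]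
      rw [add_comm]

lemma cut_walkEdges_of_subset {l : List V} {X : Set V} (h : ∀ v ∈ l, v ∈ X) :
    cut (walkEdges l) X = 0 := by
  rw [cut_eq_zero_iff]
  rintro e he ⟨u, v, rfl, hu, hv⟩
  exact hv (h v (mem_of_mem_walkEdges he (by simp)))

lemma cut_walkEdges_of_disjoint {l : List V} {X : Set V} (h : ∀ v ∈ l, v ∉ X) :
    cut (walkEdges l) X = 0 := by
  rw [cut_eq_zero_iff]
  rintro e he ⟨u, v, rfl, hu, hv⟩
  exact h u (mem_of_mem_walkEdges he (by simp)) hu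

lemma cut_walkEdges_append_le (l l' : List V) (X : Set V) :
    cut (walkEdges (l ++ l')) X ≤ cut (walkEdges l) X + cut (walkEdges l') X + 1 := by
  induction l with
  | nil => simp
  | cons a l ih =>
    cases l with
    | nil =>
      cases l' with
      | nil => simp
      | cons b l' => simp [cut_cons]; split_ifs <;> omega
    | cons c l =>
      simp only [List.cons_append, walkEdges_cons_cons, cut_cons] at ih ⊢
      omega

lemma cut_walkEdges_block_le {P q S : List V} {X : Set V} (hP : ∀ v ∈ P, v ∉ X)
    (hq : ∀ v ∈ q, v ∈ X) (hS : ∀ v ∈ S, v ∉ X) : cut (walkEdges (P ++ (q ++ S))) X ≤ 2 := by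
  have h1 := cut_walkEdges_append_le P (q ++ S) X
  have h2 := cut_walkEdges_append_le q S X
  rw [cut_walkEdges_of_disjoint hP] at h1
  rw [cut_walkEdges_of_subset hq, cut_walkEdges_of_disjoint hS] at h2
  omega

/-- A maximal block of a list on which `P` holds. -/
lemma List.exists_block (P : V → Prop) {w : List V} {x : V} (hx : x ∈ w) (hP : P x) :
    ∃ L q S, w = L ++ (q ++ S) ∧ x ∈ q ∧ (∀ v ∈ q, P v) ∧
      (L = [] ∨ ∃ p z, L = p ++ [z] ∧ ¬ P z) ∧ (S = [] ∨ ∃ z s, S = z :: s ∧ ¬ P z) := by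
  have key : ∀ l : List V, ∃ q S, l = q ++ S ∧ (∀ v ∈ q, P v) ∧
      (S = [] ∨ ∃ z s, S = z :: s ∧ ¬ P z) := by
    intro l
    induction l with
    | nil => exact ⟨[], [], by simp⟩
    | cons a l ih =>
      by_cases ha : P a
      · obtain ⟨q, S, rfl, h1, h2⟩ := ih
        exact ⟨a :: q, S, rfl, by simpa using ⟨ha, h1⟩, h2⟩
      · exact ⟨[], a :: l, rfl, by simp, Or.inr ⟨a, l, rfl, ha⟩⟩
  obtain ⟨p, s, rfl⟩ := List.append_of_mem hx
  obtain ⟨q1, L, hp, h1, h2⟩ := key p.reverse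
  obtain ⟨q2, S, rfl, h3, h4⟩ := key s
  have hp : p = L.reverse ++ q1.reverse := by rw [← List.reverse_append, ← hp]; simp
  refine ⟨L.reverse, q1.reverse ++ x :: q2, S, by simp [hp], by simp, ?_, ?_, h4⟩
  · intro v hv
    simp only [List.mem_append, List.mem_reverse, List.mem_cons] at hv
    rcases hv with hv | rfl | hv
    exacts [h1 v hv, hP, h3 v hv]
  · rcases h2 with rfl | ⟨z, s, rfl, hz⟩
    · exact Or.inl rfl
    · exact Or.inr ⟨s.reverse, z, by simp, hz⟩

section

variable {E : Multiset (Sym2 V)} {m k : ℕ} {x0 x1 : V} {U : Set V} {F K F' : Multiset (Trl V)}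
  {H : Multiset (Sym2 V)} {T T' : Trl V}

lemma Cls.okT (h : Cls E x0 x1 U m) {a b : V} {w : List V} (ha : a = x0 ∨ a = x1)
    (hb : b = x0 ∨ b = x1) (hw : seg a w b ≤ E) (h0 : x0 ∉ w) (h1 : x1 ∉ w) :
    OkT x0 x1 U (a, w, b) := by
  refine ⟨ha, hb, fun z hz => ?_⟩
  obtain ⟨e, he, hze⟩ := exists_mem_seg (a := a) (b := b) hz
  rcases h.supp e (Multiset.mem_of_le hw he) z hze with h | rfl | rfl
  exacts [h, absurd hz h0, absurd hz h1]

lemma Cls.exists_link (h : Cls E x0 x1 U m) (hHE : H ≤ E) (hH : Cn H x0 x1) :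
    ∃ w, OkT x0 x1 U (x0, w, x1) ∧ seg x0 w x1 ≤ H := by
  obtain ⟨w, hw, hle⟩ := hH.exists_path_of_ne h.ne
  have hw' : x0 ∉ w ∧ x1 ∉ w := by
    simp only [List.nodup_cons, List.mem_append, List.nodup_append] at hw
    refine ⟨fun hc => hw.1 (Or.inl hc), fun hc => ?_⟩
    exact hw.2.2.2 _ hc x1 (by simp) rfl
  exact ⟨w, h.okT (Or.inl rfl) (Or.inr rfl) (le_trans hle hHE) hw'.1 hw'.2, hle⟩

lemma Cls.exists_fam (h : Cls E x0 x1 U m) (hk : ∀ X : Set V, x0 ∈ X → x1 ∉ X → k ≤ cut E X) :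
    ∃ F H, Fam E x0 x1 U F H ∧ nk F = k := by
  have key : ∀ n (E' : Multiset (Sym2 V)), E' ≤ E → Route {x1} (Multiset.replicate n x0) E' →
      ∃ F H, Fam E' x0 x1 U F H ∧ nk F = n := by
    intro n
    induction n with
    | zero => exact fun E' _ _ => ⟨0, E', ⟨by simp, by simp⟩, rfl⟩
    | succ n ih =>
      intro E' hE' hR
      rw [Multiset.replicate_succ] at hR
      obtain ⟨A, B, r, rfl, rfl, hA, hB⟩ := hR.cons
      obtain ⟨F, H, hF, hn⟩ := ih B (le_trans (Multiset.le_add_left _ _) hE') hB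
      obtain ⟨w, hw, hle⟩ := h.exists_link (le_trans (Multiset.le_add_right _ _) hE') hA
      obtain ⟨C, rfl⟩ := Multiset.le_iff_exists_add.1 hle
      refine ⟨(x0, w, r) ::ₘ F, C + H, ⟨?_, ?_⟩, ?_⟩
      · intro T hT
        rcases Multiset.mem_cons.1 hT with rfl | hT
        · exact hw
        · exact hF.ok T hT
      · rw [← hF.sum, Multiset.map_cons, Multiset.sum_cons, te]; abel
      · rw [nk_cons, hn, tk, if_neg h.ne]; omega
  refine key k E le_rfl (route_of_cut _ _ _ fun X hX => ?_)
  rw [Set.disjoint_singleton_right] at hX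
  by_cases h0 : x0 ∈ X
  · refine le_trans ?_ (hk X h0 hX)
    rw [tok]
    exact (Multiset.countP_le_card _ _).trans (by simp)
  · rw [tok, Multiset.countP_eq_zero.2]
    · simp
    · intro a ha
      rwa [Multiset.eq_of_mem_replicate ha]

/-- A family with at least `k` links covering as many edges as possible. -/
structure MaxFam (E : Multiset (Sym2 V)) (x0 x1 : V) (U : Set V) (k : ℕ)
    (F : Multiset (Trl V)) (H : Multiset (Sym2 V)) : Prop extends Fam E x0 x1 U F H where
  le_nk : k ≤ nk F
  min : ∀ F' H', Fam E x0 x1 U F' H' → k ≤ nk F' → H.card ≤ H'.card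

lemma Fam.exists_max (h : Fam E x0 x1 U F H) (hk : k ≤ nk F) :
    ∃ F H, MaxFam E x0 x1 U k F H := by
  have hex : ∃ n F H, Fam E x0 x1 U F H ∧ k ≤ nk F ∧ H.card = n := ⟨_, F, H, h, hk, rfl⟩
  obtain ⟨F, H, h1, h2, h3⟩ := Nat.find_spec hex
  exact ⟨F, H, h1, h2, fun F' H' h1' h2' => h3 ▸ Nat.find_min' hex ⟨F', H', h1', h2', rfl⟩⟩

namespace Fam

lemma cut_sum_eq_zero {X : Set V} (hF : ∀ T ∈ F, OkT x0 x1 U T) (h0 : x0 ∉ X) (h1 : x1 ∉ X)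
    (hX : ∀ v ∈ X, Off F v) : cut (F.map te).sum X = 0 := by
  induction F using Multiset.induction with
  | empty => simp
  | cons T F ih =>
    rw [Multiset.map_cons, Multiset.sum_cons, cut_add,
      ih (fun S hS => hF S (Multiset.mem_cons_of_mem hS)) (fun v hv => (off_cons.1 (hX v hv)).2),
      te, seg, add_zero]
    have hok := hF T (by simp)
    refine cut_walkEdges_of_disjoint fun v hv hvZ => ?_
    have hr : ∀ r, r = x0 ∨ r = x1 → r ∉ X := by
      rintro r (rfl | rfl); exacts [h0, h1]
    simp only [List.mem_cons, List.mem_append, List.not_mem_nil, or_false] at hv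
    rcases hv with rfl | hv | rfl
    · exact hr _ hok.1 hvZ
    · exact (off_cons.1 (hX v hvZ)).1 hv
    · exact hr _ hok.2.1 hvZ

end Fam

namespace MaxFam

lemma le (h : MaxFam E x0 x1 U k F H) : H ≤ E := by
  rw [← h.sum]; exact Multiset.le_add_left _ _

lemma not_okT (h : MaxFam E x0 x1 U k F H) (hT : OkT x0 x1 U T) : ¬ te T ≤ H := by
  intro hle
  obtain ⟨C, rfl⟩ := Multiset.le_iff_exists_add.1 hle
  have h' : Fam E x0 x1 U F (C + te T) := by rw [add_comm]; exact h.toFam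
  have := h.min _ _ (h'.add hT) (by rw [nk_cons]; have := h.le_nk; omega)
  have hc := card_seg_pos T.1 T.2.2 T.2.1
  rw [Multiset.card_add, te] at this
  omega

lemma not_closed (h : MaxFam E x0 x1 U k (T ::ₘ F) H) {t : V} {w : List V} (ht : t ∈ T.2.1)
    (hw : ∀ v ∈ w, v ∈ U) : ¬ seg t w t ≤ H := by
  intro hle
  obtain ⟨C, rfl⟩ := Multiset.le_iff_exists_add.1 hle
  obtain ⟨a, l, b⟩ := T
  obtain ⟨p, q, rfl⟩ := List.append_of_mem ht
  have hT := h.ok (a, p ++ t :: q, b) (by simp)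
  have h' := h.toFam.replace (T' := (a, p ++ t :: (w ++ t :: q), b)) (H' := C)
    ⟨hT.1, hT.2.1, fun z hz => by
      simp only [List.mem_append, List.mem_cons] at hz
      rcases hz with hz | rfl | hz | rfl | hz
      exacts [hT.2.2 z (by simp [hz]), hT.2.2 z (by simp), hw z hz, hT.2.2 z (by simp),
        hT.2.2 z (by simp [hz])]⟩ (by
    simp only [te, seg_append]; abel)
  have := h.min _ _ h' (by have := h.le_nk; rw [nk_cons] at this ⊢; exact this)
  have hc := card_seg_pos t t w
  rw [Multiset.card_add] at this
  omega

lemma not_cn (h : MaxFam E x0 x1 U k F H) (hC : Cls E x0 x1 U m) : ¬ Cn H x0 x1 := by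
  intro hH
  obtain ⟨w, h1, h2⟩ := hC.exists_link h.le hH
  exact h.not_okT h1 h2

/-- A vertex off the family is joined by unused edges to two vertices on it. -/
lemma exists_of_off (h : MaxFam E x0 x1 U k F H) (hC : Cls E x0 x1 U m) {w : V} (hwU : w ∈ U)
    (hw : Off F w) : ∃ u ∈ U, ∃ v ∈ U, u ≠ v ∧ ¬ Off F u ∧ ¬ Off F v ∧ Cn H u v := by
  set D : Set V := {v | v ∈ U ∧ Off F v} with hD
  set HD := H.filter fun e => ∀ v ∈ e, v ∈ D with hHD
  set Z : Set V := {v | v ∈ D ∧ Cn HD w v} with hZ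
  have hwZ : w ∈ Z := ⟨⟨hwU, hw⟩, Cn.refl _ _⟩
  have h3 := hC.n3 Z ⟨w, hwZ⟩ fun v hv => hv.1.1
  have hF0 := Fam.cut_sum_eq_zero (X := Z) h.ok (fun hc => hC.x0U hc.1.1)
    (fun hc => hC.x1U hc.1.1) fun v hv => hv.1.2
  rw [← h.sum, cut_add, hF0, zero_add] at h3
  have hcard : 3 ≤ (H.filter (crosses Z)).card := by rwa [← Multiset.countP_eq_card_filter]
  obtain ⟨S, hS⟩ := Multiset.card_pos_iff_exists_mem.1
    (by rw [Multiset.card_powersetCard]; exact Nat.choose_pos hcard :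
      0 < (Multiset.powersetCard 3 (H.filter (crosses Z))).card)
  obtain ⟨hSle, hS3⟩ := Multiset.mem_powersetCard.1 hS
  obtain ⟨e1, e2, e3, rfl⟩ := Multiset.card_eq_three.1 hS3
  have hcr : ∀ e ∈ ({e1, e2, e3} : Multiset (Sym2 V)), ∃ u v, e = s(u, v) ∧ u ∈ Z ∧ v ∉ D := by
    intro e he
    have := Multiset.mem_of_le hSle he
    rw [Multiset.mem_filter] at this
    obtain ⟨heH, u, v, rfl, hu, hv⟩ := this
    refine ⟨u, v, rfl, hu, fun hvD => hv ⟨hvD, hu.2.trans (Cn.of_mem ?_)⟩⟩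
    rw [hHD, Multiset.mem_filter]
    refine ⟨heH, fun x hx => ?_⟩
    rcases Sym2.mem_iff.1 hx with rfl | rfl
    exacts [hu.1, hvD]
  obtain ⟨u1, v1, rfl, hu1, hv1⟩ := hcr e1 (by simp)
  obtain ⟨u2, v2, rfl, hu2, hv2⟩ := hcr e2 (by simp)
  obtain ⟨u3, v3, rfl, hu3, hv3⟩ := hcr e3 (by simp)
  have hSH := le_trans hSle (Multiset.filter_le _ _)
  have key : ∀ u v u' v' : V, u ∈ Z → u' ∈ Z → v ∉ D → v' ∉ D →
      ({s(u, v), s(u', v')} : Multiset (Sym2 V)) ≤ H →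
      Cn H v v' ∧ ((v = x0 ∨ v = x1) → (v' = x0 ∨ v' = x1) → False) ∧ (v ∈ U → v = v' → False) := by
    intro u v u' v' hu hu' hv hv' hle
    obtain ⟨C, rfl⟩ := Multiset.le_iff_exists_add.1 hle
    obtain ⟨l, hl, hlw, hle2⟩ := (hu.2.symm.trans hu'.2).exists_path
    have hfil : HD ≤ C := by
      rw [hHD, Multiset.filter_add]
      rw [(Multiset.filter_eq_nil (s := {s(u, v), s(u', v')})).2, zero_add]
      · exact Multiset.filter_le _ _
      · intro e he hcon
        simp only [Multiset.insert_eq_cons, Multiset.mem_cons, Multiset.mem_singleton] at he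
        rcases he with rfl | rfl
        · exact hv (hcon v (by simp))
        · exact hv' (hcon v' (by simp))
    have hlU : ∀ x ∈ l, x ∈ U := by
      intro x hx
      by_contra hxU
      have hux : u ≠ x := by rintro rfl; exact hxU hu.1.1
      have hc : Cn HD u x := (Cn.of_walk (List.mem_of_mem_head? hlw.1) hx).mono hle2
      have := hc.symm.cut_pos (X := {x}) rfl (by simpa using hux)
      obtain ⟨e, he, a, b, rfl, ha, hb⟩ := cut_pos_iff.1 this
      rw [hHD, Multiset.mem_filter] at he
      have hd : a ∈ D := he.2 a (by simp)
      rw [Set.mem_singleton_iff] at ha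
      subst ha
      exact hxU hd.1
    have hseg : seg v l v' ≤ ({s(u, v), s(u', v')} : Multiset (Sym2 V)) + C := by
      rw [seg_of_isWalk hlw]
      exact add_le_add le_rfl (hle2.trans hfil)
    refine ⟨(seg_cn_ends v l v').mono hseg, fun hr hr' => ?_, fun hvU hvv => ?_⟩
    · exact h.not_okT (T := (v, l, v')) ⟨hr, hr', hlU⟩ hseg
    · subst hvv
      have : ¬ Off F v := fun hoff => hv ⟨hvU, hoff⟩
      obtain ⟨T, F', rfl, hvT⟩ := not_off.1 this
      exact h.not_closed hvT hlU hseg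
  have hv12 := key u1 v1 u2 v2 hu1 hu2 hv1 hv2 (le_trans (by
    rw [show ({s(u1, v1), s(u2, v2), s(u3, v3)} : Multiset (Sym2 V)) =
      {s(u1, v1), s(u2, v2)} + {s(u3, v3)} from rfl]; exact Multiset.le_add_right _ _) hSH)
  have hv23 := key u2 v2 u3 v3 hu2 hu3 hv2 hv3 (le_trans (by
    rw [show ({s(u1, v1), s(u2, v2), s(u3, v3)} : Multiset (Sym2 V)) =
      {s(u1, v1)} + {s(u2, v2), s(u3, v3)} from rfl]; exact Multiset.le_add_left _ _) hSH)
  have hv13 := key u1 v1 u3 v3 hu1 hu3 hv1 hv3 (le_trans (by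
    simp only [Multiset.insert_eq_cons]
    exact Multiset.cons_le_cons _ (Multiset.le_cons_self _ _)) hSH)
  have hsupp : ∀ u v, s(u, v) ∈ H → v ∉ D → (v = x0 ∨ v = x1) ∨ v ∈ U ∧ ¬ Off F v := by
    intro u v he hv
    rcases hC.supp _ (Multiset.mem_of_le h.le he) v (by simp) with h1 | h1
    · exact Or.inr ⟨h1, fun hoff => hv ⟨h1, hoff⟩⟩
    · exact Or.inl h1
  have r1 := hsupp u1 v1 (Multiset.mem_of_le hSH (by simp)) hv1
  have r2 := hsupp u2 v2 (Multiset.mem_of_le hSH (by simp)) hv2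
  have r3 := hsupp u3 v3 (Multiset.mem_of_le hSH (by simp)) hv3
  rcases r1 with r1 | r1
  · rcases r2 with r2 | r2
    · exact (hv12.2.1 r1 r2).elim
    rcases r3 with r3 | r3
    · exact (hv13.2.1 r1 r3).elim
    exact ⟨v2, r2.1, v3, r3.1, hv23.2.2 r2.1, r2.2, r3.2, hv23.1⟩
  · rcases r2 with r2 | r2
    · rcases r3 with r3 | r3
      · exact (hv23.2.1 r2 r3).elim
      exact ⟨v1, r1.1, v3, r3.1, hv13.2.2 r1.1, r1.2, r3.2, hv13.1⟩
    · exact ⟨v1, r1.1, v2, r2.1, hv12.2.2 r1.1, r1.2, r2.2, hv12.1⟩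

end MaxFam

namespace Fam

/-- Vertices reached by unused edges from a block of vertices lying only on the trail `T` and
delimited by vertices lying on several trails avoid the remaining parts of the family. -/
lemma block_avoid (h : Fam E x0 x1 U (T ::ₘ F) H) (h2 : 2 ≤ m) (hm : m ≤ nk (T ::ₘ F))
    (hD : ¬ Dm E m x0 x1 U) {L q S : List V} (hw : T.2.1 = L ++ (q ++ S))
    (hL : L = [] ∨ ∃ p z, L = p ++ [z] ∧ ¬ Off F z) (hq : ∀ v ∈ q, Off F v)
    (hS : S = [] ∨ ∃ z s, S = z :: s ∧ ¬ Off F z) {u v : V} (hu : u ∈ q) (huv : Cn H u v) :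
    Off F v ∧ v ∉ L ∧ v ∉ S := by
  have huT : u ∈ T.2.1 := by simp [hw, hu]
  have hoffv : Off F v := by
    by_contra hc
    obtain ⟨T', F, rfl, hv⟩ := not_off.1 hc
    have : u ≠ v := by rintro rfl; exact hc (hq u hu)
    exact hD (h.dm_of_two h2 hm huT hv this huv)
  obtain ⟨a, w, b⟩ := T
  simp only at hw huT
  subst hw
  obtain ⟨q1, q2, rfl⟩ := List.append_of_mem hu
  refine ⟨hoffv, fun hv => ?_, fun hv => ?_⟩
  · rcases hL with rfl | ⟨p, z, rfl, hz⟩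
    · simp at hv
    · obtain ⟨T', F, rfl, hz'⟩ := not_off.1 hz
      have hvz : v ≠ z := by rintro rfl; exact hz hoffv
      have hv : v ∈ p := by simpa [hvz] using hv
      obtain ⟨p1, p2, rfl⟩ := List.append_of_mem hv
      have h' : Fam E x0 x1 U ((a, p1 ++ v :: ((p2 ++ z :: q1) ++ u :: (q2 ++ S)), b) ::ₘ
        T' ::ₘ F) H := by simpa using h
      by_cases hvu : v = u
      · subst hvu
        exact hD (h'.dm_of_loop h2 (by simpa using hm) hvz.symm (by simp) hz')
      · exact hD (h'.dm_of_chord h2 (by simpa using hm) hvu huv.symm (z := z) (by simp) hz')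
  · rcases hS with rfl | ⟨z, s, rfl, hz⟩
    · simp at hv
    · obtain ⟨T', F, rfl, hz'⟩ := not_off.1 hz
      have hvz : v ≠ z := by rintro rfl; exact hz hoffv
      have hv : v ∈ s := by simpa [hvz] using hv
      obtain ⟨s1, s2, rfl⟩ := List.append_of_mem hv
      have h' : Fam E x0 x1 U ((a, (L ++ q1) ++ u :: ((q2 ++ z :: s1) ++ v :: s2), b) ::ₘ
        T' ::ₘ F) H := by simpa using h
      by_cases hvu : v = u
      · subst hvu
        exact hD (h'.dm_of_loop h2 (by simpa using hm) hvz.symm (by simp) hz')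
      · exact hD (h'.dm_of_chord h2 (by simpa using hm) (Ne.symm hvu) huv (z := z) (by simp) hz')

lemma block_rooted (h : Fam E x0 x1 U (T ::ₘ F) H) (hC : Cls E x0 x1 U m) (h2 : 2 ≤ m)
    (hm : m ≤ nk (T ::ₘ F)) (hD : ¬ Dm E m x0 x1 U) {L q S : List V}
    (hw : T.2.1 = L ++ (q ++ S)) (hL : L = [] ∨ ∃ p z, L = p ++ [z] ∧ ¬ Off F z) (hq0 : q ≠ [])
    (hq : ∀ v ∈ q, Off F v) (hS : S = [] ∨ ∃ z s, S = z :: s ∧ ¬ Off F z) :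
    ∃ u ∈ q, Rooted H x0 x1 u := by
  by_contra hcon
  push Not at hcon
  set Z : Set V := {v | ∃ u ∈ q, Cn H u v} with hZ
  have h0 : x0 ∉ Z := by
    rintro ⟨u, hu, hc⟩; exact hcon u hu ⟨x0, Or.inl rfl, hc⟩
  have h1 : x1 ∉ Z := by
    rintro ⟨u, hu, hc⟩; exact hcon u hu ⟨x1, Or.inr rfl, hc⟩
  have hqZ : ∀ v ∈ q, v ∈ Z := fun v hv => ⟨v, hv, Cn.refl _ _⟩
  have hok := h.ok T (by simp)
  have hr : ∀ r, r = x0 ∨ r = x1 → r ∉ Z := by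
    rintro r (rfl | rfl); exacts [h0, h1]
  have h3 : 3 ≤ cut E Z := by
    rw [hC.cut_inter h0 h1]
    refine hC.n3 _ ?_ Set.inter_subset_right
    obtain ⟨u, hu⟩ := List.exists_mem_of_ne_nil q hq0
    exact ⟨u, hqZ u hu, hok.2.2 u (by simp [hw, hu])⟩
  have hav : ∀ v ∈ Z, Off F v ∧ v ∉ L ∧ v ∉ S := by
    rintro v ⟨u, hu, hc⟩
    exact h.block_avoid h2 hm hD hw hL hq hS hu hc
  have hH0 : cut H Z = 0 := by
    rw [cut_eq_zero_iff]
    rintro e he ⟨u, v, rfl, ⟨u', hu', hc⟩, hv⟩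
    exact hv ⟨u', hu', hc.trans (Cn.of_mem he)⟩
  have hT2 : cut (te T) Z ≤ 2 := by
    rw [te, seg, hw, show T.1 :: (L ++ (q ++ S) ++ [T.2.2]) = (T.1 :: L) ++ (q ++ (S ++ [T.2.2]))
      by simp]
    refine cut_walkEdges_block_le ?_ hqZ ?_
    · intro v hv hvZ
      rcases List.mem_cons.1 hv with rfl | hv
      exacts [hr _ hok.1 hvZ, (hav v hvZ).2.1 hv]
    · intro v hv hvZ
      simp only [List.mem_append, List.mem_cons, List.not_mem_nil, or_false] at hv
      rcases hv with hv | rfl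
      exacts [(hav v hvZ).2.2 hv, hr _ hok.2.1 hvZ]
  have hF0 := cut_sum_eq_zero (fun S hS => h.ok S (Multiset.mem_cons_of_mem hS)) h0 h1
    (fun v hv => (hav v hv).1)
  rw [← h.sum, cut_add, Multiset.map_cons, Multiset.sum_cons, cut_add, hH0, hF0] at h3
  omega

/-- A vertex lying on exactly one trail forces a vertex on that trail and no other joined to a
root by unused edges. -/
lemma exists_rooted_of_priv (h : Fam E x0 x1 U (T ::ₘ F) H) (hC : Cls E x0 x1 U m)
    (h2 : 2 ≤ m) (hm : m ≤ nk (T ::ₘ F)) (hD : ¬ Dm E m x0 x1 U) {x : V} (hx : x ∈ T.2.1)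
    (hx' : Off F x) : ∃ u ∈ T.2.1, Off F u ∧ Rooted H x0 x1 u := by
  obtain ⟨L, q, S, hw, hxq, hq, hL, hS⟩ := List.exists_block (Off F) hx hx'
  obtain ⟨u, hu, hr⟩ := h.block_rooted hC h2 hm hD hw hL (by rintro rfl; simp at hxq) hq hS
  exact ⟨u, by simp [hw, hu], hq u hu, hr⟩

end Fam
end

lemma List.exists_repeat {l : List V} (h : ¬ l.Nodup) :
    ∃ p u q s, l = p ++ u :: (q ++ u :: s) := by
  induction l with
  | nil => simp at h
  | cons a l ih =>
    rw [List.nodup_cons, not_and_or, not_not] at h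
    rcases h with h | h
    · obtain ⟨q, s, rfl⟩ := List.append_of_mem h
      exact ⟨[], a, q, s, rfl⟩
    · obtain ⟨p, u, q, s, rfl⟩ := ih h
      exact ⟨a :: p, u, q, s, rfl⟩

/-- Two lists without repetitions, with the same members in the same order, are equal. -/
lemma List.eq_of_order {l l' : List V} (h : l.Nodup) (h' : l'.Nodup) (hm : ∀ v, v ∈ l ↔ v ∈ l')
    (ho : ∀ b c p q s p' q' s', b ≠ c → l = p ++ b :: (q ++ c :: s) →
      l' = p' ++ c :: (q' ++ b :: s') → False) : l = l' := by
  induction l generalizing l' with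
  | nil =>
    cases l' with
    | nil => rfl
    | cons a l' => simpa using hm a
  | cons a l ih =>
    cases l' with
    | nil => simpa using hm a
    | cons a' l' =>
      have haa : a = a' := by
        by_contra hne
        have h1 : a ∈ l' := by simpa [hne] using (hm a).1 (by simp)
        have h2 : a' ∈ l := by simpa [Ne.symm hne] using (hm a').2 (by simp)
        obtain ⟨q, s, rfl⟩ := List.append_of_mem h1
        obtain ⟨q', s', rfl⟩ := List.append_of_mem h2
        exact ho a a' [] q' s' [] q s hne rfl rfl
      subst haa
      rw [List.nodup_cons] at h h'
      rw [ih h.2 h'.2]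
      · intro v
        by_cases hv : v = a
        · subst hv; simp [h.1, h'.1]
        · simpa [hv] using hm v
      · rintro b c p q s p' q' s' hbc rfl rfl
        exact ho b c (a :: p) q s (a :: p') q' s' hbc rfl rfl

section

variable {E : Multiset (Sym2 V)} {m k : ℕ} {x0 x1 : V} {U : Set V} {F K F' : Multiset (Trl V)}
  {H : Multiset (Sym2 V)} {T T' : Trl V}

lemma cut_replicate_of_not_mem {X : Set V} (h0 : x0 ∉ X) (h1 : x1 ∉ X) (n : ℕ) :
    cut (Multiset.replicate n s(x0, x1)) X = 0 := by
  rw [cut_eq_zero_iff]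
  intro e he
  rw [Multiset.eq_of_mem_replicate he, crosses_mk]
  tauto

/-- Many parallel edges between the roots together with an edge avoiding the roots. -/
lemma Cls.dm_of_direct (h : Cls E x0 x1 U m) (h2 : 2 ≤ m) {v1 v2 : V} (hv1 : v1 ∈ U)
    (hv2 : v2 ∈ U) (hv : v1 ≠ v2)
    (hE : Multiset.replicate m s(x0, x1) + {s(v1, v2)} ≤ E) : Dm E m x0 x1 U := by
  obtain ⟨R, rfl⟩ := Multiset.le_iff_exists_add.1 hE
  have hR : Route {x0, x1} (v1 ::ₘ v1 ::ₘ v2 ::ₘ v2 ::ₘ 0) R := by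
    refine route_of_cut _ _ _ fun X hX => ?_
    have h0 : x0 ∉ X := fun hc => Set.disjoint_left.1 hX hc (by simp)
    have h1 : x1 ∉ X := fun hc => Set.disjoint_left.1 hX hc (by simp)
    have hcut : cut R X + (if crosses X s(v1, v2) then 1 else 0) =
        cut (Multiset.replicate m s(x0, x1) + {s(v1, v2)} + R) (X ∩ U) := by
      rw [← h.cut_inter h0 h1, cut_add, cut_add, cut_replicate_of_not_mem h0 h1,
        ← Multiset.cons_zero, cut_cons]
      simp; omega
    simp only [tok_cons, tok_zero, crosses_mk] at hcut ⊢
    by_cases hx1 : v1 ∈ X <;> by_cases hx2 : v2 ∈ X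
    · have := h.n4 (X ∩ U) ⟨v1, ⟨hx1, hv1⟩, v2, ⟨hx2, hv2⟩, hv⟩ Set.inter_subset_right
      rw [← hcut] at this
      simp [hx1, hx2] at this ⊢
      omega
    · have := h.n3 (X ∩ U) ⟨v1, ⟨hx1, hv1⟩⟩ Set.inter_subset_right
      rw [← hcut] at this
      simp [hx1, hx2] at this ⊢
      omega
    · have := h.n3 (X ∩ U) ⟨v2, ⟨hx2, hv2⟩⟩ Set.inter_subset_right
      rw [← hcut] at this
      simp [hx1, hx2] at this ⊢
      omega
    · simp [hx1, hx2]
  obtain ⟨A1, B, r1, rfl, hr1, hA1, hR⟩ := hR.cons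
  obtain ⟨A2, B, r2, rfl, hr2, hA2, hR⟩ := hR.cons
  obtain ⟨B1, B, r3, rfl, hr3, hB1, hR⟩ := hR.cons
  obtain ⟨B2, B, r4, rfl, hr4, hB2, hR⟩ := hR.cons
  refine dm_of_thru (C := Multiset.replicate m {s(x0, x1)}) (k0 := 0) (k1 := 0)
    ⟨A1, A2, r1, r2, rfl, hA1, hA2, hr1, hr2, by simp⟩
    ⟨B1, B2, r3, r4, rfl, hB1, hB2, hr3, hr4, by simp⟩
    (Q := {s(v1, v2)}) (Cn.of_mem (by simp)) ?_ h2 (by simp) ?_ hv1 hv2 hv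
  · intro c hc
    rw [Multiset.eq_of_mem_replicate hc]
    exact Cn.of_mem (by simp)
  · rw [Multiset.sum_replicate, Multiset.nsmul_singleton]
    refine le_trans (Multiset.le_add_right _ B) (le_of_eq ?_)
    abel

/-- Many parallel edges between the roots together with a path of length two starting at a root
with no further edges. -/
lemma Cls.dm_of_direct_path (h : Cls E x0 x1 U m) (h2 : 2 ≤ m) (hc : cut E {x0} = m) {v1 v2 : V}
    (hv1 : v1 ∈ U) (hv2 : v2 ∈ U) (hv : v1 ≠ v2)
    (hE : Multiset.replicate (m - 1) s(x0, x1) + {s(x0, v1), s(v1, v2)} ≤ E) :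
    Dm E m x0 x1 U := by
  have n10 : v1 ≠ x0 := by rintro rfl; exact h.x0U hv1
  have n20 : v2 ≠ x0 := by rintro rfl; exact h.x0U hv2
  obtain ⟨R, rfl⟩ := Multiset.le_iff_exists_add.1 hE
  have hR0 : cut R {x0} = 0 := by
    have hrep : cut (Multiset.replicate (m - 1) s(x0, x1)) {x0} = m - 1 := by
      rw [cut, Multiset.countP_eq_card.2, Multiset.card_replicate]
      intro e he
      rw [Multiset.eq_of_mem_replicate he, crosses_mk]
      exact Or.inl ⟨rfl, by simpa using h.ne.symm⟩
    rw [cut_add, cut_add, hrep, Multiset.insert_eq_cons, ← Multiset.cons_zero, cut_cons, cut_cons]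
      at hc
    simp [crosses_mk, n10, n20] at hc
    omega
  have hR : Route {x0, x1} (v1 ::ₘ v2 ::ₘ v2 ::ₘ 0) R := by
    refine route_of_cut _ _ _ fun X hX => ?_
    have h0 : x0 ∉ X := fun hc => Set.disjoint_left.1 hX hc (by simp)
    have h1 : x1 ∉ X := fun hc => Set.disjoint_left.1 hX hc (by simp)
    have hcut : cut R X + (if crosses X s(v1, v2) then 1 else 0) +
        (if crosses X s(x0, v1) then 1 else 0) =
        cut (Multiset.replicate (m - 1) s(x0, x1) + {s(x0, v1), s(v1, v2)} + R) (X ∩ U) := by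
      rw [← h.cut_inter h0 h1, cut_add, cut_add, cut_replicate_of_not_mem h0 h1,
        Multiset.insert_eq_cons, ← Multiset.cons_zero, cut_cons, cut_cons]
      simp; omega
    simp only [tok_cons, tok_zero, crosses_mk] at hcut ⊢
    by_cases hx1 : v1 ∈ X <;> by_cases hx2 : v2 ∈ X
    · have := h.n4 (X ∩ U) ⟨v1, ⟨hx1, hv1⟩, v2, ⟨hx2, hv2⟩, hv⟩ Set.inter_subset_right
      rw [← hcut] at this
      simp [hx1, hx2, h0] at this ⊢
      omega
    · have := h.n3 (X ∩ U) ⟨v1, ⟨hx1, hv1⟩⟩ Set.inter_subset_right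
      rw [← hcut] at this
      simp [hx1, hx2, h0] at this ⊢
      omega
    · have := h.n3 (X ∩ U) ⟨v2, ⟨hx2, hv2⟩⟩ Set.inter_subset_right
      rw [← hcut] at this
      simp [hx1, hx2, h0] at this ⊢
      omega
    · simp [hx1, hx2]
  obtain ⟨A2, B, r2, rfl, hr2, hA2, hR⟩ := hR.cons
  obtain ⟨B1, B, r3, rfl, hr3, hB1, hR⟩ := hR.cons
  obtain ⟨B2, B, r4, rfl, hr4, hB2, hR⟩ := hR.cons
  have hr2' : r2 = x1 := by
    rcases hr2 with rfl | hr2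
    · have := hA2.cut_pos' (X := {r2}) (by simpa using n10) rfl
      rw [cut_add] at hR0
      omega
    · exact hr2
  subst hr2'
  refine dm_of_thru (C := Multiset.replicate (m - 1) {s(x0, r2)}) (k0 := 1) (k1 := 0)
    ⟨{s(x0, v1)}, A2, x0, r2, rfl, (Cn.of_mem (by simp)).symm, hA2, Or.inl rfl, Or.inr rfl,
      by rw [if_neg h.ne]⟩
    ⟨B1, B2, r3, r4, rfl, hB1, hB2, hr3, hr4, by simp⟩
    (Q := {s(v1, v2)}) (Cn.of_mem (by simp)) ?_ h2 (by simp; omega) ?_ hv1 hv2 hv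
  · intro c hc
    rw [Multiset.eq_of_mem_replicate hc]
    exact Cn.of_mem (by simp)
  · rw [Multiset.sum_replicate, Multiset.nsmul_singleton]
    refine le_trans (Multiset.le_add_right _ B) (le_of_eq ?_)
    rw [Multiset.insert_eq_cons, ← Multiset.singleton_add]
    abel

/-- Reverse a trail leading from `x1` to `x0`. -/
def orient (x0 x1 : V) (T : Trl V) : Trl V :=
  if T.1 = x1 ∧ T.2.2 = x0 then (T.2.2, T.2.1.reverse, T.1) else T

lemma te_orient (x0 x1 : V) (T : Trl V) : te (orient x0 x1 T) = te T := by
  unfold orient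
  split_ifs
  · rw [te, te, seg_reverse]
  · rfl

lemma tk_orient (x0 x1 : V) (T : Trl V) : tk (orient x0 x1 T) = tk T := by
  unfold orient
  split_ifs
  · simp [tk, eq_comm]
  · rfl

lemma OkT.orient (h : OkT x0 x1 U T) : OkT x0 x1 U (orient x0 x1 T) := by
  unfold PaperW4.orient
  split_ifs
  · exact ⟨h.2.1, h.1, fun z hz => h.2.2 z (List.mem_reverse.1 hz)⟩
  · exact h

lemma OkT.orient_ends (h : OkT x0 x1 U T) :
    (PaperW4.orient x0 x1 T).1 = x0 ∨ (PaperW4.orient x0 x1 T).2.2 = x1 := by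
  unfold PaperW4.orient
  have h1 := h.1
  have h2 := h.2.1
  split_ifs <;> tauto

lemma MaxFam.exists_oriented (h : MaxFam E x0 x1 U k F H) :
    ∃ F', MaxFam E x0 x1 U k F' H ∧ nk F' = nk F ∧ ∀ T ∈ F', T.1 = x0 ∨ T.2.2 = x1 := by
  have hnk : nk (F.map (orient x0 x1)) = nk F := by
    simp [nk, tk_orient]
  refine ⟨F.map (orient x0 x1), ⟨⟨?_, ?_⟩, hnk ▸ h.le_nk, h.min⟩, hnk, ?_⟩
  · intro T hT
    obtain ⟨S, hS, rfl⟩ := Multiset.mem_map.1 hT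
    exact (h.ok S hS).orient
  · rw [Multiset.map_map, ← h.sum]
    simp [te_orient]
  · intro T hT
    obtain ⟨S, hS, rfl⟩ := Multiset.mem_map.1 hT
    exact (h.ok S hS).orient_ends

namespace Fam

lemma te_le (h : Fam E x0 x1 U F H) (hT : T ∈ F) : te T ≤ E := by
  rw [← h.sum]
  exact le_trans (Multiset.single_le_sum (by simp) _ (Multiset.mem_map_of_mem te hT))
    (Multiset.le_add_right _ _)

lemma ne_of_edge (h : Fam E x0 x1 U F H) (hC : Cls E x0 x1 U m) (hT : T ∈ F) {u v : V}
    (he : s(u, v) ∈ te T) : u ≠ v := by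
  rintro rfl
  exact hC.loopless _ (Multiset.mem_of_le (h.te_le hT) he) rfl

lemma tk_of_nil (h : Fam E x0 x1 U F H) (hC : Cls E x0 x1 U m) (hT : T ∈ F) (hn : T.2.1 = []) :
    tk T = 1 := by
  rw [tk, if_neg]
  exact h.ne_of_edge hC hT (by rw [te, hn, seg_nil]; simp)

lemma te_of_nil (h : Fam E x0 x1 U F H) (hC : Cls E x0 x1 U m) (hT : T ∈ F) (hn : T.2.1 = []) :
    te T = {s(x0, x1)} := by
  have h1 := h.ne_of_edge hC hT (u := T.1) (v := T.2.2) (by rw [te, hn, seg_nil]; simp)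
  obtain ⟨ha, hb, -⟩ := h.ok T hT
  rw [te, hn, seg_nil]
  rcases ha with ha | ha <;> rcases hb with hb | hb <;> rw [ha, hb] at h1 ⊢
  · exact absurd rfl h1
  · rw [Sym2.eq_swap]
  · exact absurd rfl h1

lemma sum_of_nil (h : Fam E x0 x1 U F H) (hC : Cls E x0 x1 U m) (hF : F' ≤ F)
    (hn : ∀ T ∈ F', T.2.1 = []) :
    (F'.map te).sum = Multiset.replicate F'.card s(x0, x1) := by
  rw [← Multiset.nsmul_singleton, ← Multiset.sum_replicate]
  congr 1
  rw [Multiset.eq_replicate]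
  refine ⟨by simp, fun b hb => ?_⟩
  obtain ⟨T, hT, rfl⟩ := Multiset.mem_map.1 hb
  exact h.te_of_nil hC (Multiset.mem_of_le hF hT) (hn T hT)

lemma nodup_of_multi (h : Fam E x0 x1 U F H) (hC : Cls E x0 x1 U m) (h2 : 2 ≤ m)
    (hm : m ≤ nk F) (hD : ¬ Dm E m x0 x1 U) (hall : ∀ v ∈ U, Multi F v) (hT : T ∈ F) :
    T.2.1.Nodup := by
  by_contra hcon
  obtain ⟨p, u, q, s, hw⟩ := List.exists_repeat hcon
  cases q with
  | nil =>
    refine h.ne_of_edge hC hT (u := u) (v := u) ?_ rfl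
    rw [te, hw, seg_append]
    simp [seg_cons]
  | cons z q =>
    have hzu : z ≠ u := (h.ne_of_edge hC hT (u := u) (v := z) (by
      rw [te, hw, seg_append]; simp [seg_cons])).symm
    obtain ⟨F', rfl⟩ := Multiset.exists_cons_of_mem hT
    obtain ⟨T', F'', rfl, hz'⟩ := not_off.1
      (hall z (h.mem_U hT (by simp [hw]))).not_off_of_cons
    obtain ⟨a, w, b⟩ := T
    simp only at hw
    subst hw
    exact hD (h.dm_of_loop h2 hm hzu (by simp) hz')

end Fam

lemma MaxFam.all_multi (h : MaxFam E x0 x1 U k F H) (hC : Cls E x0 x1 U m) (h2 : 2 ≤ m)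
    (hk : m ≤ k) (hD : ¬ Dm E m x0 x1 U) (hr : ∀ v, ¬ Off F v → ¬ Rooted H x0 x1 v) :
    (∀ v ∈ U, Multi F v) ∧ H = 0 := by
  have hm : m ≤ nk F := hk.trans h.le_nk
  have hpriv : ∀ v, ¬ Priv F v := by
    rintro v ⟨T, F', rfl, hv, hoff⟩
    obtain ⟨u, hu, -, hru⟩ := h.exists_rooted_of_priv hC h2 hm hD hv hoff
    exact hr u (not_off.2 ⟨T, F', rfl, hu⟩) hru
  have hU : ∀ v ∈ U, Multi F v := by
    intro v hv
    rcases off_or_priv_or_multi F v with h1 | h1 | h1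
    · obtain ⟨u, -, u', -, hne, hu, hu', hcn⟩ := h.exists_of_off hC hv h1
      exact absurd (h.priv_of_cn h2 hm hD hu hu' hne hcn) (hpriv u)
    · exact absurd h1 (hpriv v)
    · exact h1
  refine ⟨hU, ?_⟩
  rw [Multiset.eq_zero_iff_forall_notMem]
  intro e he
  have heE := Multiset.mem_of_le h.le he
  induction e with | _ u v =>
  have hne : u ≠ v := by rintro rfl; exact hC.loopless _ heE rfl
  rcases hC.supp _ heE u (by simp) with hu | hu <;> rcases hC.supp _ heE v (by simp) with hv | hv
  · exact hpriv u (h.priv_of_cn h2 hm hD (hU u hu).not_off (hU v hv).not_off hne (Cn.of_mem he))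
  · exact hr u (hU u hu).not_off ⟨v, hv, Cn.of_mem he⟩
  · exact hr v (hU v hv).not_off ⟨u, hu, (Cn.of_mem he).symm⟩
  · refine h.not_cn hC ?_
    rcases hu with rfl | rfl <;> rcases hv with rfl | rfl
    exacts [absurd rfl hne, Cn.of_mem he, (Cn.of_mem he).symm, absurd rfl hne]

/-- A decomposition of the graph into `m + 1` oriented links in which links meeting at a vertex
are parallel. -/
structure Bundle (E : Multiset (Sym2 V)) (x0 x1 : V) (U : Set V) (m : ℕ)
    (F : Multiset (Trl V)) : Prop extends Fam E x0 x1 U F 0 where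
  ends : ∀ T ∈ F, T.1 = x0 ∧ T.2.2 = x1
  card : F.card = m + 1
  multi : ∀ v ∈ U, Multi F v
  nodup : ∀ T ∈ F, T.2.1.Nodup
  same : ∀ T T' F', F = T ::ₘ T' ::ₘ F' → ∀ v, v ∈ T.2.1 → v ∈ T'.2.1 → T = T'
  long : ∀ T ∈ F, ∀ u ∈ T.2.1, ∀ v ∈ T.2.1, u ≠ v →
    ∃ K, F = T ::ₘ T ::ₘ K ∧ ∀ z ∈ T.2.1, Off K z

/-- If some vertex is joined to a root outside a family of `m + 1` links, then `D_m` is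
immersed. -/
lemma MaxFam.dm_of_rooted_vertex (h : MaxFam E x0 x1 U (m + 1) F H) (hC : Cls E x0 x1 U m)
    (h2 : 2 ≤ m) {a : V} (ha : ¬ Off F a) (hra : Rooted H x0 x1 a) : Dm E m x0 x1 U := by
  by_contra hD
  have hm1 : m + 1 ≤ nk F := h.le_nk
  have hm : m ≤ nk F := by omega
  have hmulti : ∀ b c, ¬ Off F b → Rooted H x0 x1 b → Multi F c → b = c := by
    intro b c hb hrb hc
    by_contra hbc
    exact hD (h.dm_of_rooted_multi h2 hm1 hb hrb hc hbc)
  have hnm : ∀ b, Rooted H x0 x1 b → ¬ Multi F b := by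
    intro b hrb hb
    have huniq : ∀ c, ¬ Off F c → Rooted H x0 x1 c → c = b := by
      intro c hc hrc
      by_contra hcb
      obtain ⟨T, F', rfl, hcT⟩ := not_off.1 hc
      obtain ⟨T', F'', rfl, hbT'⟩ := not_off.1 hb.not_off_of_cons
      exact hD (h.dm_of_two_rooted h2 hm1 hcT hbT' hcb hrc hrb)
    have hpriv : ∀ v, ¬ Priv F v := by
      rintro v ⟨T, F', rfl, hv, hoff⟩
      obtain ⟨u, hu, hu', hru⟩ := h.exists_rooted_of_priv hC h2 hm hD hv hoff
      have := huniq u (not_off.2 ⟨T, F', rfl, hu⟩) hru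
      subst this
      exact hb.not_off_of_cons hu'
    have hU : ∀ v ∈ U, v = b := by
      intro v hv
      rcases off_or_priv_or_multi F v with h1 | h1 | h1
      · obtain ⟨u, -, u', -, hne, hu, hu', hcn⟩ := h.exists_of_off hC hv h1
        exact absurd (h.priv_of_cn h2 hm hD hu hu' hne hcn) (hpriv u)
      · exact absurd h1 (hpriv v)
      · exact (hmulti b v hb.not_off hrb h1).symm
    obtain ⟨u, hu, v, hv, huv⟩ := hC.nontrivial
    exact huv ((hU u hu).trans (hU v hv).symm)
  have hnom : ∀ v, ¬ Multi F v := by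
    intro v hv
    have := hmulti a v ha hra hv
    exact hnm a hra (this ▸ hv)
  obtain ⟨T, F', rfl, haT⟩ := not_off.1 ha
  have hoff : ∀ v, Off F' v := by
    intro v
    by_contra hv
    obtain ⟨T', F'', rfl, hvT'⟩ := not_off.1 hv
    have hswap : T ::ₘ T' ::ₘ F'' = T' ::ₘ T ::ₘ F'' := Multiset.cons_swap _ _ _
    have hv' : Off (T ::ₘ F'') v := by
      by_contra hc
      exact hnom v (hswap ▸ multi_of_not_off hvT' hc)
    obtain ⟨u, hu, hu', hru⟩ :=
      (h.toFam.reindex hswap).exists_rooted_of_priv hC h2 (hswap ▸ hm) hD hvT' hv'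
    have hua : a ≠ u := by
      rintro rfl
      exact hu' T (by simp) haT
    exact hD (h.dm_of_two_rooted h2 hm1 haT hu hua hra hru)
  have hnil : ∀ T' ∈ F', T'.2.1 = [] := by
    intro T' hT'
    rw [List.eq_nil_iff_forall_not_mem]
    exact fun v => hoff v T' hT'
  have hon : ∀ v, ¬ Off (T ::ₘ F') v → v ∈ T.2.1 := by
    intro v hv
    by_contra hc
    exact hv (off_cons.2 ⟨hc, hoff v⟩)
  have htwo : ∃ u v, u ≠ v ∧ u ∈ T.2.1 ∧ v ∈ T.2.1 := by
    obtain ⟨c, hcU, hca⟩ := hC.nontrivial.exists_ne a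
    by_cases hc : Off (T ::ₘ F') c
    · obtain ⟨u, -, u', -, hne, hu, hu', -⟩ := h.exists_of_off hC hcU hc
      exact ⟨u, u', hne, hon u hu, hon u' hu'⟩
    · exact ⟨c, a, hca, hon c hc, haT⟩
  have hsum := h.sum
  rw [Multiset.map_cons, Multiset.sum_cons,
    h.sum_of_nil hC (Multiset.le_cons_self _ _) hnil] at hsum
  have hcard : m ≤ F'.card := by
    have h1 := nk_le_card F'
    have h3 := tk_le_one T
    rw [nk_cons] at hm1
    omega
  obtain ⟨u, v, huv, hu, hv⟩ := htwo
  rcases hw : T.2.1 with _ | ⟨v1, _ | ⟨v2, w⟩⟩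
  · simp [hw] at hu
  · simp [hw] at hu hv; exact huv (hu.trans hv.symm)
  · have hle : ({s(v1, v2)} : Multiset (Sym2 V)) ≤ te T := by
      rw [te, hw, seg_cons, seg_cons, Multiset.singleton_le]; simp
    refine hD (hC.dm_of_direct h2 (h.mem_U (T := T) (by simp) (y := v1) (by simp [hw]))
      (h.mem_U (T := T) (by simp) (y := v2) (by simp [hw]))
      (h.ne_of_edge hC (T := T) (by simp) (Multiset.singleton_le.1 hle)) ?_)
    rw [← hsum]
    obtain ⟨d, hd⟩ := Nat.exists_eq_add_of_le hcard
    rw [hd, Multiset.replicate_add]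
    obtain ⟨R, hR⟩ := Multiset.le_iff_exists_add.1 hle
    rw [hR]
    refine Multiset.le_iff_exists_add.2 ⟨R + Multiset.replicate d s(x0, x1) + H, ?_⟩
    abel

end

section

variable {E : Multiset (Sym2 V)} {m k : ℕ} {x0 x1 : V} {U : Set V} {F K F' : Multiset (Trl V)}
  {H : Multiset (Sym2 V)} {T T' : Trl V}

lemma OkT.ends_of_tk (h : OkT x0 x1 U T) (ho : T.1 = x0 ∨ T.2.2 = x1) (ht : tk T = 1) :
    T.1 = x0 ∧ T.2.2 = x1 := by
  have hne : T.1 ≠ T.2.2 := by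
    intro hc; simp [tk, hc] at ht
  have h1 := h.1
  have h2 := h.2.1
  by_cases hx : x0 = x1
  · subst hx; tauto
  · rcases h1 with h1 | h1 <;> rcases h2 with h2 | h2 <;> rcases ho with ho | ho <;>
      simp_all

namespace Fam

/-- A trail that can be spared meets another one in any two of its vertices. -/
lemma exists_twin (h : Fam E x0 x1 U (T ::ₘ F) H) (h2 : 2 ≤ m) (hm : m ≤ nk F)
    (hD : ¬ Dm E m x0 x1 U) (hall : ∀ v ∈ U, Multi (T ::ₘ F) v) {b c : V} (hb : b ∈ T.2.1)
    (hc : c ∈ T.2.1) (hbc : b ≠ c) :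
    ∃ T' F', F = T' ::ₘ F' ∧ ∀ z ∈ T.2.1, z ∈ T'.2.1 ∧ Off F' z := by
  have hF : ∀ z ∈ T.2.1, ¬ Off F z := fun z hz =>
    (hall z (h.mem_U (by simp) hz)).not_off_of_cons
  have hcn : ∀ y ∈ T.2.1, ∀ z ∈ T.2.1, Cn (H + te T) y z := fun y hy z hz =>
    (seg_cn (Or.inr (Or.inl hy)) (Or.inr (Or.inl hz))).right _
  obtain ⟨T', F', rfl, hb', hc', hbo, hco⟩ :=
    h.drop.exists_common h2 hm hD (hF b hb) (hF c hc) hbc (hcn b hb c hc)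
  refine ⟨T', F', rfl, fun z hz => ?_⟩
  by_cases hzb : z = b
  · subst hzb; exact ⟨hb', hbo⟩
  · obtain ⟨T'', F'', hF'', hb'', hz'', hbo'', hzo''⟩ :=
      h.drop.exists_common h2 hm hD (hF b hb) (hF z hz) (Ne.symm hzb) (hcn b hb z hz)
    have hmem : T' ∈ T'' ::ₘ F'' := hF'' ▸ Multiset.mem_cons_self _ _
    rcases Multiset.mem_cons.1 hmem with rfl | hmem
    · rw [Multiset.cons_inj_right] at hF''
      subst hF''
      exact ⟨hz'', hzo''⟩
    · exact absurd hb' (hbo'' T' hmem)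

end Fam

namespace MaxFam

/-- In a family of `m + 1` links, no trail with an inner vertex can be spared. -/
lemma dm_of_spare (h : Fam E x0 x1 U (T ::ₘ F) H) (h2 : 2 ≤ m) (hm : m + 1 ≤ nk F)
    (hall : ∀ v ∈ U, Multi (T ::ₘ F) v) (hU : U.Nontrivial) {b : V} (hb : b ∈ T.2.1) :
    Dm E m x0 x1 U := by
  by_contra hD
  obtain ⟨c, hcU, hcb⟩ := hU.exists_ne b
  have hbF := (hall b (h.mem_U (by simp) hb)).not_off_of_cons
  have hok := h.ok T (by simp)
  by_cases hc : c ∈ T.2.1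
  · obtain ⟨T', F', rfl, hz⟩ := h.exists_twin h2 (by omega) hD hall hb hc hcb.symm
    have ht := tk_le_one T'
    exact hD (h.dm_of_share' h2 hb hc (hz b hb).1 (hz c hc).1 hcb.symm
      (Or.inl (by rw [nk_cons] at hm; omega)))
  · exact hD (h.drop.dm_of_rooted_multi h2 hm hbF
      ⟨T.1, hok.1, (seg_cn (Or.inr (Or.inl hb)) (Or.inl rfl)).right _⟩
      ((hall c hcU).of_cons hc) hcb.symm)

lemma bundle (h : MaxFam E x0 x1 U (m + 1) F H) (hC : Cls E x0 x1 U m)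
    (h2 : 2 ≤ m) (hD : ¬ Dm E m x0 x1 U) (hor : ∀ T ∈ F, T.1 = x0 ∨ T.2.2 = x1) :
    Bundle E x0 x1 U m F := by
  have hm1 : m + 1 ≤ nk F := h.le_nk
  obtain ⟨hall, rfl⟩ := h.all_multi hC h2 (by omega) hD
    fun v hv hr => hD (h.dm_of_rooted_vertex hC h2 hv hr)
  have hfam := h.toFam
  have hsp : ∀ T F', F = T ::ₘ F' → ∀ b ∈ T.2.1, nk F' ≤ m := by
    rintro T F' rfl b hb
    by_contra hcon
    exact hD (dm_of_spare hfam h2 (by omega) hall hC.nontrivial hb)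
  have htk : ∀ T ∈ F, tk T = 1 := by
    intro T hT
    rcases hw : T.2.1 with _ | ⟨b, w⟩
    · exact hfam.tk_of_nil hC hT hw
    · obtain ⟨F', rfl⟩ := Multiset.exists_cons_of_mem hT
      have := hsp T F' rfl b (by simp [hw])
      have ht := tk_le_one T
      rw [nk_cons] at hm1
      omega
  have hnk : nk F = F.card := by
    rw [nk, Multiset.map_congr rfl htk]; simp
  have hnkeq : nk F = m + 1 := by
    obtain ⟨u, hu⟩ := hC.nontrivial.nonempty
    obtain ⟨T, T', F', rfl, hT, -⟩ := hall u hu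
    have := hsp T _ rfl u hT
    have ht := tk_le_one T
    rw [nk_cons] at hm1 ⊢
    omega
  have hends : ∀ T ∈ F, T.1 = x0 ∧ T.2.2 = x1 := fun T hT =>
    (h.ok T hT).ends_of_tk (hor T hT) (htk T hT)
  have hnd : ∀ T ∈ F, T.2.1.Nodup := fun T hT =>
    hfam.nodup_of_multi hC h2 (by omega) hD hall hT
  have hrest : ∀ T F', F = T ::ₘ F' → nk F' = m := by
    rintro T F' rfl
    have := htk T (by simp)
    rw [nk_cons] at hnkeq
    omega
  have hlong : ∀ T ∈ F, ∀ u ∈ T.2.1, ∀ v ∈ T.2.1, u ≠ v →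
      ∃ F', F = T ::ₘ T ::ₘ F' ∧ ∀ z ∈ T.2.1, Off F' z := by
    intro T hT u hu v hv huv
    obtain ⟨F1, rfl⟩ := Multiset.exists_cons_of_mem hT
    obtain ⟨T', F2, rfl, hz⟩ :=
      hfam.exists_twin h2 (hrest _ _ rfl).ge hD hall hu hv huv
    have hswap : T ::ₘ T' ::ₘ F2 = T' ::ₘ T ::ₘ F2 := Multiset.cons_swap _ _ _
    obtain ⟨T'', F3, hF3, hz'⟩ :=
      (hfam.reindex hswap).exists_twin h2 (hrest _ _ hswap).ge hD (hswap ▸ hall)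
        (hz u hu).1 (hz v hv).1 huv
    have hT'' : T'' = T := by
      have hmem : T'' ∈ T ::ₘ F2 := hF3 ▸ Multiset.mem_cons_self _ _
      rcases Multiset.mem_cons.1 hmem with h1 | h1
      · exact h1
      · exact absurd (hz' u (hz u hu).1).1 ((hz u hu).2 T'' h1)
    subst hT''
    have hTT : T'' = T' := by
      have e1 := hends T'' (by simp)
      have e2 := hends T' (by simp)
      obtain ⟨a, w, b⟩ := T''
      obtain ⟨c, w', d⟩ := T'
      simp only at e1 e2 hz hz'
      obtain ⟨rfl, rfl⟩ := e1
      obtain ⟨rfl, rfl⟩ := e2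
      have : w = w' := by
        refine List.eq_of_order (hnd _ hT) (hnd (c, w', d) (by simp))
          (fun v => ⟨fun hv => (hz v hv).1, fun hv => (hz' v hv).1⟩) ?_
        rintro y z p q s p' q' s' hyz rfl rfl
        have hr := (hfam.reindex hswap).rev
        rw [show (p' ++ z :: (q' ++ y :: s')).reverse =
          s'.reverse ++ y :: (q'.reverse ++ z :: p'.reverse) by simp, Multiset.cons_swap] at hr
        refine hD (hr.dm_of_share h2 hyz ?_)
        rw [if_neg hC.ne, if_neg hC.ne.symm]
        simp only [nk_cons] at hnkeq
        have t1 := tk_le_one (c, p ++ y :: (q ++ z :: s), d)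
        have t2 := tk_le_one (c, p' ++ z :: (q' ++ y :: s'), d)
        omega
      rw [this]
    subst hTT
    exact ⟨F2, rfl, fun z hz0 => (hz z hz0).2⟩
  refine ⟨hfam, hends, by omega, hall, hnd, ?_, hlong⟩
  have hsame : ∀ T T' F', F = T ::ₘ T' ::ₘ F' → ∀ v, v ∈ T.2.1 → v ∈ T'.2.1 →
      ∀ u ∈ T.2.1, u ≠ v → T = T' := by
    rintro T T' F' rfl v hv hv' u hu huv
    obtain ⟨F'', hF'', hz⟩ := hlong T (by simp) u hu v hv huv
    rw [Multiset.cons_inj_right] at hF''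
    have hmem : T' ∈ T ::ₘ F'' := hF'' ▸ Multiset.mem_cons_self _ _
    rcases Multiset.mem_cons.1 hmem with h1 | h1
    · exact h1.symm
    · exact absurd hv' (hz v hv T' h1)
  intro T T' F' hF v hv hv'
  by_cases h1 : ∃ u ∈ T.2.1, u ≠ v
  · obtain ⟨u, hu, huv⟩ := h1
    exact hsame T T' F' hF v hv hv' u hu huv
  by_cases h1' : ∃ u ∈ T'.2.1, u ≠ v
  · obtain ⟨u, hu, huv⟩ := h1'
    rw [Multiset.cons_swap] at hF
    exact (hsame T' T F' hF v hv' hv u hu huv).symm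
  push Not at h1 h1'
  have hsingle : ∀ w : List V, w.Nodup → v ∈ w → (∀ u ∈ w, u = v) → w = [v] := by
    intro w hw hvw hu
    rw [List.eq_replicate_of_mem hu] at hw hvw ⊢
    have := List.nodup_replicate.1 hw
    have h0 : w.length ≠ 0 := by intro hc; simp [hc] at hvw
    rw [show w.length = 1 by omega]; rfl
  have w1 := hsingle _ (hnd T (by simp [hF])) hv h1
  have w2 := hsingle _ (hnd T' (by simp [hF])) hv' h1'
  have e1 := hends T (by simp [hF])
  have e2 := hends T' (by simp [hF])
  exact Prod.ext (e1.1.trans e2.1.symm) (Prod.ext (w1.trans w2.symm) (e1.2.trans e2.2.symm))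

end MaxFam

end

section

variable {E : Multiset (Sym2 V)} {m k : ℕ} {x0 x1 : V} {U : Set V} {F K F' : Multiset (Trl V)}
  {H : Multiset (Sym2 V)} {T T' S : Trl V} {X : Set V}

lemma cut_seg_append_le (a : V) (p q : List V) (b : V) (X : Set V) :
    cut (seg a (p ++ q) b) X ≤
      cut (walkEdges (a :: p)) X + cut (walkEdges (q ++ [b])) X + 1 := by
  rw [seg, show a :: (p ++ q ++ [b]) = (a :: p) ++ (q ++ [b]) by simp]
  exact cut_walkEdges_append_le _ _ _

lemma cut_seg_le_of_enter {a b : V} {p q : List V} (ha : a ∉ X) (hp : ∀ v ∈ p, v ∉ X)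
    (hq : ∀ v ∈ q, v ∈ X) (hb : b ∈ X) : cut (seg a (p ++ q) b) X ≤ 1 := by
  have h := cut_seg_append_le a p q b X
  rwa [cut_walkEdges_of_disjoint (by simpa using ⟨ha, hp⟩), cut_walkEdges_of_subset (by
    intro v hv
    rcases List.mem_append.1 hv with hv | hv
    · exact hq v hv
    · rwa [List.mem_singleton.1 hv]), zero_add, zero_add] at h

lemma cut_seg_le_of_leave {a b : V} {p q : List V} (ha : a ∈ X) (hp : ∀ v ∈ p, v ∈ X)
    (hq : ∀ v ∈ q, v ∉ X) (hb : b ∉ X) : cut (seg a (p ++ q) b) X ≤ 1 := by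
  rw [← cut_compl]
  exact cut_seg_le_of_enter (by simpa using ha) (by simpa using hp) (by simpa using hq)
    (by simpa using hb)

lemma cut_sum_le_nk (h : ∀ T ∈ F, cut (te T) X ≤ tk T) : cut (F.map te).sum X ≤ nk F := by
  induction F using Multiset.induction with
  | empty => simp [cut_zero]
  | cons T F ih =>
    rw [Multiset.map_cons, Multiset.sum_cons, cut_add, nk_cons]
    exact add_le_add (h T (by simp)) (ih fun S hS => h S (by simp [hS]))

/-- A family of exactly `m` links from `x0`, all of whose other trails are closed at `x1`. -/
structure Tight (E : Multiset (Sym2 V)) (x0 x1 : V) (U : Set V) (m : ℕ)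
    (F : Multiset (Trl V)) (H : Multiset (Sym2 V)) : Prop extends Fam E x0 x1 U F H where
  ends : ∀ T ∈ F, T.2.2 = x1 ∧ (T.1 = x0 ∨ T.1 = x1)
  nk_eq : nk F = m
  cut_eq : cut H {x0} = 0

lemma OkT.tk_le_cut (h : OkT x0 x1 U T) (hne : x0 ≠ x1) : tk T ≤ cut (te T) {x0} := by
  by_cases hT : T.1 = T.2.2
  · simp [tk, hT]
  · rw [tk, if_neg hT]
    exact (h.cn_link hT).cut_pos rfl (by simpa using hne.symm)

lemma MaxFam.tight (h : MaxFam E x0 x1 U m F H) (hC : Cls E x0 x1 U m)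
    (hc : cut E {x0} = m) (hor : ∀ T ∈ F, T.1 = x0 ∨ T.2.2 = x1) : Tight E x0 x1 U m F H := by
  have key : ∀ F' : Multiset (Trl V), (∀ T ∈ F', tk T ≤ cut (te T) {x0}) →
      nk F' ≤ cut (F'.map te).sum {x0} ∧
      (cut (F'.map te).sum {x0} ≤ nk F' → ∀ T ∈ F', cut (te T) {x0} = tk T) := by
    intro F' hF'
    induction F' using Multiset.induction with
    | empty => simp
    | cons T F' ih =>
      obtain ⟨i1, i2⟩ := ih fun S hS => hF' S (by simp [hS])
      have h1 := hF' T (by simp)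
      rw [Multiset.map_cons, Multiset.sum_cons, cut_add, nk_cons]
      refine ⟨by omega, fun hle S hS => ?_⟩
      rcases Multiset.mem_cons.1 hS with rfl | hS
      · omega
      · exact i2 (by omega) S hS
  obtain ⟨k1, k2⟩ := key F fun T hT => (h.ok T hT).tk_le_cut hC.ne
  have hle := h.le_nk
  rw [← h.sum, cut_add] at hc
  refine ⟨h.toFam, fun T hT => ?_, by omega, by omega⟩
  have hT1 := h.ok T hT
  have hT2 := k2 (by omega) T hT
  by_cases ho : T.2.2 = x1
  · exact ⟨ho, hT1.1⟩
  · exfalso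
    have e1 : T.1 = x0 := (hor T hT).resolve_right ho
    have e2 : T.2.2 = x0 := hT1.2.1.resolve_right ho
    rw [tk, if_pos (e1.trans e2.symm), cut_eq_zero_iff] at hT2
    have hmem : ∃ v, s(x0, v) ∈ te T := by
      rcases hw : T.2.1 with _ | ⟨v, w⟩
      · exact ⟨x0, by rw [te, hw, e1, e2, seg_nil]; simp⟩
      · exact ⟨v, by rw [te, hw, e1, seg_cons]; simp⟩
    obtain ⟨v, hv⟩ := hmem
    have hne := h.toFam.ne_of_edge hC hT hv
    exact hT2 _ hv (by rw [crosses_mk]; exact Or.inl ⟨rfl, by simpa using hne.symm⟩)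

namespace Tight

lemma reindex (h : Tight E x0 x1 U m F H) (hF : F = F') : Tight E x0 x1 U m F' H := hF ▸ h

lemma tk_closed (h : T.2.2 = x1) (hT : T.1 = x1) : tk T = 0 := by simp [tk, h, hT]

lemma tk_link (hne : x0 ≠ x1) (h : T.2.2 = x1) (hT : T.1 = x0) : tk T = 1 := by
  simp [tk, h, hT, hne]

lemma cn_of_rooted (h : Tight E x0 x1 U m F H) {v : V} (hv : v ≠ x0)
    (hr : Rooted H x0 x1 v) : Cn H v x1 := by
  obtain ⟨r, rfl | rfl, hr⟩ := hr
  · have := hr.cut_pos' (X := {r}) (by simpa using hv) rfl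
    have := h.cut_eq
    omega
  · exact hr

lemma ne_of_cn (h : Tight E x0 x1 U m F H) {u v : V} (hu : u ≠ x0) (hc : Cn H u v) : v ≠ x0 := by
  rintro rfl
  have := hc.cut_pos' (X := {v}) (by simpa using hu) rfl
  have := h.cut_eq
  omega

lemma dm_of_closed (h : Tight E x0 x1 U m (T ::ₘ F) H) (h2 : 2 ≤ m) (hT : T.1 = x1) {a c : V}
    (ha : a ∈ T.2.1) (hc : c ∈ T.2.1) (hac : a ≠ c) (hcF : ¬ Off F c) (hr : Cn H a x1) :
    Dm E m x0 x1 U := by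
  obtain ⟨T', F', rfl, hcT'⟩ := not_off.1 hcF
  refine h.dm_of_rooted h2 ha hc hcT' hac ⟨x1, Or.inr rfl, hr⟩ ?_
  have := h.nk_eq
  rw [nk_cons, nk_cons, tk_closed (h.ends T (by simp)).1 hT] at this
  omega

lemma dm_of_before {a c : V} {p q s : List V} (hne : x0 ≠ x1)
    (h : Tight E x0 x1 U m ((x0, p ++ a :: (q ++ c :: s), x1) ::ₘ F) H) (h2 : 2 ≤ m)
    (hac : a ≠ c) (hcF : ¬ Off F c) (hr : Cn H a x1) : Dm E m x0 x1 U := by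
  obtain ⟨T', F', rfl, hcT'⟩ := not_off.1 hcF
  refine h.dm_of_rooted_before h2 hcT' hac (Or.inr rfl) hr ?_
  have := h.nk_eq
  rw [nk_cons, nk_cons, tk_link hne rfl rfl] at this
  rw [if_neg hne.symm]
  omega

lemma dm_of_after {a c : V} {p q s : List V} (hne : x0 ≠ x1)
    (h : Tight E x0 x1 U m ((x0, p ++ c :: (q ++ a :: s), x1) ::ₘ S ::ₘ F) H) (h2 : 2 ≤ m)
    (hS : S.1 = x1) (hcS : c ∈ S.2.1) (hac : a ≠ c) (hr : Cn H a x1) : Dm E m x0 x1 U := by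
  have hk := h.nk_eq
  rw [nk_cons, nk_cons, tk_link hne rfl rfl, tk_closed (h.ends S (by simp)).1 hS] at hk
  refine Fam.dm (K := {(x0, p ++ c :: (q ++ a :: s), x1), S}) (F' := F) (y0 := c) (y1 := a)
    (k0 := 1) (k1 := 0) (A := seg x0 p c + te S) (B := H + seg a s x1) (Q := seg c q a) (R := 0)
    (h.toFam.reindex (by simp)) ?_ ?_ (seg_cn_ends _ _ _) ?_ h2 (by omega)
    (h.mem_U (T := S) (by simp) hcS)
    (h.mem_U (T := (x0, p ++ c :: (q ++ a :: s), x1)) (by simp) (by simp)) hac.symm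
  · refine ⟨seg x0 p c, te S, x0, x1, rfl, (seg_cn_ends _ _ _).symm, ?_, Or.inl rfl, Or.inr rfl,
      by rw [if_neg hne]⟩
    have := seg_cn (a := S.1) (p := S.2.1) (b := S.2.2) (Or.inr (Or.inl hcS)) (Or.inl rfl)
    rw [te]
    rwa [hS] at this ⊢
  · exact ⟨H, seg a s x1, x1, x1, rfl, hr, seg_cn_ends _ _ _, Or.inr rfl, Or.inr rfl, by simp⟩
  · rw [Multiset.insert_eq_cons, ← Multiset.cons_zero, Multiset.map_cons, Multiset.map_cons]
    simp only [te, Multiset.map_zero, Multiset.sum_cons, Multiset.sum_zero, seg_append]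
    abel

/-- A closed trail meets the remaining trails at no vertex other than one joined to `x1` outside
the family. -/
lemma dm_of_closed_rooted (h : Tight E x0 x1 U m (S ::ₘ F) H) (hne : x0 ≠ x1) (h2 : 2 ≤ m)
    (hS : S.1 = x1) {a c : V} (hcS : c ∈ S.2.1) (hac : a ≠ c) (hcF : ¬ Off F c)
    (haF : ¬ Off F a) (hr : Cn H a x1) : Dm E m x0 x1 U := by
  by_contra hD
  have hnk : m ≤ nk F := by
    have := h.nk_eq
    rw [nk_cons, tk_closed (h.ends S (by simp)).1 hS] at this
    omega
  have hcn : Cn (H + te S) a c := by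
    refine hr.trans_add ?_
    have := seg_cn (a := S.1) (p := S.2.1) (b := S.2.2) (Or.inl rfl) (Or.inr (Or.inl hcS))
    rw [te]
    rwa [hS] at this ⊢
  obtain ⟨T, F', rfl, haT, hcT, -, -⟩ := h.drop.exists_common h2 hnk hD haF hcF hac hcn
  have hsw : S ::ₘ T ::ₘ F' = T ::ₘ S ::ₘ F' := Multiset.cons_swap _ _ _
  have hoff : ¬ Off (S ::ₘ F') c := not_off.2 ⟨S, F', rfl, hcS⟩
  have hT := h.ends T (by simp)
  rcases hT.2 with hT1 | hT1
  · obtain ⟨t, w, t'⟩ := T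
    simp only at hT hT1 haT hcT
    obtain rfl := hT1
    obtain rfl := hT.1
    rcases List.exists_split_pair haT hcT hac with ⟨p, q, s, rfl⟩ | ⟨p, q, s, rfl⟩
    · exact hD ((h.reindex hsw).dm_of_before hne h2 hac hoff hr)
    · exact hD ((h.reindex hsw).dm_of_after hne h2 hS hcS hac hr)
  · exact hD ((h.reindex hsw).dm_of_closed h2 hT1 haT hcT hac hoff hr)

/-- If all other vertices are multiple, the outside edges cannot be concentrated between `x1` and
a single vertex. -/
lemma dm_of_apex (h : Tight E x0 x1 U m F H) (hC : Cls E x0 x1 U m) (h2 : 2 ≤ m) {a : V}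
    (haU : a ∈ U) (ha : ¬ Off F a) (hr : Cn H a x1) (hH : cut H {a, x1} = 0)
    (hall : ∀ v ∈ U, v ≠ a → Multi F v) : Dm E m x0 x1 U := by
  by_contra hD
  have ha0 : a ≠ x0 := by rintro rfl; exact hC.x0U haU
  have h0X : x0 ∉ ({a, x1} : Set V) := by
    simp only [Set.mem_insert_iff, Set.mem_singleton_iff, not_or]
    exact ⟨ha0.symm, hC.ne⟩
  have hlow : m + 1 ≤ cut E {a, x1} := by
    rw [hC.cut_insert_diff h0X (by simp)]
    refine hC.si _ ?_ Set.sdiff_subset ?_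
    · obtain ⟨c, hcU, hca⟩ := hC.nontrivial.exists_ne a
      refine ⟨c, hcU, ?_⟩
      simp only [Set.mem_insert_iff, Set.mem_singleton_iff, not_or]
      exact ⟨hca, fun hc => hC.x1U (hc ▸ hcU)⟩
    · intro hc
      have : a ∈ U \ {a, x1} := hc.symm ▸ haU
      exact this.2 (by simp)
  have hup : cut E {a, x1} ≤ m := by
    rw [← h.sum, cut_add, hH, add_zero, ← h.nk_eq]
    refine cut_sum_le_nk fun T hT => ?_
    obtain ⟨F', rfl⟩ := Multiset.exists_cons_of_mem hT
    have hmul : ∀ c ∈ T.2.1, c ≠ a → ¬ Off F' c := fun c hc hca =>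
      (hall c (h.mem_U hT hc) hca).not_off_of_cons
    have hE := h.ends T hT
    rcases hE.2 with hT1 | hT1
    · rw [tk_link hC.ne hE.1 hT1]
      obtain ⟨t, w, t'⟩ := T
      simp only at hE hT1 hmul
      obtain rfl := hT1
      obtain rfl := hE.1
      have hpU : ∀ v ∈ w, v ≠ t' := by
        rintro v hv rfl
        exact hC.x1U (h.mem_U hT hv)
      by_cases haw : a ∈ w
      · obtain ⟨p, s, rfl, hap⟩ := List.eq_append_cons_of_mem haw
        refine cut_seg_le_of_enter h0X (fun v hv => ?_) (fun v hv => ?_) (by simp)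
        · simp only [Set.mem_insert_iff, Set.mem_singleton_iff, not_or]
          exact ⟨fun hc => hap (hc ▸ hv), hpU v (by simp [hv])⟩
        · by_contra hcon
          have hva : v ≠ a := fun hc => hcon (by simp [hc])
          obtain ⟨q, r, rfl⟩ := List.append_of_mem ((List.mem_cons.1 hv).resolve_left hva)
          exact hD (h.dm_of_before hC.ne h2 hva.symm (hmul v (by simp) hva) hr)
      · rw [te, ← List.append_nil w]
        refine cut_seg_le_of_enter h0X (fun v hv => ?_) (by simp) (by simp)
        simp only [Set.mem_insert_iff, Set.mem_singleton_iff, not_or]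
        exact ⟨fun hc => haw (hc ▸ hv), hpU v hv⟩
    · rw [tk_closed hE.1 hT1, Nat.le_zero]
      refine cut_walkEdges_of_subset fun v hv => ?_
      rw [List.mem_cons, List.mem_append, List.mem_singleton, hT1, hE.1] at hv
      rcases hv with rfl | hv | rfl
      · simp
      · by_contra hcon
        have hva : v ≠ a := fun hc => hcon (by simp [hc])
        by_cases haF : Off F' a
        · have haT : a ∈ T.2.1 := by
            by_contra hc
            exact ha (off_cons.2 ⟨hc, haF⟩)
          exact hD (h.dm_of_closed h2 hT1 haT hv hva.symm (hmul v hv hva) hr)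
        · exact hD (h.dm_of_closed_rooted hC.ne h2 hT1 hv hva.symm (hmul v hv hva) haF hr)
      · simp
  omega

end Tight

end

section

variable {E : Multiset (Sym2 V)} {m k : ℕ} {x0 x1 : V} {U : Set V} {F K F' : Multiset (Trl V)}
  {H : Multiset (Sym2 V)} {T T' S : Trl V} {X : Set V}

lemma Priv.eq_of_off {v : V} {G : Multiset (Trl V)} (hT : F = T ::ₘ F') (hv : Off F' v)
    (hT' : F = T' ::ₘ G) (hv' : v ∈ T'.2.1) : T' = T ∧ G = F' := by
  subst hT
  have hmem : T' ∈ T ::ₘ F' := hT' ▸ Multiset.mem_cons_self _ _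
  rcases Multiset.mem_cons.1 hmem with rfl | hmem
  · exact ⟨rfl, ((Multiset.cons_inj_right _).1 hT').symm⟩
  · exact absurd hv' (hv T' hmem)

namespace Tight

lemma dm_of_multi (ht : Tight E x0 x1 U m F H) (h : MaxFam E x0 x1 U m F H)
    (hC : Cls E x0 x1 U m) (h2 : 2 ≤ m) {a : V} (ha : Multi F a) (hr : Cn H a x1) :
    Dm E m x0 x1 U := by
  by_contra hD
  have hm := h.le_nk
  have hpriv : ∀ v, ¬ Priv F v := by
    rintro v ⟨T, F', rfl, hv, hoff⟩
    obtain ⟨u, hu, hu', hru⟩ := h.exists_rooted_of_priv hC h2 hm hD hv hoff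
    have hu0 : u ≠ x0 := by rintro rfl; exact hC.x0U (h.mem_U (by simp) hu)
    have hau : a ≠ u := by rintro rfl; exact ha.not_off_of_cons hu'
    exact ha.not_priv (h.priv_of_cn h2 hm hD ha.not_off
      (not_off.2 ⟨T, F', rfl, hu⟩) hau (hr.trans (ht.cn_of_rooted hu0 hru).symm))
  have hU : ∀ v ∈ U, Multi F v := by
    intro v hv
    rcases off_or_priv_or_multi F v with h1 | h1 | h1
    · obtain ⟨u, -, u', -, hne, hu, hu', hcn⟩ := h.exists_of_off hC hv h1
      exact absurd (h.priv_of_cn h2 hm hD hu hu' hne hcn) (hpriv u)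
    · exact absurd h1 (hpriv v)
    · exact h1
  have haU : a ∈ U := by
    obtain ⟨T, F', rfl, haT⟩ := not_off.1 ha.not_off
    exact h.mem_U (by simp) haT
  have hroot : ∀ v ∈ U, Cn H v x1 → v = a := by
    intro v hv hvr
    by_contra hva
    exact hpriv v (h.priv_of_cn h2 hm hD (hU v hv).not_off ha.not_off hva (hvr.trans hr.symm))
  have hx : ∀ v ∈ ({a, x1} : Set V), v ≠ x0 := by
    rintro v (rfl | rfl) rfl
    · exact hC.x0U haU
    · exact hC.ne rfl
  refine hD (ht.dm_of_apex hC h2 haU ha.not_off hr ?_ fun v hv _ => hU v hv)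
  rw [cut_eq_zero_iff]
  intro e he hcr
  have heE := Multiset.mem_of_le h.le he
  have key : ∀ u v : V, s(u, v) ∈ H → u ∈ ({a, x1} : Set V) → v ∉ ({a, x1} : Set V) → False := by
    intro u v huv hu hv
    have hvx : Cn H v x1 := by
      rcases hu with rfl | rfl
      · exact (Cn.of_mem huv).symm.trans hr
      · exact (Cn.of_mem huv).symm
    rcases hC.supp _ (Multiset.mem_of_le h.le huv) v (by simp) with hvU | rfl | rfl
    · exact hv (by simp [hroot v hvU hvx])
    · exact ht.ne_of_cn (hx u hu) (Cn.of_mem huv) rfl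
    · exact hv (by simp)
  induction e with | _ u v =>
  rw [crosses_mk] at hcr
  rcases hcr with ⟨hu, hv⟩ | ⟨hv, hu⟩
  · exact key u v he hu hv
  · exact key v u (by rwa [Sym2.eq_swap]) hv hu

/-- A vertex joined to `x1` outside the family lies on two trails, if `D_m` is not immersed only
on one. -/
lemma dm_of_priv (ht : Tight E x0 x1 U m (T ::ₘ F) H) (h : MaxFam E x0 x1 U m (T ::ₘ F) H)
    (hC : Cls E x0 x1 U m) (h2 : 2 ≤ m) (hc : cut E {x0} = m) {a : V} (ha : a ∈ T.2.1)
    (haF : Off F a) (hr : Cn H a x1) : Dm E m x0 x1 U := by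
  by_contra hD
  have hm := h.le_nk
  have haT : ¬ Off (T ::ₘ F) a := not_off.2 ⟨T, F, rfl, ha⟩
  have haU : a ∈ U := h.mem_U (by simp) ha
  have huniq : ∀ v, ¬ Off (T ::ₘ F) v → Cn H v x1 → v ∈ T.2.1 ∧ Off F v := by
    intro v hv hvr
    by_cases hva : v = a
    · subst hva; exact ⟨ha, haF⟩
    obtain ⟨T', F', hF, haT', hvT', -, hvF'⟩ :=
      h.exists_common h2 hm hD haT hv (Ne.symm hva) (hr.trans hvr.symm)
    obtain ⟨rfl, rfl⟩ := Priv.eq_of_off rfl haF hF haT'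
    exact ⟨hvT', hvF'⟩
  have hopen : ∀ S ∈ F, S.1 = x0 := by
    intro S hS
    obtain ⟨F', rfl⟩ := Multiset.exists_cons_of_mem hS
    have hE := ht.ends S (by simp)
    refine hE.2.resolve_right fun hS1 => ?_
    obtain ⟨c, hcS⟩ : ∃ c, c ∈ S.2.1 := by
      refine List.exists_mem_of_ne_nil _ fun hn => ?_
      have := h.toFam.tk_of_nil hC (T := S) (by simp) hn
      rw [tk_closed hE.1 hS1] at this
      omega
    have hac : a ≠ c := by rintro rfl; exact haF S (by simp) hcS
    have hsw : T ::ₘ S ::ₘ F' = S ::ₘ T ::ₘ F' := Multiset.cons_swap _ _ _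
    have hcF : ¬ Off (T ::ₘ F') c := by
      intro hoff
      obtain ⟨u, hu, hu', hru⟩ :=
        (h.toFam.reindex hsw).exists_rooted_of_priv hC h2 (hsw ▸ hm) hD hcS hoff
      have hu0 : u ≠ x0 := by rintro rfl; exact hC.x0U (h.mem_U (T := S) (by simp) hu)
      exact (huniq u (not_off.2 ⟨S, _, hsw, hu⟩) (ht.cn_of_rooted hu0 hru)).2 S (by simp) hu
    exact hD ((ht.reindex hsw).dm_of_closed_rooted hC.ne h2 hS1 hcS hac hcF
      (not_off.2 ⟨T, F', rfl, ha⟩) hr)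
  obtain ⟨L, q, hw, haq, hq, hL, hLT⟩ : ∃ L q, T.2.1 = L ++ (q ++ []) ∧ a ∈ q ∧
      (∀ v ∈ q, Off F v) ∧ (L = [] ∨ ∃ p z, L = p ++ [z] ∧ ¬ Off F z) ∧
      (T.1 = x1 → L = []) := by
    obtain ⟨L, q, S', hw, haq, hq, hL, hS'⟩ := List.exists_block (Off F) ha haF
    have hS : S' = [] := by
      rcases hS' with hS' | ⟨z, s, rfl, hz⟩
      · exact hS'
      exfalso
      have haz : a ≠ z := by rintro rfl; exact hz haF
      have hE := ht.ends T (by simp)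
      rcases hE.2 with hT1 | hT1
      · obtain ⟨t, w, t'⟩ := T
        simp only at hE hT1 hw
        obtain rfl := hT1
        obtain rfl := hE.1
        obtain ⟨q1, q2, rfl⟩ := List.append_of_mem haq
        subst hw
        rw [show L ++ (q1 ++ a :: q2 ++ z :: s) = (L ++ q1) ++ a :: (q2 ++ z :: s) by simp] at ht
        exact hD (ht.dm_of_before hC.ne h2 haz hz hr)
      · exact hD (ht.dm_of_closed h2 hT1 ha (by simp [hw]) haz hz hr)
    subst hS
    refine ⟨L, q, hw, haq, hq, hL, fun hT1 => ?_⟩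
    rcases hL with hL | ⟨p, z, rfl, hz⟩
    · exact hL
    · have haz : a ≠ z := by rintro rfl; exact hz haF
      exact absurd (ht.dm_of_closed h2 hT1 ha (by simp [hw]) haz hz hr) hD
  have hLr : ∀ v ∈ L, ¬ Cn H v x1 := by
    intro v hv hvr
    rcases hL with rfl | ⟨p, z, rfl, hz⟩
    · simp at hv
    have hvT : v ∈ T.2.1 := by
      rw [hw]
      exact List.mem_append_left _ hv
    obtain ⟨-, hvF⟩ := huniq v (not_off.2 ⟨T, F, rfl, hvT⟩) hvr
    have hvz : v ≠ z := by rintro rfl; exact hz hvF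
    have hvp : v ∈ p := by
      rcases List.mem_append.1 hv with hv | hv
      · exact hv
      · exact absurd (List.mem_singleton.1 hv) hvz
    have hE := ht.ends T (by simp)
    have hT1 : T.1 = x0 := hE.2.resolve_right fun hT1 => by simpa using hLT hT1
    obtain ⟨t, w, t'⟩ := T
    simp only at hE hT1 hw
    obtain rfl := hT1
    obtain rfl := hE.1
    obtain ⟨p1, p2, rfl⟩ := List.append_of_mem hvp
    subst hw
    rw [show (p1 ++ v :: p2 ++ [z]) ++ (q ++ []) = p1 ++ v :: (p2 ++ z :: q) by simp] at ht
    exact hD (ht.dm_of_before hC.ne h2 hvz hz hvr)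
  set Z : Set V := {v | Cn H v x1 ∨ ∃ u ∈ q, Cn H u v} with hZ
  have hqU : ∀ u ∈ q, u ∈ U := fun u hu => h.mem_U (T := T) (by simp) (by rw [hw]; simp [hu])
  have hblock := fun u v hu huv =>
    h.toFam.block_avoid h2 hm hD hw hL hq (Or.inl rfl) (u := u) (v := v) hu huv
  have hZF : ∀ v ∈ Z, ¬ Off (T ::ₘ F) v → Off F v := by
    rintro v (hv | ⟨u, hu, huv⟩) hoff
    · exact (huniq v hoff hv).2
    · exact (hblock u v hu huv).1
  have hZL : ∀ v ∈ L, v ∉ Z := by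
    rintro v hvL (hv | ⟨u, hu, huv⟩)
    · exact hLr v hvL hv
    · exact (hblock u v hu huv).2.1 hvL
  have h1Z : x1 ∈ Z := Or.inl (Cn.refl _ _)
  have h0Z : x0 ∉ Z := by
    rintro (hv | ⟨u, hu, huv⟩)
    · exact ht.ne_of_cn hC.ne.symm hv.symm rfl
    · exact ht.ne_of_cn (fun hc => hC.x0U (hc ▸ hqU u hu)) huv rfl
  have hcutZ : cut E Z ≤ m := by
    have hHZ : cut H Z = 0 := by
      rw [cut_eq_zero_iff]
      intro e he hcr
      have key : ∀ u v : V, s(u, v) ∈ H → u ∈ Z → v ∈ Z := by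
        rintro u v huv (hu | ⟨z, hz, hu⟩)
        · exact Or.inl ((Cn.of_mem huv).symm.trans hu)
        · exact Or.inr ⟨z, hz, hu.trans (Cn.of_mem huv)⟩
      induction e with | _ u v =>
      rw [crosses_mk] at hcr
      rcases hcr with ⟨hu, hv⟩ | ⟨hv, hu⟩
      · exact hv (key u v he hu)
      · exact hu (key v u (by rwa [Sym2.eq_swap]) hv)
    rw [← ht.sum, cut_add, hHZ, add_zero]
    refine le_trans (cut_sum_le_nk fun S hS => ?_) ht.nk_eq.le
    have hE := ht.ends S hS
    rcases Multiset.mem_cons.1 hS with rfl | hSF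
    · rw [te, hw, List.append_nil, hE.1]
      have hqZ : ∀ v ∈ q, v ∈ Z := fun v hv => Or.inr ⟨v, hv, Cn.refl _ _⟩
      rcases hE.2 with hS1 | hS1
      · rw [tk_link hC.ne hE.1 hS1, hS1]
        exact cut_seg_le_of_enter h0Z hZL hqZ h1Z
      · rw [tk_closed hE.1 hS1, hS1, hLT hS1, Nat.le_zero]
        refine cut_walkEdges_of_subset fun v hv => ?_
        simp only [List.nil_append, List.mem_cons, List.mem_append, List.not_mem_nil,
          or_false] at hv
        rcases hv with rfl | hv | rfl
        exacts [h1Z, hqZ v hv, h1Z]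
    · have hS1 := hopen S hSF
      rw [tk_link hC.ne hE.1 hS1, te, hS1, hE.1, ← List.append_nil S.2.1]
      refine cut_seg_le_of_enter h0Z (fun v hv hvZ => ?_) (by simp) h1Z
      exact hZF v hvZ (fun hoff => hoff S hS hv) S hSF hv
  have hUZ : ∀ v ∈ U, v ∈ Z := by
    by_contra! hcon
    obtain ⟨v, hvU, hvZ⟩ := hcon
    have := hC.si (U \ Z) ⟨v, hvU, hvZ⟩ Set.sdiff_subset fun hc => by
      have : a ∈ U \ Z := hc.symm ▸ haU
      exact this.2 (Or.inl hr)
    rw [← hC.cut_insert_diff h0Z h1Z] at this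
    omega
  have hFU : ∀ S ∈ F, S.2.1 = [] := by
    intro S hS
    rw [List.eq_nil_iff_forall_not_mem]
    intro v hv
    exact hZF v (hUZ v (h.mem_U (T := S) (by simp [hS]) hv))
      (fun hoff => hoff S (by simp [hS]) hv) S hS hv
  have hon : ∀ v, ¬ Off (T ::ₘ F) v → v ∈ T.2.1 := by
    intro v hv
    by_contra hcon
    refine hv (off_cons.2 ⟨hcon, fun S hS => ?_⟩)
    rw [hFU S hS]
    simp
  have htwo : ∃ u v, u ≠ v ∧ u ∈ T.2.1 ∧ v ∈ T.2.1 := by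
    obtain ⟨c, hcU, hca⟩ := hC.nontrivial.exists_ne a
    by_cases hc : Off (T ::ₘ F) c
    · obtain ⟨u, -, u', -, hne, hu, hu', -⟩ := h.exists_of_off hC hcU hc
      exact ⟨u, u', hne, hon u hu, hon u' hu'⟩
    · exact ⟨c, a, hca, hon c hc, ha⟩
  have hsum := h.sum
  rw [Multiset.map_cons, Multiset.sum_cons,
    h.sum_of_nil hC (Multiset.le_cons_self _ _) hFU] at hsum
  have hcard : nk F = F.card := by
    rw [nk, Multiset.map_congr rfl fun S hS => h.toFam.tk_of_nil hC (T := S) (by simp [hS])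
      (hFU S hS)]
    simp
  have hnk := ht.nk_eq
  rw [nk_cons, hcard] at hnk
  obtain ⟨u, v, huv, hu, hv⟩ := htwo
  rcases hwT : T.2.1 with _ | ⟨v1, _ | ⟨v2, w⟩⟩
  · simp [hwT] at hu
  · simp only [hwT, List.mem_singleton] at hu hv; exact huv (hu.trans hv.symm)
  · have hv1 := h.mem_U (T := T) (by simp) (y := v1) (by simp [hwT])
    have hv2 := h.mem_U (T := T) (by simp) (y := v2) (by simp [hwT])
    have hv12 := h.toFam.ne_of_edge hC (T := T) (by simp) (u := v1) (v := v2)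
      (by rw [te, hwT, seg_cons, seg_cons]; simp)
    have hE := ht.ends T (by simp)
    rcases hE.2 with hT1 | hT1
    · rw [tk_link hC.ne hE.1 hT1] at hnk
      refine hD (hC.dm_of_direct_path h2 hc hv1 hv2 hv12 ?_)
      rw [← hsum, te, hwT, hT1, seg_cons, seg_cons, show m - 1 = F.card by omega,
        Multiset.insert_eq_cons, ← Multiset.singleton_add, ← Multiset.singleton_add,
        ← Multiset.singleton_add]
      refine Multiset.le_iff_exists_add.2 ⟨seg v2 w T.2.2 + H, ?_⟩
      abel
    · rw [tk_closed hE.1 hT1] at hnk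
      refine hD (hC.dm_of_direct h2 hv1 hv2 hv12 ?_)
      rw [← hsum, te, hwT, hT1, seg_cons, seg_cons, show m = F.card by omega,
        ← Multiset.singleton_add, ← Multiset.singleton_add]
      refine Multiset.le_iff_exists_add.2 ⟨{s(x1, v1)} + seg v2 w T.2.2 + H, ?_⟩
      abel

end Tight

end

section

variable {E : Multiset (Sym2 V)} {m k : ℕ} {x0 x1 : V} {U : Set V} {F K F' : Multiset (Trl V)}
  {H : Multiset (Sym2 V)} {T T' S : Trl V} {X : Set V}

lemma not_rooted_zero {v : V} (h0 : v ≠ x0) (h1 : v ≠ x1) : ¬ Rooted 0 x0 x1 v := by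
  rintro ⟨r, hr, hc⟩
  have hvr : r ≠ v := by rintro rfl; tauto
  have := hc.cut_pos (X := {v}) rfl (by simpa using hvr)
  rw [cut_zero] at this
  omega

namespace Tight

/-- A family with all vertices multiple and nothing outside contains no closed trail. -/
lemma dm_of_closed_multi (h : Tight E x0 x1 U m (S ::ₘ F) 0) (hC : Cls E x0 x1 U m)
    (h2 : 2 ≤ m) (hall : ∀ v ∈ U, Multi (S ::ₘ F) v) (hS1 : S.1 = x1) : Dm E m x0 x1 U := by
  by_contra hD
  have hE := h.ends S (by simp)
  have hS0 := tk_closed hE.1 hS1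
  have hnk := h.nk_eq
  rw [nk_cons, hS0, zero_add] at hnk
  have hSF : ∀ v ∈ S.2.1, ¬ Off F v := fun v hv =>
    (hall v (h.mem_U (by simp) hv)).not_off_of_cons
  obtain ⟨a, haS⟩ : ∃ a, a ∈ S.2.1 := by
    refine List.exists_mem_of_ne_nil _ fun hn => ?_
    have := h.toFam.tk_of_nil hC (T := S) (by simp) hn
    omega
  have haU := h.mem_U (by simp) haS
  have hone : ∀ c ∈ S.2.1, c = a := by
    intro c hcS
    by_contra hca
    obtain ⟨T, F', rfl, hcT, haT, -, -⟩ := h.drop.exists_common h2 hnk.ge hD (hSF c hcS)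
      (hSF a haS) hca ((seg_cn (Or.inr (Or.inl hcS)) (Or.inr (Or.inl haS))).right _)
    have hT := tk_le_one T
    rw [nk_cons] at hnk
    refine hD (h.dm_of_share' h2 hcS haS hcT haT hca ?_)
    by_cases hT0 : tk T = 0
    · left; omega
    · right; omega
  have hcut : ∀ X : Set V, (∀ v ∈ S.2.1, v ∈ X) → x1 ∈ X → cut (te S) X = 0 := by
    intro X hX h1X
    refine cut_walkEdges_of_subset fun v hv => ?_
    rw [List.mem_cons, List.mem_append, List.mem_singleton, hS1, hE.1] at hv
    rcases hv with rfl | hv | rfl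
    exacts [h1X, hX v hv, h1X]
  have ht : Tight E x0 x1 U m F (0 + te S) := by
    refine ⟨h.drop, fun T hT => h.ends T (by simp [hT]), hnk, ?_⟩
    rw [zero_add, ← cut_compl]
    refine hcut _ (fun v hv => ?_) ?_
    · rintro rfl
      exact hC.x0U (h.mem_U (T := S) (by simp) hv)
    · exact hC.ne.symm
  refine hD (ht.dm_of_apex hC h2 haU (hSF a haS) ?_ ?_ fun v hv hva =>
    (hall v hv).of_cons fun hc => hva (hone v hc))
  · have := seg_cn (a := S.1) (p := S.2.1) (b := S.2.2) (Or.inr (Or.inl haS)) (Or.inr (Or.inr rfl))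
    rw [hE.1] at this
    rw [zero_add, te, hE.1]
    exact this
  · rw [zero_add]
    exact hcut _ (fun v hv => by simp [hone v hv]) (by simp)

end Tight

/-- The families of exactly `m` links from `x0` to `x1` using all edges. -/
structure Full (E : Multiset (Sym2 V)) (x0 x1 : V) (U : Set V) (m : ℕ)
    (F : Multiset (Trl V)) : Prop extends Fam E x0 x1 U F 0 where
  ends : ∀ T ∈ F, T.1 = x0 ∧ T.2.2 = x1
  card : F.card = m

namespace Full

lemma nk_eq (h : Full E x0 x1 U m F) (hne : x0 ≠ x1) : nk F = m := by
  rw [nk, Multiset.map_congr rfl fun S hS =>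
    Tight.tk_link hne (h.ends S hS).2 (h.ends S hS).1]
  simp [h.card]

lemma length_le (h : Full E x0 x1 U m F) (hT : T ∈ F) : T.2.1.length ≤ E.card := by
  have h1 := Multiset.card_le_card (h.te_le hT)
  have h3 : ∀ (a : V) (w : List V) (b : V), w.length ≤ (seg a w b).card := by
    intro a w b
    induction w generalizing a with
    | nil => simp
    | cons c w ih => rw [seg_cons, Multiset.card_cons, List.length_cons]; exact Nat.succ_le_succ (ih c)
  exact (h3 _ _ _).trans h1

lemma exists_longest (h : Full E x0 x1 U m F) (hT : T ∈ F) :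
    ∃ F T, Full E x0 x1 U m F ∧ T ∈ F ∧
      ∀ F' T', Full E x0 x1 U m F' → T' ∈ F' → T'.2.1.length ≤ T.2.1.length := by
  have hex : ∃ n F T, Full E x0 x1 U m F ∧ T ∈ F ∧ E.card - T.2.1.length = n :=
    ⟨_, F, T, h, hT, rfl⟩
  obtain ⟨F', T', h1, h2, h3⟩ := Nat.find_spec hex
  refine ⟨F', T', h1, h2, fun F'' T'' h1' h2' => ?_⟩
  have h4 := Nat.find_min' hex ⟨F'', T'', h1', h2', rfl⟩
  rw [← h3] at h4
  have := h1.length_le h2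
  have := h1'.length_le h2'
  omega

lemma multi (h : Full E x0 x1 U m F) (hC : Cls E x0 x1 U m) (h2 : 2 ≤ m)
    (hD : ¬ Dm E m x0 x1 U) : (∀ v ∈ U, Multi F v) ∧ ∀ T ∈ F, T.2.1.Nodup := by
  have hmax : MaxFam E x0 x1 U m F 0 := ⟨h.toFam, (h.nk_eq hC.ne).ge, by simp⟩
  have hall := (hmax.all_multi hC h2 le_rfl hD fun v hv => by
    obtain ⟨T, F', rfl, hvT⟩ := not_off.1 hv
    have hvU := h.mem_U (by simp) hvT
    exact not_rooted_zero (fun hc => hC.x0U (hc ▸ hvU)) fun hc => hC.x1U (hc ▸ hvU)).1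
  exact ⟨hall, fun T hT => h.nodup_of_multi hC h2 (h.nk_eq hC.ne).ge hD hall hT⟩

lemma dm (h : Full E x0 x1 U m F) (hC : Cls E x0 x1 U m) (h2 : 2 ≤ m) : Dm E m x0 x1 U := by
  by_contra hD
  obtain ⟨T, hT⟩ : ∃ T, T ∈ F := Multiset.card_pos_iff_exists_mem.1 (by rw [h.card]; omega)
  obtain ⟨F, T, h, hT, hmax⟩ := h.exists_longest hT
  obtain ⟨hall, hnd⟩ := h.multi hC h2 hD
  obtain ⟨t, w, t'⟩ := T
  have hE := h.ends _ hT
  simp only at hE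
  obtain ⟨rfl, rfl⟩ := hE
  cases w with
  | nil =>
    obtain ⟨u, hu⟩ := hC.nontrivial.nonempty
    obtain ⟨S, F', rfl, huS⟩ := not_off.1 (hall u hu).not_off
    have := hmax _ S h (by simp)
    rw [List.length_nil, Nat.le_zero, List.length_eq_zero_iff] at this
    simp [this] at huS
  | cons v w =>
    obtain ⟨G, rfl⟩ := Multiset.exists_cons_of_mem hT
    have hvU : v ∈ U := h.mem_U hT (by simp)
    have hv0 : v ≠ t := by rintro rfl; exact hC.x0U hvU
    have h1X : t' ∉ ({t, v} : Set V) := by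
      simp only [Set.mem_insert_iff, Set.mem_singleton_iff, not_or]
      exact ⟨hC.ne.symm, fun hc => hC.x1U (hc ▸ hvU)⟩
    have hlow := hC.si {v} ⟨v, rfl⟩ (by simpa using hvU) (by
      rintro rfl
      exact Set.not_nontrivial_singleton hC.nontrivial)
    have hup : cut E {t, v} ≤ m := by
      rw [← h.sum, add_zero, ← h.nk_eq hC.ne]
      refine cut_sum_le_nk fun S hS => ?_
      have hSE := h.ends S hS
      rw [Tight.tk_link hC.ne hSE.2 hSE.1]
      have hSU : ∀ z ∈ S.2.1, z ≠ t := by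
        rintro z hz rfl
        exact hC.x0U (h.mem_U hS hz)
      have hfirst : v ∉ S.2.1 ∨ ∃ s, S.2.1 = v :: s ∧ v ∉ s := by
        rw [or_iff_not_imp_left, not_not]
        intro hvS
        obtain ⟨p, s, hps, -⟩ := List.eq_append_cons_of_mem hvS
        have hp : p = [] := by
          rcases Multiset.mem_cons.1 hS with rfl | hSG
          · have hnd' := hnd _ hS
            simp only at hps
            cases p with
            | nil => rfl
            | cons z p =>
              rw [List.cons_append, List.cons.injEq] at hps
              rw [List.nodup_cons, hps.2] at hnd'
              exact absurd (by simp) hnd'.1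
          · obtain ⟨K, rfl⟩ := Multiset.exists_cons_of_mem hSG
            obtain ⟨c, u, d⟩ := S
            simp only at hps hSE
            obtain ⟨rfl, rfl⟩ := hSE
            subst hps
            have hnew : Full E c d U m ((c, p ++ v :: w, d) ::ₘ (c, v :: s, d) ::ₘ K) := by
              refine ⟨⟨?_, ?_⟩, ?_, ?_⟩
              · intro R hR
                rcases Multiset.mem_cons.1 hR with rfl | hR
                · refine ⟨Or.inl rfl, Or.inr rfl, fun z hz => ?_⟩
                  rcases List.mem_append.1 hz with hz | hz
                  · exact (h.ok _ hS).2.2 z (List.mem_append_left _ hz)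
                  · exact (h.ok _ hT).2.2 z hz
                rcases Multiset.mem_cons.1 hR with rfl | hR
                · exact ⟨Or.inl rfl, Or.inr rfl, fun z hz =>
                    (h.ok _ hS).2.2 z (List.mem_append_right _ hz)⟩
                · exact h.ok R (by simp [hR])
              · rw [← h.sum]
                simp only [Multiset.map_cons, Multiset.sum_cons, te, seg_append, seg_cons]
                rw [← Multiset.singleton_add, ← Multiset.singleton_add]
                abel
              · intro R hR
                rcases Multiset.mem_cons.1 hR with rfl | hR
                · exact ⟨rfl, rfl⟩
                rcases Multiset.mem_cons.1 hR with rfl | hR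
                · exact ⟨rfl, rfl⟩
                · exact h.ends R (by simp [hR])
              · rw [← h.card]; simp
            have := hmax _ (c, p ++ v :: w, d) hnew (by simp)
            rw [← List.length_eq_zero_iff]
            simp at this
            simpa using this
        subst hp
        refine ⟨s, hps, ?_⟩
        have := hnd _ hS
        rw [hps, List.nil_append, List.nodup_cons] at this
        exact this.1
      rw [te, hSE.1, hSE.2]
      rcases hfirst with hvS | ⟨s, hs, hvs⟩
      · rw [← List.nil_append S.2.1]
        refine cut_seg_le_of_leave (by simp) (by simp) (fun z hz => ?_) h1X
        simp only [Set.mem_insert_iff, Set.mem_singleton_iff, not_or]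
        exact ⟨hSU z hz, fun hc => hvS (hc ▸ hz)⟩
      · rw [hs, ← List.singleton_append]
        refine cut_seg_le_of_leave (by simp) (by simp) (fun z hz => ?_) h1X
        simp only [Set.mem_insert_iff, Set.mem_singleton_iff, not_or]
        exact ⟨hSU z (by simp [hs, hz]), fun hc => hvs (hc ▸ hz)⟩
    omega

end Full

namespace Cls

/-- A root of degree exactly `m` forces `D_m`. -/
lemma dm_of_tight (hC : Cls E x0 x1 U m) (h2 : 2 ≤ m) (hc : cut E {x0} = m) :
    Dm E m x0 x1 U := by
  obtain ⟨F, H, hF, hk⟩ := hC.exists_fam (k := m) fun X h0 h1 => hC.le_cut h0 h1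
  obtain ⟨F, H, hF⟩ := hF.exists_max hk.ge
  obtain ⟨F, h, -, hor⟩ := hF.exists_oriented
  have ht := h.tight hC hc hor
  by_contra hD
  have hr : ∀ v, ¬ Off F v → ¬ Rooted H x0 x1 v := by
    intro v hv hvr
    obtain ⟨T, F', rfl, hvT⟩ := not_off.1 hv
    have hvU := h.mem_U (by simp) hvT
    have hcn := ht.cn_of_rooted (fun hc => hC.x0U (hc ▸ hvU)) hvr
    by_cases hvF : Off F' v
    · exact hD (ht.dm_of_priv h hC h2 hc hvT hvF hcn)
    · exact hD (ht.dm_of_multi h hC h2 (multi_of_not_off hvT hvF) hcn)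
  obtain ⟨hall, rfl⟩ := h.all_multi hC h2 le_rfl hD hr
  by_cases hcl : ∃ S ∈ F, S.1 = x1
  · obtain ⟨S, hS, hS1⟩ := hcl
    obtain ⟨F', rfl⟩ := Multiset.exists_cons_of_mem hS
    exact hD (ht.dm_of_closed_multi hC h2 hall hS1)
  · push Not at hcl
    have hends : ∀ T ∈ F, T.1 = x0 ∧ T.2.2 = x1 := fun T hT =>
      ⟨(ht.ends T hT).2.resolve_right (hcl T hT), (ht.ends T hT).1⟩
    have hcard : F.card = m := by
      rw [← ht.nk_eq, nk, Multiset.map_congr rfl fun S hS =>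
        Tight.tk_link hC.ne (hends S hS).2 (hends S hS).1]
      simp
    exact hD (Full.dm ⟨ht.toFam, hends, hcard⟩ hC h2)

theorem exists_bundle (hC : Cls E x0 x1 U m) (h2 : 2 ≤ m) (hD : ¬ Dm E m x0 x1 U) :
    ∃ F, Bundle E x0 x1 U m F := by
  have h0 : m + 1 ≤ cut E {x0} := by
    have h1 := hC.s ∅ (Set.empty_subset _)
    rw [LawfulSingleton.insert_empty_eq] at h1
    by_contra hcon
    exact hD (hC.dm_of_tight h2 (by omega))
  have h1 : m + 1 ≤ cut E {x1} := by
    have h1 := hC.swap.s ∅ (Set.empty_subset _)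
    rw [LawfulSingleton.insert_empty_eq] at h1
    by_contra hcon
    exact hD (hC.swap.dm_of_tight h2 (by omega)).swap
  obtain ⟨F, H, hF, hk⟩ := hC.exists_fam (k := m + 1) fun X h0X h1X => by
    rw [hC.cut_insert_inter h0X h1X]
    rcases Set.eq_empty_or_nonempty (X ∩ U) with hX | hX
    · rwa [hX, LawfulSingleton.insert_empty_eq]
    by_cases hXU : X ∩ U = U
    · have := hC.cut_insert_diff (X := {x1}) (by simpa using hC.ne) rfl
      rw [hXU, ← Set.sdiff_singleton_eq_self hC.x1U, ← this]
      exact h1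
    · exact hC.si _ hX Set.inter_subset_right hXU
  obtain ⟨F, H, hF⟩ := hF.exists_max hk.ge
  obtain ⟨F, h, -, hor⟩ := hF.exists_oriented
  exact ⟨F, h.bundle hC h2 hD hor⟩

end Cls

end

/-- The vertex map identifying `A` with the vertex `x`. -/
def collapse (A : Set V) (x : V) (v : V) : V := if v ∈ A then x else v

lemma collapse_of_mem {A : Set V} {x v : V} (h : v ∈ A) : collapse A x v = x := if_pos h

lemma collapse_of_notMem {A : Set V} {x v : V} (h : v ∉ A) : collapse A x v = v := if_neg h

/-- The edges left after identifying `A` with the vertex `x`. -/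
def contract (A : Set V) (x : V) (E : Multiset (Sym2 V)) : Multiset (Sym2 V) :=
  (E.map (Sym2.map (collapse A x))).filter fun e => ¬ e.IsDiag

lemma contract_add (A : Set V) (x : V) (E E' : Multiset (Sym2 V)) :
    contract A x (E + E') = contract A x E + contract A x E' := by
  simp [contract]

lemma contract_loopless {A : Set V} {x : V} {E : Multiset (Sym2 V)} :
    ∀ e ∈ contract A x E, ¬ e.IsDiag := fun _ he => (Multiset.mem_filter.1 he).2

lemma cut_contract (A : Set V) (x : V) (E : Multiset (Sym2 V)) (X : Set V) :
    cut (contract A x E) X = cut E (collapse A x ⁻¹' X) := by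
  induction E using Multiset.induction with
  | empty => simp [contract]
  | cons e E ih =>
    rw [← Multiset.singleton_add, contract_add, cut_add, cut_add, ih]
    congr 1
    induction e with | _ u v =>
    rw [← Multiset.cons_zero, cut_cons, crosses_mk]
    by_cases h : collapse A x u = collapse A x v
    · simp [contract, h, Multiset.filter_singleton]
    · rw [contract, Multiset.map_cons, Multiset.map_zero, Sym2.map_mk,
        Multiset.filter_cons_of_pos _ (by simpa using h), Multiset.filter_zero, cut_cons,
        crosses_mk]
      simp

lemma exists_crossing_decomp (A : Set V) (E : Multiset (Sym2 V)) :
    ∃ (Ei : Multiset (Sym2 V)) (K : Multiset (V × V)) (Eo : Multiset (Sym2 V)),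
      E = Ei + K.map (fun p => s(p.1, p.2)) + Eo ∧ (∀ e ∈ Ei, ∀ v ∈ e, v ∈ A) ∧
      (∀ p ∈ K, p.1 ∈ A ∧ p.2 ∉ A) ∧ ∀ e ∈ Eo, ∀ v ∈ e, v ∉ A := by
  induction E using Multiset.induction with
  | empty => exact ⟨0, 0, 0, by simp⟩
  | cons e E ih =>
    obtain ⟨Ei, K, Eo, rfl, h1, h2, h3⟩ := ih
    induction e with | _ u v =>
    have key : ∀ u v, u ∈ A → v ∉ A → ∃ (Ei' : Multiset (Sym2 V)) (K' : Multiset (V × V))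
        (Eo' : Multiset (Sym2 V)),
      s(u, v) ::ₘ (Ei + K.map (fun p => s(p.1, p.2)) + Eo) =
        Ei' + K'.map (fun p => s(p.1, p.2)) + Eo' ∧ (∀ e ∈ Ei', ∀ v ∈ e, v ∈ A) ∧
      (∀ p ∈ K', p.1 ∈ A ∧ p.2 ∉ A) ∧ ∀ e ∈ Eo', ∀ v ∈ e, v ∉ A := fun u v hu hv =>
      ⟨Ei, (u, v) ::ₘ K, Eo, by simp, h1, by simpa [hu, hv] using h2, h3⟩
    by_cases hu : u ∈ A <;> by_cases hv : v ∈ A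
    · exact ⟨s(u, v) ::ₘ Ei, K, Eo, by simp, by simpa [hu, hv] using h1, h2, h3⟩
    · exact key u v hu hv
    · rw [Sym2.eq_swap]; exact key v u hv hu
    · exact ⟨Ei, K, s(u, v) ::ₘ Eo, by simp, h1, h2, by simpa [hu, hv] using h3⟩

lemma Pack.of_route {D : List (V × V)} {Ei Eo : Multiset (Sym2 V)} {K : Multiset (V × V)} {x : V}
    (hR : Route {x} (K.map Prod.fst) Ei) (h : Pack D (K.map (fun p => s(x, p.2)) + Eo)) :
    Pack D (Ei + K.map (fun p => s(p.1, p.2)) + Eo) := by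
  induction K using Multiset.induction generalizing Ei Eo with
  | empty => exact h.mono (by simp)
  | cons p K ih =>
    rw [Multiset.map_cons] at hR
    obtain ⟨A, B, r, rfl, rfl, hA, hR⟩ := hR.cons
    rw [Multiset.map_cons, Multiset.cons_add] at h
    have h' := h.subst (C := A + {s(p.1, p.2)}) (hA.symm.trans_add (Cn.of_mem (by simp)))
    rw [add_assoc] at h'
    refine (ih hR h').mono (le_of_eq ?_)
    rw [Multiset.map_cons, ← Multiset.singleton_add]
    abel

lemma cut_eq_of_forall_mem {E : Multiset (Sym2 V)} {A : Set V} (h : ∀ e ∈ E, ∀ v ∈ e, v ∈ A)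
    (X : Set V) : cut E (A \ X) = cut E X := by
  rw [← cut_compl E X]
  exact cut_congr fun e he => crosses_congr fun v hv => ⟨fun hX => hX.2, fun hX => ⟨h e he v hv, hX⟩⟩

lemma cut_eq_zero_of_forall_notMem {E : Multiset (Sym2 V)} {A X : Set V}
    (h : ∀ e ∈ E, ∀ v ∈ e, v ∉ A) (hX : X ⊆ A) : cut E X = 0 := by
  rw [cut_eq_zero_iff]
  rintro e he ⟨u, v, rfl, hu, -⟩
  exact h _ he u (by simp) (hX hu)

/-- Edge-disjoint walks survive un-contracting `A` to `x` when `A` is a minimum cut around `x`. -/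
lemma Pack.of_contract {D : List (V × V)} {E : Multiset (Sym2 V)} {A : Set V} {x : V} (hx : x ∈ A)
    (hE : ∀ e ∈ E, ¬ e.IsDiag) (hA : ∀ S ⊆ A, x ∉ S → cut E A ≤ cut E (A \ S))
    (h : Pack D (contract A x E)) : Pack D E := by
  obtain ⟨Ei, K, Eo, rfl, hi, hK, ho⟩ := exists_crossing_decomp A E
  refine Pack.of_route (x := x) (route_of_cut _ _ _ fun X hX => ?_) (h.mono (le_of_eq ?_))
  · have hXx : x ∉ X := by simpa using hX
    have h1 := hA (A ∩ X) Set.inter_subset_left (fun hc => hXx hc.2)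
    rw [Set.sdiff_self_inter] at h1
    simp only [cut_add] at h1
    rw [cut_eq_of_forall_mem hi, cut_eq_zero_of_forall_notMem ho le_rfl,
      cut_eq_zero_of_forall_notMem ho Set.sdiff_subset] at h1
    have h2 : ∀ K : Multiset (V × V), (∀ p ∈ K, p.1 ∈ A ∧ p.2 ∉ A) →
        cut (K.map fun p => s(p.1, p.2)) (A \ X) + tok (K.map Prod.fst) X =
          cut (K.map fun p => s(p.1, p.2)) A := by
      intro K hK
      induction K using Multiset.induction with
      | empty => simp
      | cons p K ih =>
        simp only [Multiset.map_cons, cut_cons, tok_cons, crosses_mk]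
        have hp := hK p (by simp)
        have := ih fun q hq => hK q (by simp [hq])
        by_cases hpX : p.1 ∈ X <;> simp [hp.1, hp.2, hpX] <;> omega
    have := h2 K hK
    omega
  · rw [contract_add, contract_add]
    have h1 : contract A x Ei = 0 := by
      rw [contract, Multiset.filter_eq_nil]
      simp only [Multiset.mem_map, not_not]
      rintro _ ⟨e, he, rfl⟩
      have := hi e he
      induction e with | _ u v =>
      simp [collapse_of_mem (this u (by simp)), collapse_of_mem (this v (by simp))]
    have h2 : contract A x (K.map fun p => s(p.1, p.2)) = K.map fun p => s(x, p.2) := by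
      rw [contract, Multiset.map_map, Multiset.map_congr (g := fun p => s(x, p.2)) rfl]
      · rw [Multiset.filter_eq_self]
        simp only [Multiset.mem_map]
        rintro _ ⟨p, hp, rfl⟩
        simp only [Sym2.mk_isDiag_iff]
        rintro hc
        exact (hK p hp).2 (hc ▸ hx)
      · intro p hp
        simp [collapse_of_mem (hK p hp).1, collapse_of_notMem (hK p hp).2]
    have h3 : contract A x Eo = Eo := by
      rw [contract, Multiset.map_congr (g := id) rfl, Multiset.map_id, Multiset.filter_eq_self]
      · exact fun e he => hE e (by simp [he])
      · intro e he
        have := ho e he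
        induction e with | _ u v =>
        simp [collapse_of_notMem (this u (by simp)), collapse_of_notMem (this v (by simp))]
    rw [h1, h2, h3, zero_add]

namespace Conn

variable {E : Multiset (Sym2 V)} {m : ℕ} {x0 x1 : V} {U : Set V}

/-- Between two tight cuts differing in at least two vertices there is another tight cut. -/
lemma exists_between (hC : Conn E x0 x1 U m) (h2 : 2 ≤ m) (hD : ¬ Dm E m x0 x1 U) {S T : Set V}
    (hST : S ⊆ T) (hTU : T ⊆ U) (hS : cut E (insert x0 S) = m)
    (hT : cut E (insert x0 T) = m ∨ T = U) (hnt : (T \ S).Nontrivial) :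
    ∃ R, S ⊆ R ∧ R ⊆ T ∧ R ≠ S ∧ R ≠ T ∧ cut E (insert x0 R) = m := by
  by_contra hno
  push Not at hno
  set A : Set V := insert x0 S with hA
  set B : Set V := insert x1 (U \ T) with hB
  have hSU := hST.trans hTU
  have h0B : x0 ∉ B := by
    rintro (h | h)
    · exact hC.ne h
    · exact hC.x0U h.1
  have hAB : ∀ v ∈ A, v ∉ B := by
    rintro v (rfl | hv)
    · exact h0B
    · rintro (rfl | h)
      · exact hC.x1U (hSU hv)
      · exact h.2 (hST hv)
  set E1 := contract A x0 E with hE1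
  set E2 := contract B x1 E1 with hE2
  have hcol : ∀ v, (v ∈ A ∧ collapse B x1 (collapse A x0 v) = x0) ∨
      (v ∈ B ∧ collapse B x1 (collapse A x0 v) = x1) ∨
      (v ∉ A ∧ v ∉ B ∧ collapse B x1 (collapse A x0 v) = v) := by
    intro v
    by_cases hvA : v ∈ A
    · exact Or.inl ⟨hvA, by rw [collapse_of_mem hvA, collapse_of_notMem h0B]⟩
    · rw [collapse_of_notMem hvA]
      by_cases hvB : v ∈ B
      · exact Or.inr (Or.inl ⟨hvB, collapse_of_mem hvB⟩)
      · exact Or.inr (Or.inr ⟨hvA, hvB, collapse_of_notMem hvB⟩)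
  have hcut : ∀ X ⊆ T \ S, cut E2 X = cut E X := by
    intro X hX
    rw [hE2, cut_contract, hE1, cut_contract]
    congr 1
    ext v
    have h0X : x0 ∉ X := fun h => hC.x0U (hTU (hX h).1)
    have h1X : x1 ∉ X := fun h => hC.x1U (hTU (hX h).1)
    simp only [Set.mem_preimage]
    rcases hcol v with ⟨hv, h⟩ | ⟨hv, h⟩ | ⟨-, -, h⟩ <;> rw [h]
    · refine iff_of_false h0X fun hvX => ?_
      rcases hv with rfl | hv
      · exact h0X hvX
      · exact (hX hvX).2 hv
    · refine iff_of_false h1X fun hvX => ?_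
      rcases hv with rfl | hv
      · exact h1X hvX
      · exact hv.2 (hX hvX).1
  have hcut0 : ∀ X ⊆ T \ S, cut E2 (insert x0 X) = cut E (insert x0 (S ∪ X)) := by
    intro X hX
    rw [hE2, cut_contract, hE1, cut_contract]
    congr 1
    ext v
    have h1X : x1 ∉ insert x0 (S ∪ X) := by
      rintro (h | h | h)
      · exact hC.ne h.symm
      · exact hC.x1U (hSU h)
      · exact hC.x1U (hTU (hX h).1)
    simp only [Set.mem_preimage]
    rcases hcol v with ⟨hv, h⟩ | ⟨hv, h⟩ | ⟨hv, -, h⟩ <;> rw [h]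
    · refine iff_of_true (Or.inl rfl) ?_
      rcases hv with rfl | hv
      · exact Or.inl rfl
      · exact Or.inr (Or.inl hv)
    · refine iff_of_false (fun hc => h1X ?_) fun hc => ?_
      · exact hc.imp id Or.inr
      · rcases hv with rfl | hv
        · exact h1X hc
        · rcases hc with rfl | hc | hc
          · exact hC.x0U hv.1
          · exact hv.2 (hST hc)
          · exact hv.2 (hX hc).1
    · simp only [hA, Set.mem_insert_iff, Set.mem_union] at hv ⊢
      tauto
  have hCls : Cls E2 x0 x1 (T \ S) m := by
    refine ⟨⟨hC.ne, fun h => hC.x0U (hTU h.1), fun h => hC.x1U (hTU h.1), ?_, contract_loopless,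
      fun X hX hXU => ?_, fun X hX hXU => ?_, fun X hXU => ?_⟩, hnt, fun X hX hXU hne => ?_⟩
    · intro e he v hv
      obtain ⟨e1, he1, rfl⟩ := Multiset.mem_map.1 (Multiset.mem_filter.1 he).1
      obtain ⟨e0, he0, rfl⟩ := Multiset.mem_map.1 (Multiset.mem_filter.1 he1).1
      rw [Sym2.mem_map] at hv
      obtain ⟨w, hw, rfl⟩ := hv
      rw [Sym2.mem_map] at hw
      obtain ⟨u, hu, rfl⟩ := hw
      rcases hcol u with ⟨-, h⟩ | ⟨-, h⟩ | ⟨hA', hB', h⟩ <;> rw [h]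
      · exact Or.inr (Or.inl rfl)
      · exact Or.inr (Or.inr rfl)
      · have := hC.supp e0 he0 u hu
        simp only [hA, hB, Set.mem_insert_iff, Set.mem_sdiff] at hA' hB' ⊢
        tauto
    · rw [hcut X hXU]
      exact hC.n3 X hX (hXU.trans (Set.sdiff_subset.trans hTU))
    · rw [hcut X hXU]
      exact hC.n4 X hX (hXU.trans (Set.sdiff_subset.trans hTU))
    · rw [hcut0 X hXU]
      exact hC.s _ (Set.union_subset hSU (hXU.trans (Set.sdiff_subset.trans hTU)))
    · rw [hcut0 X hXU]
      have h1 := hC.s (S ∪ X) (Set.union_subset hSU (hXU.trans (Set.sdiff_subset.trans hTU)))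
      refine lt_of_le_of_ne h1 (hno _ Set.subset_union_left
        (Set.union_subset hST (hXU.trans Set.sdiff_subset)) ?_ ?_).symm
      · obtain ⟨v, hv⟩ := hX
        intro hc
        exact (hXU hv).2 (hc ▸ Or.inr hv)
      · intro hc
        refine hne (subset_antisymm hXU fun v hv => ?_)
        exact (hc ▸ hv.1 : v ∈ S ∪ X).resolve_left hv.2
  have htight : cut E2 {x0} = m := by
    have := hcut0 ∅ (Set.empty_subset _)
    rwa [Set.union_empty, ← hA, hS, LawfulSingleton.insert_empty_eq] at this
  obtain ⟨y0, hy0, y1, hy1, hy, hP⟩ := hCls.dm_of_tight h2 htight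
  refine hD ⟨y0, hTU hy0.1, y1, hTU hy1.1, hy, ?_⟩
  have hcutB : ∀ Y ⊆ B, cut E1 Y = cut E Y := by
    intro Y hY
    rw [hE1, cut_contract]
    refine cut_congr fun e _ => crosses_congr fun v _ => ?_
    simp only [Set.mem_preimage]
    by_cases hv : v ∈ A
    · rw [collapse_of_mem hv]
      exact iff_of_false (fun h => h0B (hY h)) (fun h => hAB v hv (hY h))
    · rw [collapse_of_notMem hv]
  refine Pack.of_contract (x := x0) (A := A) (Or.inl rfl) hC.loopless (fun R hR h0 => ?_)
    (Pack.of_contract (x := x1) (A := B) (Or.inl rfl) contract_loopless (fun R hR h1 => ?_) hP)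
  · rw [hS]
    refine hC.le_cut ⟨Or.inl rfl, h0⟩ ?_
    rintro ⟨h | h, -⟩
    · exact hC.ne h.symm
    · exact hC.x1U (hSU h)
  · rw [hcutB B le_rfl, hcutB _ Set.sdiff_subset]
    rcases hT with hT | hT
    · have : cut E B = m := by
        rw [hB, hC.cut_insert_swap Set.sdiff_subset, Set.sdiff_sdiff_cancel_left hTU, hT]
      rw [this]
      exact hC.swap.le_cut ⟨Or.inl rfl, h1⟩ fun h => h0B h.1
    · have hR0 : R = ∅ := by
        rw [Set.eq_empty_iff_forall_notMem]
        intro v hv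
        rcases hR hv with rfl | h
        · exact h1 hv
        · exact h.2 (hT ▸ h.1)
      rw [hR0, Set.sdiff_empty]

end Conn

namespace Conn

variable {E : Multiset (Sym2 V)} {m : ℕ} {x0 x1 : V} {U : Finset V} {S : Finset V}

lemma exists_tight_insert (hC : Conn E x0 x1 (U : Set V) m) (h2 : 2 ≤ m)
    (hD : ¬ Dm E m x0 x1 (U : Set V)) (hSU : S ⊆ U) (hS : cut E (insert x0 (S : Set V)) = m)
    (hcard : 2 ≤ (U \ S).card) : ∃ v ∈ U \ S, cut E (insert x0 (insert v S : Set V)) = m := by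
  have key : ∀ n, ∀ T : Finset V, (T \ S).card = n → S ⊆ T → T ⊆ U →
      (cut E (insert x0 (T : Set V)) = m ∨ T = U) → n ≠ 0 →
      ∃ v ∈ U \ S, cut E (insert x0 (insert v S : Set V)) = m := by
    intro n
    induction n using Nat.strong_induction_on with
    | _ n ih =>
    intro T hn hST hTU hT hn0
    rcases Nat.lt_or_ge 1 n with h1 | h1
    · have hnt : ((T : Set V) \ (S : Set V)).Nontrivial := by
        rw [← hn, Finset.one_lt_card_iff_nontrivial] at h1
        rw [← Finset.coe_sdiff]
        exact h1
      obtain ⟨R, hSR, hRT, hRS, hRT', hR⟩ := hC.exists_between h2 hD (S := S) (T := T)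
        (by simpa using hST) (by simpa using hTU) hS (by simpa using hT) hnt
      have hfin : R.Finite := (Finset.finite_toSet T).subset hRT
      obtain ⟨R, rfl⟩ := hfin.exists_finset_coe
      simp only [Finset.coe_subset, ne_eq, Finset.coe_inj] at hSR hRT hRS hRT'
      refine ih (R \ S).card ?_ R rfl hSR (hRT.trans hTU) (Or.inl hR) ?_
      · rw [← hn, Finset.card_sdiff_of_subset hSR, Finset.card_sdiff_of_subset hST]
        have h3 := Finset.card_lt_card (Finset.ssubset_iff_subset_ne.2 ⟨hRT, hRT'⟩)
        have h4 := Finset.card_le_card hSR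
        omega
      · rw [Finset.card_ne_zero, Finset.sdiff_nonempty]
        exact fun h => hRS (subset_antisymm h hSR)
    · obtain ⟨v, hv⟩ := Finset.card_eq_one.1 (by omega : (T \ S).card = 1)
      have hTv : T = insert v S := by
        rw [← Finset.sdiff_union_of_subset hST, hv, Finset.singleton_union]
      have hvT : v ∈ T \ S := by rw [hv]; simp
      rw [Finset.mem_sdiff] at hvT
      refine ⟨v, Finset.mem_sdiff.2 ⟨hTU hvT.1, hvT.2⟩, ?_⟩
      rcases hT with hT | rfl
      · rwa [hTv, Finset.coe_insert] at hT
      · omega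
  exact key _ U rfl hSU le_rfl (Or.inr rfl) (by omega)

lemma exists_tight_erase (hC : Conn E x0 x1 (U : Set V) m) (h2 : 2 ≤ m)
    (hD : ¬ Dm E m x0 x1 (U : Set V)) (hSU : S ⊆ U) (hS : cut E (insert x0 (S : Set V)) = m)
    (hcard : 2 ≤ S.card) : ∃ v ∈ S, cut E (insert x0 ((S.erase v : Finset V) : Set V)) = m := by
  have hS' : cut E (insert x1 ((U \ S : Finset V) : Set V)) = m := by
    rw [hC.cut_insert_swap (by simp), Finset.coe_sdiff,
      Set.sdiff_sdiff_cancel_left (by simpa using hSU), hS]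
  obtain ⟨v, hv, h⟩ := hC.swap.exists_tight_insert h2 (fun h => hD h.swap)
    Finset.sdiff_subset hS' (by rwa [Finset.sdiff_sdiff_eq_self hSU])
  rw [Finset.sdiff_sdiff_eq_self hSU] at hv
  refine ⟨v, hv, ?_⟩
  rw [hC.cut_insert_swap] at h
  · rw [← h]
    congr 2
    ext w
    have := @hSU w
    simp only [Finset.coe_erase, Finset.coe_sdiff, Set.mem_sdiff, Set.mem_singleton_iff,
      Set.mem_insert_iff, Finset.mem_coe]
    tauto
  · rw [Set.insert_subset_iff]
    exact ⟨hSU hv, by simp⟩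

end Conn

/-- Consecutive members of a segmentation of width `m` containing the root `x0`, with `x0`
removed. -/
def Step (E : Multiset (Sym2 V)) (x0 : V) (U : Finset V) (m : ℕ) (S T : Finset V) : Prop :=
  ∃ v ∈ U \ S, T = insert v S ∧ cut E (insert x0 (T : Set V)) = m

namespace Conn

variable {E : Multiset (Sym2 V)} {m : ℕ} {x0 x1 : V} {U : Finset V} {S : Finset V}

lemma exists_steps_up (hC : Conn E x0 x1 (U : Set V) m) (h2 : 2 ≤ m)
    (hD : ¬ Dm E m x0 x1 (U : Set V)) (hSU : S ⊆ U) (hS : cut E (insert x0 (S : Set V)) = m)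
    (hne : S ≠ U) : ∃ T, Relation.ReflTransGen (Step E x0 U m) S T ∧ (U \ T).card = 1 := by
  induction hn : (U \ S).card generalizing S with
  | zero => exact absurd (subset_antisymm hSU (by simpa using hn)) hne
  | succ n ih =>
    rcases Nat.eq_zero_or_pos n with rfl | hpos
    · exact ⟨S, Relation.ReflTransGen.refl, hn⟩
    · obtain ⟨v, hv, h⟩ := hC.exists_tight_insert h2 hD hSU hS (by omega)
      have hv' := Finset.mem_sdiff.1 hv
      have hcard : (U \ insert v S).card = n := by
        rw [Finset.sdiff_insert, Finset.card_erase_of_mem hv, hn]; rfl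
      rw [← Finset.coe_insert] at h
      obtain ⟨T, hT, hT1⟩ := ih (S := insert v S) (Finset.insert_subset hv'.1 hSU) h
        (by rintro rfl; simp at hcard; omega) hcard
      exact ⟨T, hT.head ⟨v, hv, rfl, h⟩, hT1⟩

lemma exists_steps_down (hC : Conn E x0 x1 (U : Set V) m) (h2 : 2 ≤ m)
    (hD : ¬ Dm E m x0 x1 (U : Set V)) (hSU : S ⊆ U) (hS : cut E (insert x0 (S : Set V)) = m)
    (hne : S.Nonempty) : ∃ R ⊆ U, R.card = 1 ∧ cut E (insert x0 (R : Set V)) = m ∧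
      Relation.ReflTransGen (Step E x0 U m) R S := by
  induction hn : S.card generalizing S with
  | zero => simp [Finset.card_eq_zero.1 hn] at hne
  | succ n ih =>
    rcases Nat.eq_zero_or_pos n with rfl | hpos
    · exact ⟨S, hSU, hn, hS, Relation.ReflTransGen.refl⟩
    · obtain ⟨v, hv, h⟩ := hC.exists_tight_erase h2 hD hSU hS (by omega)
      have hcard : (S.erase v).card = n := by rw [Finset.card_erase_of_mem hv, hn]; rfl
      obtain ⟨R, hRU, hR1, hR, hRS⟩ := ih (S := S.erase v) ((Finset.erase_subset _ _).trans hSU) h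
        (Finset.card_pos.1 (by omega)) hcard
      exact ⟨R, hRU, hR1, hR, hRS.tail ⟨v, by simp [hSU hv], (Finset.insert_erase hv).symm, hS⟩⟩

end Conn

lemma segChain_of_steps {G : MG V} {x0 x1 : V} {m : ℕ} {R T : Finset V} (hx0 : x0 ∈ G.verts)
    (hRU : R ⊆ G.verts \ {x0, x1}) (hR : cut G.edges (insert x0 (R : Set V)) = m)
    (h : Relation.ReflTransGen (Step G.edges x0 (G.verts \ {x0, x1}) m) R T) :
    ∃ (n : ℕ) (C : Fin (n + 1) → Finset V), SegChain G n C m ∧ C 0 = insert x0 R ∧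
      C (Fin.last n) = insert x0 T := by
  induction h with
  | refl =>
    refine ⟨0, fun _ => insert x0 R, ⟨fun _ => ?_, fun i => i.elim0, fun _ => ?_⟩, rfl, rfl⟩
    · exact Finset.insert_subset hx0 (hRU.trans Finset.sdiff_subset)
    · rw [dcut_eq_cut, Finset.coe_insert, hR]
  | @tail S T _ hST ih =>
    obtain ⟨n, C, ⟨h1, h2, h3⟩, h0, hl⟩ := ih
    obtain ⟨v, hv, rfl, hcut⟩ := hST
    simp only [Finset.mem_sdiff, Finset.mem_insert, Finset.mem_singleton, not_or] at hv
    refine ⟨n + 1, Fin.snoc C (insert x0 (insert v S)), ⟨fun i => ?_, fun i => ?_, fun i => ?_⟩,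
      ?_, ?_⟩
    · refine Fin.lastCases ?_ (fun i => ?_) i
      · rw [Fin.snoc_last, Finset.insert_comm, ← hl]
        exact Finset.insert_subset hv.1.1 (h1 _)
      · rw [Fin.snoc_castSucc]; exact h1 i
    · refine Fin.lastCases ?_ (fun i => ?_) i
      · rw [Fin.succ_last, Fin.snoc_last, Fin.snoc_castSucc, hl, Finset.insert_comm]
        refine ⟨Finset.subset_insert _ _, ?_⟩
        rw [Finset.insert_sdiff_cancel (by simp [hv.1.2.1, hv.2]), Finset.card_singleton]
      · rw [Fin.succ_castSucc, Fin.snoc_castSucc, Fin.snoc_castSucc]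
        exact h2 i
    · refine Fin.lastCases ?_ (fun i => ?_) i
      · rw [Fin.snoc_last, dcut_eq_cut, Finset.coe_insert, hcut]
      · rw [Fin.snoc_castSucc]; exact h3 i
    · rw [← Fin.castSucc_zero, Fin.snoc_castSucc, h0]
    · rw [Fin.snoc_last]

/-- A tight internal cut extends to a segmentation. -/
lemma typeA_of_tight {G : MG V} {x0 x1 : V} {m : ℕ} (hx0 : x0 ∈ G.verts) (hx1 : x1 ∈ G.verts)
    (h2 : 2 ≤ m) (hC : Conn G.edges x0 x1 ((G.verts \ {x0, x1} : Finset V) : Set V) m)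
    (hD : ¬ Dm G.edges m x0 x1 ((G.verts \ {x0, x1} : Finset V) : Set V)) {S : Finset V}
    (hSU : S ⊆ G.verts \ {x0, x1}) (hS : cut G.edges (insert x0 (S : Set V)) = m)
    (hS0 : S.Nonempty) (hS1 : S ≠ G.verts \ {x0, x1}) : TypeA G m x0 x1 := by
  obtain ⟨R, hRU, hR1, hR, hRS⟩ := hC.exists_steps_down h2 hD hSU hS hS0
  obtain ⟨T, hST, hT1⟩ := hC.exists_steps_up h2 hD hSU hS hS1
  obtain ⟨n, C, hchain, h0, hl⟩ := segChain_of_steps hx0 hRU hR (hRS.trans hST)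
  have hx1T : x1 ∉ T := by
    have : ∀ {A B}, Relation.ReflTransGen (Step G.edges x0 (G.verts \ {x0, x1}) m) A B →
        x1 ∉ A → x1 ∉ B := by
      intro A B hAB hA
      induction hAB with
      | refl => exact hA
      | tail _ h ih =>
        obtain ⟨v, hv, rfl, -⟩ := h
        simp only [Finset.mem_sdiff, Finset.mem_insert, Finset.mem_singleton, not_or] at hv ⊢
        exact ⟨fun h => hv.1.2.2 h.symm, ih⟩
    exact this hST fun h => by have := hSU h; simp at this
  refine ⟨insert x0 R, G.verts \ insert x0 T, Finset.mem_insert_self _ _, ?_, ?_, ?_,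
    n, C, hchain, h0, by rw [hl]⟩
  · simp [hx1, hC.ne.symm, hx1T]
  · exact (Finset.card_insert_le _ _).trans (by omega)
  · have : G.verts \ insert x0 T ⊆ insert x1 ((G.verts \ {x0, x1}) \ T) := by
      intro v
      simp only [Finset.mem_sdiff, Finset.mem_insert, Finset.mem_singleton]
      tauto
    exact (Finset.card_le_card this).trans ((Finset.card_insert_le _ _).trans (by omega))

lemma Pack.of_immersion {E : Multiset (Sym2 V)} {φ : W → V} {D : List (W × W)}
    {P : Multiset (Sym2 W × List V)}
    (hP : P.map Prod.fst = (D.map fun d => s(d.1, d.2) : List (Sym2 W)))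
    (hw : ∀ p ∈ P, ∃ u v : W, p.1 = s(u, v) ∧ IsWalk p.2 (φ u) (φ v))
    (hE : (P.map fun p => walkEdges p.2).sum ≤ E) : Pack (D.map (Prod.map φ φ)) E := by
  induction D generalizing P E with
  | nil => trivial
  | cons d D ih =>
    rw [List.map_cons, ← Multiset.cons_coe] at hP
    obtain ⟨p, hp, hpd, hP'⟩ := (Multiset.map_eq_cons _ _ _ _).2 hP
    obtain ⟨P, rfl⟩ := Multiset.exists_cons_of_mem hp
    rw [Multiset.erase_cons_head] at hP'
    rw [Multiset.map_cons, Multiset.sum_cons] at hE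
    refine Pack.mono (Pack.cons ?_ (ih hP' (fun q hq => hw q (by simp [hq])) le_rfl)) hE
    obtain ⟨u, v, huv, h⟩ := hw p hp
    rw [hpd] at huv
    have h := Cn.of_isWalk h le_rfl
    rcases Sym2.eq_iff.1 huv with ⟨h1, h2⟩ | ⟨h1, h2⟩
    · rw [h1, h2]; exact h
    · rw [h1, h2]; exact h.symm

lemma Pack.exists_immersion {E : Multiset (Sym2 V)} {φ : W → V} {D : List (W × W)}
    (h : Pack (D.map (Prod.map φ φ)) E) : ∃ P : Multiset (Sym2 W × List V),
      P.map Prod.fst = (D.map fun d => s(d.1, d.2) : List (Sym2 W)) ∧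
      (∀ p ∈ P, ∃ u v : W, p.1 = s(u, v) ∧ IsWalk p.2 (φ u) (φ v)) ∧
      (P.map fun p => walkEdges p.2).sum ≤ E := by
  induction D generalizing E with
  | nil => exact ⟨0, by simp⟩
  | cons d D ih =>
    obtain ⟨A, B, rfl, hA, hB⟩ := h
    obtain ⟨P, h1, h2, h3⟩ := ih hB
    obtain ⟨l, -, hl, hlA⟩ := hA.exists_path
    refine ⟨(s(d.1, d.2), l) ::ₘ P, by simp [h1], ?_, ?_⟩
    · intro p hp
      rcases Multiset.mem_cons.1 hp with rfl | hp
      · exact ⟨d.1, d.2, rfl, hl⟩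
      · exact h2 p hp
    · rw [Multiset.map_cons, Multiset.sum_cons]
      exact add_le_add hlA h3

lemma dmEdges_eq (m : ℕ) : dmEdges m =
    (((([(0, 2), (0, 3), (1, 2), (1, 3), (2, 3)] ++ List.replicate (m - 2) (0, 1)) :
      List (Fin 4 × Fin 4)).map fun d => s(d.1, d.2) : List (Sym2 (Fin 4))) :
      Multiset (Sym2 (Fin 4))) := by
  rw [List.map_append, ← Multiset.coe_add, dmEdges, add_comm]
  congr 1
  rw [List.map_replicate, Multiset.coe_replicate]

lemma dmPairs_eq (m : ℕ) (φ : Fin 4 → V) : dmPairs m (φ 0) (φ 1) (φ 2) (φ 3) =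
    (([(0, 2), (0, 3), (1, 2), (1, 3), (2, 3)] ++ List.replicate (m - 2) (0, 1)) :
      List (Fin 4 × Fin 4)).map (Prod.map φ φ) := by
  simp [dmPairs]

lemma hasRootedDmImmersion_iff {G : MG V} {m : ℕ} {x0 x1 : V} (hx0 : x0 ∈ G.verts)
    (hx1 : x1 ∈ G.verts) (hne : x0 ≠ x1) : HasRootedDmImmersion G m x0 x1 ↔
      Dm G.edges m x0 x1 ((G.verts \ {x0, x1} : Finset V) : Set V) := by
  constructor
  · rintro ⟨φ, rfl, rfl, hinj, hv, P, h1, h2, h3⟩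
    refine ⟨φ 2, ?_, φ 3, ?_, hinj.ne (by decide), ?_⟩
    · simp [hv, hinj.eq_iff]
    · simp [hv, hinj.eq_iff]
    · rw [dmPairs_eq]
      rw [dmEdges_eq] at h1
      exact Pack.of_immersion h1 h2 h3
  · rintro ⟨y0, h0, y1, h1, hy, hP⟩
    simp only [Finset.coe_sdiff, Set.mem_sdiff, Finset.mem_coe, Finset.mem_insert,
      Finset.mem_singleton, not_or] at h0 h1
    refine ⟨![x0, x1, y0, y1], rfl, rfl, ?_, ?_, ?_⟩
    · intro i j hij
      fin_cases i <;> fin_cases j <;> simp_all [eq_comm]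
    · intro i
      fin_cases i
      exacts [hx0, hx1, h0.1, h1.1]
    · rw [dmEdges_eq]
      exact Pack.exists_immersion (by rw [← dmPairs_eq]; exact hP)

lemma conn_of_lam {G : MG V} {m : ℕ} {x0 x1 : V} (hx0 : x0 ∈ G.verts)
    (hx1 : x1 ∈ G.verts) (hne : x0 ≠ x1) (hln : LamNGe G x0 x1 3) (hlni : LamNiGe G x0 x1 4)
    (hls : LamSGe G x0 x1 m) :
    Conn G.edges x0 x1 ((G.verts \ {x0, x1} : Finset V) : Set V) m := by
  have fin : ∀ X : Set V, X ⊆ ((G.verts \ {x0, x1} : Finset V) : Set V) →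
      ∃ Y : Finset V, (Y : Set V) = X ∧ Y ⊆ G.verts ∧ x0 ∉ Y ∧ x1 ∉ Y := by
    intro X hX
    obtain ⟨Y, rfl⟩ := ((Finset.finite_toSet _).subset hX).exists_finset_coe
    rw [Finset.coe_subset] at hX
    exact ⟨Y, rfl, hX.trans Finset.sdiff_subset, fun h => by simpa using hX h,
      fun h => by simpa using hX h⟩
  refine ⟨hne, by simp, by simp, fun e he v hv => ?_, G.loopless, fun X hX hXU => ?_,
    fun X hX hXU => ?_, fun X hXU => ?_⟩
  · have := G.edge_support e he v hv
    simp only [Finset.coe_sdiff, Set.mem_sdiff, Finset.mem_coe, Finset.mem_insert,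
      Finset.mem_singleton]
    tauto
  · obtain ⟨Y, rfl, hY, h0, h1⟩ := fin X hXU
    rw [← dcut_eq_cut]
    exact hln Y hY (by simpa using hX) (by rintro rfl; exact h0 hx0) (by simp [h0, h1])
  · obtain ⟨Y, rfl, hY, h0, h1⟩ := fin X hXU
    rw [← dcut_eq_cut]
    refine hlni Y hY (Finset.one_lt_card_iff_nontrivial.2 hX) ?_ (by simp [h0, h1])
    rw [← Finset.card_pair hne]
    refine Finset.card_le_card fun v hv => ?_
    simp only [Finset.mem_insert, Finset.mem_singleton] at hv
    rcases hv with rfl | rfl <;> simp [*]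
  · obtain ⟨Y, rfl, hY, h0, h1⟩ := fin X hXU
    rw [← Finset.coe_insert, ← dcut_eq_cut]
    exact hls _ (Finset.insert_subset hx0 hY) (by simp) (by simp [h1, hne.symm])

lemma Pack.sum_le_cut {D : List (V × V)} {E : Multiset (Sym2 V)} (h : Pack D E) (X : Set V) :
    (D.map fun d => if d.1 ∈ X ↔ d.2 ∈ X then 0 else 1).sum ≤ cut E X := by
  induction D generalizing E with
  | nil => simp
  | cons d D ih =>
    obtain ⟨A, B, rfl, hA, hB⟩ := h
    have hB := ih hB
    rw [List.map_cons, List.sum_cons, cut_add]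
    split_ifs with hd
    · omega
    · have : 0 < cut A X := by
        by_cases h1 : d.1 ∈ X
        · exact hA.cut_pos h1 (by tauto)
        · exact hA.cut_pos' h1 (by tauto)
      omega

lemma Pack.lt_cut_of_dmPairs {E : Multiset (Sym2 V)} {m : ℕ} {x0 x1 y0 y1 : V} (h2 : 2 ≤ m)
    (h : Pack (dmPairs m x0 x1 y0 y1) E) {X : Set V} (h0 : x0 ∈ X) (h1 : x1 ∉ X)
    (hy : ¬ (y0 ∈ X ↔ y1 ∈ X)) : m < cut E X := by
  have := h.sum_le_cut X
  by_cases hy0 : y0 ∈ X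
  · have hy1 : y1 ∉ X := by tauto
    simp [dmPairs, h0, h1, hy0, hy1] at this
    omega
  · have hy1 : y1 ∈ X := by tauto
    simp [dmPairs, h0, h1, hy0, hy1] at this
    omega

lemma TypeA.not_dm {G : MG V} {m : ℕ} {x0 x1 : V} (h2 : 2 ≤ m) (h : TypeA G m x0 x1) :
    ¬ Dm G.edges m x0 x1 ((G.verts \ {x0, x1} : Finset V) : Set V) := by
  rintro ⟨y0, hy0, y1, hy1, hy, hP⟩
  simp only [Finset.coe_sdiff, Set.mem_sdiff, Finset.mem_coe, Finset.mem_insert,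
    Finset.mem_singleton, not_or] at hy0 hy1
  obtain ⟨X0, X1, hx0, hx1, hc0, hc1, n, C, ⟨-, hstep, hcut⟩, rfl, rfl⟩ := h
  have hmono : Monotone C := Fin.monotone_iff_le_succ.2 fun i => (hstep i).1
  have hsep : ∀ i, y0 ∈ C i ↔ y1 ∈ C i := by
    intro i
    by_contra hsep
    have h1 := hP.lt_cut_of_dmPairs h2 (X := C i) (hmono (Fin.zero_le i) hx0)
      (fun h => (Finset.mem_sdiff.1 hx1).2 (hmono (Fin.le_last i) h)) hsep
    rw [← dcut_eq_cut, hcut] at h1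
    omega
  have hpair : ∀ (S : Finset V) (x : V), x ∈ S → y0 ∈ S → y1 ∈ S → y0 ≠ x → y1 ≠ x →
      3 ≤ S.card := by
    intro S x hx h0 h1 h0x h1x
    have : ({y0, y1, x} : Finset V).card = 3 := by
      rw [Finset.card_eq_three]; exact ⟨y0, y1, x, hy, h0x, h1x, rfl⟩
    rw [← this]
    refine Finset.card_le_card fun v hv => ?_
    simp only [Finset.mem_insert, Finset.mem_singleton] at hv
    rcases hv with rfl | rfl | rfl <;> assumption
  have hnone : ∀ i, y0 ∉ C i := by
    intro i
    induction i using Fin.induction with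
    | zero =>
      intro h0
      have := hpair _ _ hx0 h0 ((hsep 0).1 h0) hy0.2.1 hy1.2.1
      omega
    | succ i ih =>
      intro h0
      have h1 := (hsep _).1 h0
      have h2 : ({y0, y1} : Finset V) ⊆ C i.succ \ C i.castSucc := by
        intro v hv
        simp only [Finset.mem_insert, Finset.mem_singleton] at hv
        rw [Finset.mem_sdiff]
        rcases hv with rfl | rfl
        · exact ⟨h0, ih⟩
        · exact ⟨h1, fun h => ih ((hsep _).2 h)⟩
      have := Finset.card_le_card h2
      rw [Finset.card_pair hy, (hstep i).2] at this
      omega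
  have h0 := hnone (Fin.last n)
  have h1 : y1 ∉ C (Fin.last n) := fun h => h0 ((hsep _).2 h)
  have := hpair _ _ hx1 (by simp [hy0.1, h0]) (by simp [hy1.1, h1]) hy0.2.2 hy1.2.2
  omega

lemma isComponent_iff {H : MG V} {D : Finset V} :
    IsComponent H D ↔ ∃ v ∈ H.verts, D = H.verts.filter (Cn H.edges v) := by
  constructor
  · rintro ⟨hD, ⟨v, hv⟩, hconn, hcl⟩
    refine ⟨v, hD hv, ?_⟩
    ext w
    rw [Finset.mem_filter]
    constructor
    · intro hw
      refine ⟨hD hw, ?_⟩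
      obtain ⟨l, hl, hle, -⟩ := hconn v (Finset.mem_inter.2 ⟨hD hv, hv⟩) w
        (Finset.mem_inter.2 ⟨hD hw, hw⟩)
      exact Cn.of_isWalk hl (hle.trans (Multiset.filter_le _ _))
    · rintro ⟨-, hw⟩
      induction hw with
      | refl => exact hv
      | tail _ hbc ih => exact hcl _ hbc ⟨_, by simp, ih⟩ _ (by simp)
  · rintro ⟨v, hv, rfl⟩
    have hcl : ∀ e ∈ H.edges, (∃ a ∈ e, a ∈ H.verts.filter (Cn H.edges v)) →
        ∀ b ∈ e, b ∈ H.verts.filter (Cn H.edges v) := by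
      rintro e he ⟨a, ha, haD⟩ b hb
      rw [Finset.mem_filter] at haD ⊢
      refine ⟨H.edge_support e he b hb, ?_⟩
      by_cases hab : a = b
      · exact hab ▸ haD.2
      · rw [(Sym2.mem_and_mem_iff hab).1 ⟨ha, hb⟩] at he
        exact haD.2.trans (Cn.of_mem he)
    refine ⟨Finset.filter_subset _ _, ⟨v, Finset.mem_filter.2 ⟨hv, Cn.refl _ _⟩⟩, ?_, hcl⟩
    intro a ha b hb
    replace ha := (Finset.mem_inter.1 ha).2
    replace hb := (Finset.mem_inter.1 hb).2
    have key : ∀ w, Cn H.edges a w → Cn (induce H (H.verts.filter (Cn H.edges v))).edges a w ∧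
        w ∈ H.verts.filter (Cn H.edges v) := by
      intro w hw
      induction hw with
      | refl => exact ⟨Cn.refl _ _, ha⟩
      | @tail b c _ hbc ih =>
        have hall := hcl _ hbc ⟨b, by simp, ih.2⟩
        exact ⟨ih.1.trans (Cn.of_mem (Multiset.mem_filter.2 ⟨hbc, hall⟩)), hall c (by simp)⟩
    have hab := key b ((Finset.mem_filter.1 ha).2.symm.trans (Finset.mem_filter.1 hb).2)
    obtain ⟨l, -, hl, hle⟩ := hab.1.exists_path
    refine ⟨l, hl, hle, fun w hw => ?_⟩
    have h1 := ((Cn.of_walk (List.mem_of_mem_head? hl.1) hw).mono hle).mono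
      (Multiset.filter_le _ _)
    have := (key w h1).2
    exact Finset.mem_inter.2 ⟨(Finset.mem_filter.1 this).1, this⟩

/-- A connection between vertices other than `w` using at most one edge at `w` can avoid `w`. -/
lemma Cn.avoid {A : Multiset (Sym2 V)} {u v w : V} (h : Cn A u v) (hu : u ≠ w) (hv : v ≠ w)
    (hw : cut A {w} ≤ 1) : ∃ B ≤ A, Cn B u v ∧ ∀ e ∈ B, w ∉ e := by
  obtain ⟨l, hl, hlw, hle⟩ := h.exists_path
  have hul := List.mem_of_mem_head? hlw.1
  have hvl := List.mem_of_mem_getLast? hlw.2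
  by_cases hwl : w ∈ l
  · exfalso
    obtain ⟨p, q, rfl⟩ := List.append_of_mem hwl
    have hp : p ≠ [] := by
      rintro rfl
      simp only [IsWalk, List.nil_append, List.head?_cons, Option.some.injEq] at hlw
      exact hu hlw.1.symm
    have hq : q ≠ [] := by
      rintro rfl
      simp only [IsWalk, List.getLast?_append, List.getLast?_singleton, Option.some_or,
        Option.some.injEq] at hlw
      exact hv hlw.2.symm
    obtain ⟨p, a, rfl⟩ : ∃ p' a, p = p' ++ [a] :=
      ⟨p.dropLast, p.getLast hp, (List.dropLast_append_getLast hp).symm⟩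
    obtain ⟨b, q, rfl⟩ := List.exists_cons_of_ne_nil hq
    have h1 : a ≠ w ∧ w ≠ b := by
      constructor <;> rintro rfl <;>
        simp [List.nodup_append] at hl
    have h2 : cut (walkEdges (p ++ a :: w :: b :: q)) {w} ≤ 1 := by
      refine le_trans (cut_mono ?_ _) hw
      simpa using hle
    rw [walkEdges_append, walkEdges_cons_cons, walkEdges_cons_cons, cut_add, cut_cons, cut_cons,
      if_pos, if_pos] at h2
    · omega
    · rw [crosses_mk]; simp [h1.1]
    · rw [crosses_mk]; simp [h1.2.symm]
  · exact ⟨_, hle, Cn.of_isWalk hlw le_rfl, fun e he hwe => hwl (mem_of_mem_walkEdges he hwe)⟩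

lemma cut_walkEdges_head_le {l : List V} {u v : V} (hl : l.Nodup) (h : IsWalk l u v) :
    cut (walkEdges l) {u} ≤ 1 := by
  obtain ⟨h, -⟩ := h
  match l, hl with
  | [], _ => simp
  | [a], _ => simp
  | a :: b :: l, hl =>
    simp only [List.head?_cons, Option.some.injEq] at h
    subst h
    rw [walkEdges_cons_cons, cut_cons]
    have : cut (walkEdges (b :: l)) {a} = 0 := by
      rw [cut_eq_zero_iff]
      rintro e he ⟨x, y, rfl, hx, -⟩
      rw [Set.mem_singleton_iff] at hx
      subst hx
      exact (List.nodup_cons.1 hl).1 (mem_of_mem_walkEdges he (by simp))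
    rw [this]
    split_ifs <;> omega

lemma IsWalk.reverse {l : List V} {u v : V} (h : IsWalk l u v) : IsWalk l.reverse v u := by
  simpa [IsWalk, and_comm] using h

lemma mem_verts_deleteVerts {G : MG V} {S : Finset V} {v : V} :
    v ∈ (deleteVerts G S).verts ↔ v ∈ G.verts ∧ v ∉ S := by
  simp only [deleteVerts, induce, Finset.mem_inter, Finset.mem_sdiff]
  tauto

lemma mem_edges_deleteVerts {G : MG V} {S : Finset V} {e : Sym2 V} :
    e ∈ (deleteVerts G S).edges ↔ e ∈ G.edges ∧ ∀ v ∈ e, v ∉ S := by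
  simp only [deleteVerts, induce, Multiset.mem_filter, Finset.mem_sdiff]
  exact ⟨fun h => ⟨h.1, fun v hv => (h.2 v hv).2⟩,
    fun h => ⟨h.1, fun v hv => ⟨G.edge_support e h.1 v hv, h.2 v hv⟩⟩⟩

lemma mem_lobeEdges_of_mem {G : MG V} {x0 x1 : V} {D : Finset V}
    (hD : IsComponent (deleteVerts G {x0, x1}) D) {e : Sym2 V} (he : e ∈ G.edges) {v : V}
    (hv : v ∈ e) (hvD : v ∈ D) : e ∈ lobeEdges G D x0 x1 := by
  have hv0 := mem_verts_deleteVerts.1 (hD.1 hvD)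
  simp only [Finset.mem_insert, Finset.mem_singleton, not_or] at hv0
  refine Multiset.mem_filter.2 ⟨he, fun w hw => ?_, ?_⟩
  · simp only [Finset.mem_insert]
    by_contra hc
    simp only [not_or] at hc
    obtain ⟨hw0, hw1, hwD⟩ := hc
    refine hwD (hD.2.2.2 e (mem_edges_deleteVerts.2 ⟨he, fun z hz => ?_⟩) ⟨v, hv, hvD⟩ w hw)
    have hvw : v ≠ w := by rintro rfl; exact hwD hvD
    rw [(Sym2.mem_and_mem_iff hvw).1 ⟨hv, hw⟩, Sym2.mem_iff] at hz
    rcases hz with rfl | rfl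
    · simp [hv0.2]
    · simp [hw0, hw1]
  · rintro rfl
    rw [Sym2.mem_iff] at hv
    tauto

/-- The roots of a graph of type `B_m` have degree at most `m + 1`. -/
lemma cut_root_le {G : MG V} {m k : ℕ} {x0 x1 : V} {C : Fin k → Finset V} {nL : Fin k → ℕ}
    (hne : x0 ≠ x1) (hC : ∀ D, IsComponent (deleteVerts G {x0, x1}) D ↔ ∃ i, C i = D)
    (hL : ∀ i, ∃ l : List V, l.Nodup ∧ IsWalk l x0 x1 ∧
      lobeEdges G (C i) x0 x1 = nL i • walkEdges l)
    (hsum : emult G x0 x1 + ∑ i, nL i = m + 1) {r : V} (hr : r = x0 ∨ r = x1) :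
    cut G.edges {r} ≤ m + 1 := by
  have hE : G.edges ≤ Multiset.replicate (emult G x0 x1) s(x0, x1) +
      ∑ i, lobeEdges G (C i) x0 x1 := by
    rw [Multiset.le_iff_count]
    intro e
    rw [Multiset.count_add, Multiset.count_sum']
    by_cases he : e = s(x0, x1)
    · subst he
      rw [Multiset.count_replicate_self]
      exact Nat.le_add_right _ _
    · by_cases hmem : e ∈ G.edges
      · obtain ⟨v, hv, hv0⟩ : ∃ v ∈ e, v ∉ ({x0, x1} : Finset V) := by
          by_contra hc
          push Not at hc
          induction e with | _ a b =>
          have ha := hc a (by simp)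
          have hb := hc b (by simp)
          have hab : a ≠ b := by
            rintro rfl
            exact G.loopless _ hmem (by simp)
          simp only [Finset.mem_insert, Finset.mem_singleton] at ha hb
          rcases ha with rfl | rfl <;> rcases hb with rfl | rfl
          · exact hab rfl
          · exact he rfl
          · exact he Sym2.eq_swap
          · exact hab rfl
        have hvH := mem_verts_deleteVerts.2 ⟨G.edge_support e hmem v hv, hv0⟩
        have hcomp := isComponent_iff.2 ⟨v, hvH, rfl⟩
        obtain ⟨i, hi⟩ := (hC _).1 hcomp
        have hlobe : e ∈ lobeEdges G (C i) x0 x1 := by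
          refine mem_lobeEdges_of_mem ((hC _).2 ⟨i, rfl⟩) hmem hv ?_
          rw [hi]
          exact Finset.mem_filter.2 ⟨hvH, Cn.refl _ _⟩
        refine le_trans ?_ (Nat.le_add_left _ _)
        refine le_trans ?_ (Finset.single_le_sum (f := fun i => (lobeEdges G (C i) x0 x1).count e)
          (fun _ _ => Nat.zero_le _) (Finset.mem_univ i))
        rw [lobeEdges, Multiset.count_filter, if_pos (Multiset.mem_filter.1 hlobe).2]
      · rw [Multiset.count_eq_zero_of_notMem hmem]
        exact Nat.zero_le _
  have hlobe : ∀ i, cut (lobeEdges G (C i) x0 x1) {r} ≤ nL i := by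
    intro i
    obtain ⟨l, hl, hw, h⟩ := hL i
    have h1 : cut (walkEdges l) {r} ≤ 1 := by
      rcases hr with rfl | rfl
      · exact cut_walkEdges_head_le hl hw
      · rw [← walkEdges_reverse]
        exact cut_walkEdges_head_le (List.nodup_reverse.2 hl) hw.reverse
    rw [h, cut, Multiset.countP_nsmul]
    exact (Nat.mul_le_mul_left _ h1).trans (by omega)
  have hcutsum : cut (∑ i, lobeEdges G (C i) x0 x1) {r} = ∑ i, cut (lobeEdges G (C i) x0 x1) {r} :=
    map_sum (Multiset.countPAddMonoidHom (crosses {r})) _ _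
  refine (cut_mono hE _).trans ?_
  rw [cut_add, hcutsum, ← hsum]
  refine add_le_add ?_ (Finset.sum_le_sum fun i _ => hlobe i)
  refine (Multiset.countP_le_card _ _).trans ?_
  rw [Multiset.card_replicate]

lemma IsWalk.mem_left {l s t : List V} {u v y : V} (h : IsWalk l u v) (hl : l = s ++ y :: t)
    (hy : y ≠ u) : u ∈ s := by
  subst hl
  cases s with
  | nil =>
    simp only [IsWalk, List.nil_append, List.head?_cons, Option.some.injEq] at h
    exact absurd h.1 hy
  | cons a s =>
    simp only [IsWalk, List.cons_append, List.head?_cons, Option.some.injEq] at h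
    simp [h.1]

lemma IsWalk.mem_right {l s t : List V} {u v y : V} (h : IsWalk l u v) (hl : l = s ++ y :: t)
    (hy : y ≠ v) : v ∈ t := by
  have hv : v ∈ t.reverse :=
    h.reverse.mem_left (s := t.reverse) (t := s.reverse) (y := y) (by simp [hl]) hy
  simpa using hv

/-- The only edge of a path leaving an initial segment is the one following that segment. -/
lemma eq_of_mem_walkEdges {p q : List V} {a b u v : V} (hn : (p ++ a :: b :: q).Nodup)
    (he : s(u, v) ∈ walkEdges (p ++ a :: b :: q)) (hu : u ∈ p ++ [a]) (hv : v ∉ p ++ [a]) :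
    s(u, v) = s(a, b) := by
  rw [walkEdges_append, walkEdges_cons_cons, Multiset.mem_add, Multiset.mem_cons] at he
  rcases he with he | he | he
  · exact absurd (mem_of_mem_walkEdges he (by simp)) hv
  · exact he
  · have hu' := mem_of_mem_walkEdges he (Sym2.mem_mk_left u v)
    have hsplit : (p ++ [a] ++ b :: q).Nodup := by simpa using hn
    exact absurd hu' (List.disjoint_of_nodup_append hsplit hu)

/-- Three connections passing between consecutive vertices of a doubled lobe cannot be
edge-disjoint. -/
lemma not_cn_of_doubled_lobe {G : MG V} {x0 x1 y0 y1 : V} {D : Finset V} {l s t : List V}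
    (hD : IsComponent (deleteVerts G {x0, x1}) D) (hl : l.Nodup) (hw : IsWalk l x0 x1)
    (hlD : l.toFinset = insert x0 (insert x1 D)) (hlobe : lobeEdges G D x0 x1 = 2 • walkEdges l)
    (hst : l = s ++ y0 :: t) (hyt : y1 ∈ t) (hy0 : y0 ∈ D) (hy1 : y1 ∈ D)
    {A B Q : Multiset (Sym2 V)} (hE : A + B + Q ≤ G.edges) (hA : Cn A x0 y1) (hB : Cn B x1 y0)
    (hQ : Cn Q y0 y1) (hA1 : ∀ e ∈ A, x1 ∉ e) (hB0 : ∀ e ∈ B, x0 ∉ e)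
    (hQ0 : ∀ e ∈ Q, x0 ∉ e) : False := by
  have hroot : ∀ v ∈ D, v ≠ x0 ∧ v ≠ x1 := by
    intro v hv
    have := (mem_verts_deleteVerts.1 (hD.1 hv)).2
    simpa using this
  have hx0 := hw.mem_left hst (hroot _ hy0).1
  have hx1 := hw.mem_right hst (hroot _ hy0).2
  obtain ⟨z, q, rfl⟩ := List.exists_cons_of_ne_nil (List.ne_nil_of_mem hyt)
  subst hst
  have hmem : ∀ v, v ∈ s ++ [y0] ∨ v ∈ z :: q ↔ v = x0 ∨ v = x1 ∨ v ∈ D := by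
    intro v
    have : v ∈ (s ++ y0 :: z :: q).toFinset ↔ v ∈ insert x0 (insert x1 D) := by rw [hlD]
    simp only [List.mem_toFinset, Finset.mem_insert, List.mem_append, List.mem_cons] at this
    rw [← this]
    simp only [List.mem_append, List.mem_cons, List.not_mem_nil, or_false]
    tauto
  have hdis : List.Disjoint (s ++ [y0]) (z :: q) := by
    refine List.disjoint_of_nodup_append ?_
    simpa using hl
  have hpath : ∀ e ∈ G.edges, ∀ v ∈ e, v ∈ D → e ∈ walkEdges (s ++ y0 :: z :: q) := by
    intro e he v hv hvD
    have := mem_lobeEdges_of_mem hD he hv hvD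
    rw [hlobe] at this
    exact Multiset.mem_of_mem_nsmul this
  have hleft : ∀ K ≤ G.edges, (∀ e ∈ K, x0 ∉ e) →
      0 < cut K {v | v ∈ D ∧ v ∈ s ++ [y0]} → s(y0, z) ∈ K := by
    intro K hK hK0 hcut
    obtain ⟨_, he, u, v, rfl, hu, hv⟩ := cut_pos_iff.1 hcut
    have hel := hpath _ (Multiset.mem_of_le hK he) u (by simp) hu.1
    rwa [← eq_of_mem_walkEdges hl hel hu.2]
    intro hvs
    rcases (hmem v).1 (.inl hvs) with rfl | rfl | hvD
    · exact hK0 _ he (by simp)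
    · exact hdis hvs hx1
    · exact hv ⟨hvD, hvs⟩
  have hright : s(y0, z) ∈ A := by
    have hcut := hA.cut_pos' (X := {v | v ∈ D ∧ v ∈ z :: q}) (fun h => (hroot _ h.1).1 rfl)
      ⟨hy1, hyt⟩
    have hAE : A ≤ G.edges := ((Multiset.le_add_right A B).trans (Multiset.le_add_right _ Q)).trans hE
    obtain ⟨_, he, u, v, rfl, hu, hv⟩ := cut_pos_iff.1 hcut
    have hel := hpath _ (Multiset.mem_of_le hAE he) u (by simp) hu.1
    have hvl : v ∈ s ++ [y0] ∨ v ∈ z :: q := by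
      have := mem_of_mem_walkEdges hel (Sym2.mem_mk_right u v)
      simpa [or_assoc] using this
    rw [Sym2.eq_swap] at he hel
    rw [← eq_of_mem_walkEdges hl hel]
    · exact he
    · refine hvl.resolve_right fun hvq => ?_
      rcases (hmem v).1 (.inr hvq) with rfl | rfl | hvD
      · exact hdis (List.mem_append_left _ hx0) hvq
      · exact hA1 _ he (by simp)
      · exact hv ⟨hvD, hvq⟩
    · exact fun hus => hdis hus hu.2
  have hyq : y1 ∉ s ++ [y0] := fun h => hdis h hyt
  have hgB := hleft B (((Multiset.le_add_left B A).trans (Multiset.le_add_right _ Q)).trans hE) hB0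
    (hB.cut_pos' (fun h => (hroot _ h.1).2 rfl) ⟨hy0, by simp⟩)
  have hgQ := hleft Q ((Multiset.le_add_left Q _).trans hE) hQ0
    (hQ.cut_pos ⟨hy0, by simp⟩ fun h => hyq h.2)
  have h3 := Multiset.le_iff_count.1 hE s(y0, z)
  rw [Multiset.count_add, Multiset.count_add] at h3
  have hgG : s(y0, z) ∈ lobeEdges G D x0 x1 :=
    mem_lobeEdges_of_mem hD (Multiset.mem_of_le hE (by simp [hright])) (Sym2.mem_mk_left _ _) hy0
  have h2 : G.edges.count s(y0, z) = (lobeEdges G D x0 x1).count s(y0, z) := by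
    rw [lobeEdges, Multiset.count_filter, if_pos (Multiset.mem_filter.1 hgG).2]
  rw [hlobe, Multiset.count_nsmul] at h2
  have h1 := Multiset.nodup_iff_count_le_one.1 (walkEdges_nodup hl) s(y0, z)
  have := Multiset.count_pos.2 hright
  have := Multiset.count_pos.2 hgB
  have := Multiset.count_pos.2 hgQ
  omega

/-- Graphs of type `B_m` have no rooted immersion of `D_m`. -/
lemma TypeB.not_dm {G : MG V} {m : ℕ} {x0 x1 : V} (hne : x0 ≠ x1)
    (h : TypeB G m x0 x1) :
    ¬ Dm G.edges m x0 x1 ((G.verts \ {x0, x1} : Finset V) : Set V) := by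
  obtain ⟨k, C, nL, -, hC, hL, hsum⟩ := h
  rintro ⟨y0, hy0, y1, hy1, hy, A1, B1, hE1, h00, A2, B2, rfl, h01, A3, B3, rfl, h10, A4, B4, rfl,
    h11, A5, R, rfl, hQ, hR⟩
  have hcut : ∀ r, r = x0 ∨ r = x1 → cut G.edges {r} ≤ m + 1 := fun r hr =>
    cut_root_le hne hC (fun i => by
      obtain ⟨-, l, a, b, -, -, c⟩ := hL i
      exact ⟨l, a, b, c⟩) hsum hr
  simp only [Finset.mem_coe, Finset.mem_sdiff, Finset.mem_insert, Finset.mem_singleton,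
    not_or] at hy0 hy1
  have hR0 := Pack.sum_le_cut hR {x0}
  have hR1 := Pack.sum_le_cut hR {x1}
  simp [hne, hne.symm] at hR0 hR1
  have hc0 := hcut x0 (.inl rfl)
  have hc1 := hcut x1 (.inr rfl)
  simp only [← hE1, cut_add] at hc0 hc1
  have p1 := h00.cut_pos (X := {x0}) (by simp) (by simpa using hy0.2.1)
  have p2 := h01.cut_pos (X := {x0}) (by simp) (by simpa using hy1.2.1)
  have p3 := h10.cut_pos (X := {x1}) (by simp) (by simpa using hy0.2.2)
  have p4 := h11.cut_pos (X := {x1}) (by simp) (by simpa using hy1.2.2)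
  obtain ⟨A1', l1, q1, r1⟩ := h00.avoid hne hy0.2.2 (by omega)
  obtain ⟨A2', l2, q2, r2⟩ := h01.avoid hne hy1.2.2 (by omega)
  obtain ⟨A3', l3, q3, r3⟩ := h10.avoid hne.symm hy0.2.1 (by omega)
  obtain ⟨A4', l4, q4, r4⟩ := h11.avoid hne.symm hy1.2.1 (by omega)
  obtain ⟨A5', l5, q5, r5⟩ := hQ.avoid hy0.2.1 hy1.2.1 (by omega)
  obtain ⟨A5'', l5', q5', r5'⟩ := q5.avoid hy0.2.2 hy1.2.2 ((cut_mono l5 _).trans (by omega))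
  have hv0 : y0 ∈ (deleteVerts G {x0, x1}).verts := mem_verts_deleteVerts.2 ⟨hy0.1, by simp [hy0.2]⟩
  have hv1 : y1 ∈ (deleteVerts G {x0, x1}).verts := mem_verts_deleteVerts.2 ⟨hy1.1, by simp [hy1.2]⟩
  obtain ⟨i, hi⟩ := (hC _).1 (isComponent_iff.2 ⟨y0, hv0, rfl⟩)
  have hD := (hC _).2 ⟨i, rfl⟩
  have hi0 : y0 ∈ C i := by rw [hi]; exact Finset.mem_filter.2 ⟨hv0, Cn.refl _ _⟩
  have hi1 : y1 ∈ C i := by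
    rw [hi]
    refine Finset.mem_filter.2 ⟨hv1, q5'.mono_subset fun e he => ?_⟩
    have heA := Multiset.mem_of_le l5' he
    refine mem_edges_deleteVerts.2 ⟨?_, fun v hv => ?_⟩
    · rw [← hE1]; simp [Multiset.mem_of_le l5 heA]
    · simp only [Finset.mem_insert, Finset.mem_singleton, not_or]
      constructor <;> rintro rfl
      exacts [r5 _ heA hv, r5' _ he hv]
  obtain ⟨-, l, hl, hw, hlD, htwo, hlobe⟩ := hL i
  rw [htwo (Finset.one_lt_card.2 ⟨y0, hi0, y1, hi1, hy⟩)] at hlobe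
  have hl0 : y0 ∈ l := by rw [← List.mem_toFinset, hlD]; simp [hi0]
  have hl1 : y1 ∈ l := by rw [← List.mem_toFinset, hlD]; simp [hi1]
  obtain ⟨s, t, hst⟩ := List.append_of_mem hl0
  rw [hst, List.mem_append, List.mem_cons] at hl1
  rcases hl1 with h' | rfl | h'
  · obtain ⟨s', t', rfl⟩ := List.append_of_mem h'
    refine not_cn_of_doubled_lobe hD hl hw hlD hlobe (s := s') (t := t' ++ y0 :: t)
      (by simpa using hst) (by simp) hi1 hi0 (?_ : _ ≤ G.edges) q1 q4 q5.symm r1 r4 r5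
    refine (add_le_add (add_le_add l1 l4) l5).trans ?_
    rw [← hE1, Multiset.le_iff_count]
    intro e
    simp only [Multiset.count_add]
    omega
  · exact hy rfl
  · refine not_cn_of_doubled_lobe hD hl hw hlD hlobe hst h' hi0 hi1 (?_ : _ ≤ G.edges) q2 q3 q5 r2 r3 r5
    refine (add_le_add (add_le_add l2 l3) l5).trans ?_
    rw [← hE1, Multiset.le_iff_count]
    intro e
    simp only [Multiset.count_add]
    omega

lemma mem_te {T : Trl V} {e : Sym2 V} {v : V} (he : e ∈ te T) (hv : v ∈ e) :
    v = T.1 ∨ v ∈ T.2.1 ∨ v = T.2.2 := by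
  simpa using mem_of_mem_walkEdges he hv

lemma walkEdges_subset_te (T : Trl V) : walkEdges T.2.1 ⊆ te T := by
  obtain ⟨a, w, b⟩ := T
  intro e he
  cases w with
  | nil => simp at he
  | cons c w =>
    change e ∈ walkEdges (a :: ((c :: w) ++ [b]))
    rw [List.cons_append, walkEdges_cons_cons, Multiset.mem_cons, ← walkEdges_reverse]
    right
    rw [← walkEdges_reverse] at he
    simp only [List.reverse_append, List.reverse_cons, List.reverse_nil, List.nil_append,
      List.cons_append] at he ⊢
    cases hw : w.reverse ++ [c] with
    | nil => rw [hw] at he; simp at he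
    | cons d s =>
      rw [hw] at he
      rw [walkEdges_cons_cons]
      exact Multiset.mem_cons_of_mem he

namespace Bundle

variable {G : MG V} {m : ℕ} {x0 x1 : V} {F : Multiset (Trl V)} {T T' : Trl V} {U : Set V}
  {E : Multiset (Sym2 V)} {v : V} {e : Sym2 V}

lemma eq_of_mem (h : Bundle E x0 x1 U m F) (hT : T ∈ F) (hT' : T' ∈ F) (hv : v ∈ T.2.1)
    (hv' : v ∈ T'.2.1) : T = T' := by
  by_contra hne
  obtain ⟨F', rfl⟩ := Multiset.exists_cons_of_mem hT
  obtain ⟨F'', rfl⟩ :=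
    Multiset.exists_cons_of_mem ((Multiset.mem_cons.1 hT').resolve_left (Ne.symm hne))
  exact hne (h.same _ _ _ rfl v hv hv')

lemma mem_edges_iff (h : Bundle E x0 x1 U m F) : e ∈ E ↔ ∃ T ∈ F, e ∈ te T := by
  rw [← h.sum, add_zero]
  exact Multiset.mem_bind

lemma eq_direct (h : Bundle E x0 x1 U m F) (hT : T ∈ F) (hw : T.2.1 = []) : T = (x0, [], x1) :=
  Prod.ext (h.ends T hT).1 (Prod.ext hw (h.ends T hT).2)

lemma nodup_path (h : Bundle E x0 x1 U m F) (hC : Conn E x0 x1 U m) (hT : T ∈ F) :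
    (x0 :: (T.2.1 ++ [x1])).Nodup := by
  have h0 : x0 ∉ T.2.1 := fun h' => hC.x0U ((h.ok T hT).2.2 _ h')
  have h1 : x1 ∉ T.2.1 := fun h' => hC.x1U ((h.ok T hT).2.2 _ h')
  have hd : ∀ a ∈ T.2.1, a ≠ x1 := fun a ha hax => h1 (hax ▸ ha)
  simpa [List.nodup_append, h0, hC.ne, h.nodup T hT] using hd

lemma te_eq (h : Bundle E x0 x1 U m F) (hT : T ∈ F) :
    te T = walkEdges (x0 :: (T.2.1 ++ [x1])) := by
  rw [te, seg, (h.ends T hT).1, (h.ends T hT).2]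

lemma exists_inner (h : Bundle E x0 x1 U m F) (hC : Conn E x0 x1 U m) (hT : T ∈ F)
    (he : e ∈ te T) (hne : e ≠ s(x0, x1)) : ∃ v ∈ e, v ∈ T.2.1 := by
  by_contra hc
  push Not at hc
  have hE := h.mem_edges_iff.2 ⟨T, hT, he⟩
  have hl := hC.loopless e hE
  have hm : ∀ v ∈ e, v = x0 ∨ v = x1 := by
    intro v hv
    have := mem_te he hv
    rw [(h.ends T hT).1, (h.ends T hT).2] at this
    have := hc v hv
    tauto
  induction e with | _ a b =>
  rcases hm a (by simp) with rfl | rfl <;> rcases hm b (by simp) with rfl | rfl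
  · simp at hl
  · exact hne rfl
  · exact hne Sym2.eq_swap
  · simp at hl

lemma direct_notMem (h : Bundle E x0 x1 U m F) (hC : Conn E x0 x1 U m) (hT : T ∈ F)
    (hw : T.2.1 ≠ []) : s(x0, x1) ∉ te T := by
  intro he
  have hn := h.nodup_path hC hT
  rw [h.te_eq hT] at he
  obtain ⟨c, w, hcw⟩ := List.exists_cons_of_ne_nil hw
  rw [hcw] at he hn
  have := eq_of_mem_walkEdges (p := []) hn he (by simp) (by simp [hC.ne.symm])
  rw [Sym2.congr_right] at this
  subst this
  simp at hn

lemma count_direct (h : Bundle E x0 x1 U m F) (hC : Conn E x0 x1 U m) :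
    E.count s(x0, x1) = F.count (x0, [], x1) := by
  have h1 : E = (F.map te).sum := by rw [← h.sum, add_zero]
  rw [h1, Multiset.count_sum, Multiset.sum_map_eq_nsmul_single (x0, [], x1)]
  · simp [te, seg]
  · intro T hT hTF
    exact Multiset.count_eq_zero_of_notMem
      (h.direct_notMem hC hTF fun hw => hT (h.eq_direct hTF hw))

lemma two_le_count (h : Bundle E x0 x1 U m F) (hT : T ∈ F) (hw : T.2.1 ≠ []) :
    2 ≤ F.count T := by
  obtain ⟨v, hv⟩ := List.exists_mem_of_ne_nil _ hw
  obtain ⟨T1, T2, F', rfl, h1, h2⟩ := h.multi v ((h.ok T hT).2.2 v hv)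
  have e1 : T = T1 := h.eq_of_mem hT (by simp) hv h1
  have e2 : T = T2 := h.eq_of_mem hT (by simp) hv h2
  simp [← e1, ← e2]

lemma count_eq_two (h : Bundle E x0 x1 U m F) (hT : T ∈ F) (hw : 2 ≤ T.2.1.toFinset.card) :
    F.count T = 2 := by
  obtain ⟨u, hu, v, hv, huv⟩ := Finset.one_lt_card.1 hw
  rw [List.mem_toFinset] at hu hv
  obtain ⟨F', hF, hoff⟩ := h.long T hT u hu v hv huv
  have : T ∉ F' := fun h' => hoff u hu T h' hu
  rw [hF]
  simp [this]

/-- The lobe on the inner vertices of a trail consists of the copies of that trail. -/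
lemma lobeEdges_eq (h : Bundle G.edges x0 x1 U m F) (hC : Conn G.edges x0 x1 U m) (hT : T ∈ F)
    (hw : T.2.1 ≠ []) :
    lobeEdges G T.2.1.toFinset x0 x1 = F.count T • walkEdges (x0 :: (T.2.1 ++ [x1])) := by
  have h1 : G.edges = (F.map te).sum := by rw [← h.sum, add_zero]
  rw [lobeEdges, h1, ← h.te_eq hT]
  set P : Sym2 V → Prop := fun e =>
    (∀ v ∈ e, v ∈ insert x0 (insert x1 T.2.1.toFinset)) ∧ e ≠ s(x0, x1) with hP
  have h2 : ∀ F' : Multiset (Trl V),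
      (F'.map te).sum.filter P = (F'.map fun T' => (te T').filter P).sum := by
    intro F'
    induction F' using Multiset.induction with
    | empty => simp
    | cons a s ih => simp [Multiset.filter_add, ih]
  rw [h2, Multiset.sum_map_eq_nsmul_single T]
  · rw [Multiset.filter_eq_self.2]
    refine fun e he => ⟨fun v hv => ?_, fun heq => h.direct_notMem hC hT hw (heq ▸ he)⟩
    have := mem_te he hv
    rw [(h.ends T hT).1, (h.ends T hT).2] at this
    simp only [Finset.mem_insert, List.mem_toFinset]
    tauto
  · intro T' hne hT'
    rw [Multiset.filter_eq_nil.2]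
    rintro e he ⟨hv, hd⟩
    obtain ⟨v, hve, hvT⟩ := h.exists_inner hC hT' he hd
    have hU := (h.ok T' hT').2.2 v hvT
    have := hv v hve
    simp only [Finset.mem_insert, List.mem_toFinset] at this
    rcases this with rfl | rfl | hvT'
    · exact hC.x0U hU
    · exact hC.x1U hU
    · exact hne (h.eq_of_mem hT' hT hvT hvT')

lemma component_eq (h : Bundle G.edges x0 x1 ((G.verts \ {x0, x1} : Finset V) : Set V) m F)
    (hT : T ∈ F) (hv : v ∈ T.2.1) :
    (deleteVerts G {x0, x1}).verts.filter (Cn (deleteVerts G {x0, x1}).edges v) =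
      T.2.1.toFinset := by
  have hU : ∀ T' ∈ F, ∀ u ∈ T'.2.1, u ∈ (deleteVerts G {x0, x1}).verts := by
    intro T' hT' u hu
    have := (h.ok T' hT').2.2 u hu
    rw [mem_verts_deleteVerts]
    simpa using this
  ext u
  rw [Finset.mem_filter, List.mem_toFinset]
  constructor
  · rintro ⟨-, hu⟩
    induction hu with
    | refl => exact hv
    | @tail a b _ hab ih =>
      rw [mem_edges_deleteVerts] at hab
      obtain ⟨T', hT', he⟩ := h.mem_edges_iff.1 hab.1
      have ha := hab.2 a (by simp)
      have hb := hab.2 b (by simp)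
      have ha' := mem_te he (Sym2.mem_mk_left a b)
      have hb' := mem_te he (Sym2.mem_mk_right a b)
      rw [(h.ends T' hT').1, (h.ends T' hT').2] at ha' hb'
      simp only [Finset.mem_insert, Finset.mem_singleton, not_or] at ha hb
      have haT : a ∈ T'.2.1 := by tauto
      rw [h.eq_of_mem hT hT' ih haT]
      tauto
  · refine fun hu => ⟨hU T hT u hu, (Cn.of_walk hv hu).mono_subset fun e he => ?_⟩
    refine mem_edges_deleteVerts.2 ⟨h.mem_edges_iff.2 ⟨T, hT, walkEdges_subset_te T he⟩,
      fun z hz => ?_⟩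
    exact (mem_verts_deleteVerts.1 (hU T hT z (mem_of_mem_walkEdges he hz))).2

/-- A graph whose edges form bundles of parallel trails has type `B_m`. -/
lemma typeB (h : Bundle G.edges x0 x1 ((G.verts \ {x0, x1} : Finset V) : Set V) m F)
    (hC : Conn G.edges x0 x1 ((G.verts \ {x0, x1} : Finset V) : Set V) m) : TypeB G m x0 x1 := by
  set S : Finset (Trl V) := F.toFinset.erase (x0, [], x1) with hS
  have hSF : ∀ T ∈ S, T ∈ F ∧ T.2.1 ≠ [] := by
    intro T hT
    rw [hS, Finset.mem_erase, Multiset.mem_toFinset] at hT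
    exact ⟨hT.2, fun hw => hT.1 (h.eq_direct hT.2 hw)⟩
  have hFS : ∀ T ∈ F, ∀ v ∈ T.2.1, T ∈ S := by
    intro T hT v hv
    rw [hS, Finset.mem_erase, Multiset.mem_toFinset]
    refine ⟨?_, hT⟩
    rintro rfl
    simp at hv
  let f := S.equivFin.symm
  refine ⟨S.card, fun i => (f i).1.2.1.toFinset, fun i => F.count (f i).1, ?_, ?_, ?_, ?_⟩
  · intro i j hij
    obtain ⟨hi, hwi⟩ := hSF _ (f i).2
    obtain ⟨v, hv⟩ := List.exists_mem_of_ne_nil _ hwi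
    have hv' : v ∈ (f j).1.2.1.toFinset := hij.subset (List.mem_toFinset.2 hv)
    exact f.injective (Subtype.ext (h.eq_of_mem hi (hSF _ (f j).2).1 hv (List.mem_toFinset.1 hv')))
  · intro D
    rw [isComponent_iff]
    constructor
    · rintro ⟨v, hv, rfl⟩
      obtain ⟨T, T', F', hF, hvT, -⟩ := h.multi v (by
        rw [mem_verts_deleteVerts] at hv
        simpa using hv)
      have hT : T ∈ F := by simp [hF]
      refine ⟨f.symm ⟨T, hFS T hT v hvT⟩, ?_⟩
      rw [h.component_eq hT hvT]
      simp
    · rintro ⟨i, rfl⟩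
      obtain ⟨hi, hwi⟩ := hSF _ (f i).2
      obtain ⟨v, hv⟩ := List.exists_mem_of_ne_nil _ hwi
      refine ⟨v, ?_, (h.component_eq hi hv).symm⟩
      have := List.mem_toFinset.2 hv
      rw [← h.component_eq hi hv] at this
      exact (Finset.mem_filter.1 this).1
  · intro i
    obtain ⟨hi, hwi⟩ := hSF _ (f i).2
    refine ⟨h.two_le_count hi hwi, _, h.nodup_path hC hi, ⟨rfl, ?_⟩, ?_, h.count_eq_two hi,
      h.lobeEdges_eq hC hi hwi⟩
    · rw [← List.cons_append, List.getLast?_concat]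
    · ext v
      simp only [List.toFinset_cons, List.toFinset_append, List.toFinset_nil, Finset.mem_insert,
        Finset.mem_union, Finset.notMem_empty, or_false]
      tauto
  · have hsum : ∑ i, F.count (f i).1 = ∑ T ∈ S, F.count T := by
      rw [Equiv.sum_comp f fun T : S => F.count T.1]
      exact Finset.sum_coe_sort S fun T => F.count T
    rw [hsum, emult, h.count_direct hC, ← h.card, ← Multiset.toFinset_sum_count_eq F]
    by_cases h0 : (x0, [], x1) ∈ F.toFinset
    · exact Finset.add_sum_erase _ (fun T => F.count T) h0
    · rw [Multiset.count_eq_zero_of_notMem fun h' => h0 (Multiset.mem_toFinset.2 h'), zero_add, hS,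
        Finset.erase_eq_of_notMem h0]

end Bundle

/-- Let `m ≥ 2` and let `G` be a rooted graph with roots `x0, x1`
such that `|V(G)| ≥ 4`, `λ_n(G) ≥ 3`, `λ_n^i(G) ≥ 4`, and `λ_s(G) ≥ m`.  Then `G`
has no rooted immersion of `D_m` if and only if `G` has type `A_m` or type `B_m`. -/
theorem statement_2 {V : Type} (G : MG V) (x0 x1 : V) (m : ℕ)
    (hm : 2 ≤ m) (hconn : Connected G)
    (hx0 : x0 ∈ G.verts) (hx1 : x1 ∈ G.verts) (hne : x0 ≠ x1)
    (hcard : 4 ≤ G.verts.card)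
    (hln : LamNGe G x0 x1 3) (hlni : LamNiGe G x0 x1 4) (hls : LamSGe G x0 x1 m) :
    ¬ HasRootedDmImmersion G m x0 x1 ↔ (TypeA G m x0 x1 ∨ TypeB G m x0 x1) := by
  rw [hasRootedDmImmersion_iff hx0 hx1 hne]
  constructor
  · intro hD
    have hC := conn_of_lam hx0 hx1 hne hln hlni hls
    by_cases htight : ∃ S : Finset V, S ⊆ G.verts \ {x0, x1} ∧ S.Nonempty ∧
        S ≠ G.verts \ {x0, x1} ∧ cut G.edges (insert x0 (S : Set V)) = m
    · obtain ⟨S, hSU, hS0, hS1, hS⟩ := htight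
      exact .inl (typeA_of_tight hx0 hx1 hm hC hD hSU hS hS0 hS1)
    · have hU : 1 < (G.verts \ {x0, x1}).card := by
        have := Finset.le_card_sdiff ({x0, x1} : Finset V) G.verts
        rw [Finset.card_pair hne] at this
        omega
      have hcls : Cls G.edges x0 x1 ((G.verts \ {x0, x1} : Finset V) : Set V) m := by
        refine { hC with nontrivial := Finset.one_lt_card_iff_nontrivial.1 hU, si := ?_ }
        intro X hX0 hXU hX1
        obtain ⟨S, rfl⟩ := ((Finset.finite_toSet _).subset hXU).exists_finset_coe
        refine lt_of_le_of_ne (hC.s _ hXU) fun heq => htight ⟨S, Finset.coe_subset.1 hXU,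
          Finset.coe_nonempty.1 hX0, fun h => hX1 (by rw [h]), heq.symm⟩
      obtain ⟨F, hF⟩ := hcls.exists_bundle hm hD
      exact .inr (hF.typeB hC)
  · rintro (h | h)
    · exact h.not_dm hm
    · exact h.not_dm hne

end PaperW4
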